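/- Let X be a regular element of g⊗A. Then the orbit of X under the adjoint group of g⊗A meets the affine subspace t = x₊⊗1 + g^{x₋}⊗A. -/

import Mathlib

open scoped TensorProduct

/-- The ideal `⟨t^ω : ω ≰ μ⟩` of `F[t₁,…,t_ℓ]`. -/
noncomputable def truncIdeal (F : Type*) [Field F] {ℓ : ℕ} (μ : Fin ℓ → ℕ) :
    Ideal (MvPolynomial (Fin ℓ) F) :=
  Ideal.span ((fun ω : Fin ℓ → ℕ =>
    MvPolynomial.monomial (Finsupp.equivFunOnFinite.symm ω) (1 : F)) '' {ω | ¬ ω ≤ μ})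

/-- The truncated polynomial algebra `A = F[t₁,…,t_ℓ]/⟨t^ω : ω ≰ μ⟩`. -/
noncomputable abbrev trunc (F : Type*) [Field F] {ℓ : ℕ} (μ : Fin ℓ → ℕ) : Type _ :=
  MvPolynomial (Fin ℓ) F ⧸ truncIdeal F μ

/-- The Lie algebra structure over `F` on `A ⊗[F] g`. -/
noncomputable instance tensorLieAlgebra {F : Type*} [Field F] {A : Type*} [CommRing A]
    [Algebra F A] {g : Type*} [LieRing g] [LieAlgebra F g] :
    LieAlgebra F (A ⊗[F] g) where
  lie_smul t x y := by
    rw [← algebraMap_smul A t y, lie_smul, algebraMap_smul]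

/-- The centralizer `L^x = {y ∈ L : ⁅x, y⁆ = 0}` of an element `x` of a Lie algebra. -/
noncomputable def cent (F : Type*) [Field F] (L : Type*) [LieRing L] [LieAlgebra F L]
    (x : L) : Submodule F L where
  carrier := {y | ⁅x, y⁆ = 0}
  add_mem' := by
    intro a b ha hb
    simp only [Set.mem_setOf_eq] at *
    rw [lie_add, ha, hb, add_zero]
  zero_mem' := by simp
  smul_mem' := by
    intro c a ha
    simp only [Set.mem_setOf_eq] at *
    rw [lie_smul, ha, smul_zero]

/-- An element of a finite-dimensional Lie algebra is regular if its centralizer has the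
minimal possible dimension. -/
def isRegular (F : Type*) [Field F] (L : Type*) [LieRing L] [LieAlgebra F L]
    (x : L) : Prop :=
  Module.finrank F (cent F L x) = sInf (Set.range fun z : L => Module.finrank F (cent F L z))

/-- The exponential of a (nilpotent) endomorphism of a finite-dimensional space in
characteristic zero: `exp N = ∑_{n ≤ dim} N^n / n!` (when `N` is nilpotent, all terms of
the series beyond the dimension vanish). -/
noncomputable def expEnd {F : Type*} [Field F] {M : Type*} [AddCommGroup M] [Module F M]
    (N : Module.End F M) : Module.End F M :=
  ∑ n ∈ Finset.range (Module.finrank F M + 1), ((n.factorial : F)⁻¹) • N ^ n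

/-- `reach F L X Y` holds if `Y` is obtained from `X` by applying an element of the
adjoint group of `L`, i.e. a finite composition of automorphisms `exp (ad N)` with
`ad N` nilpotent. -/
def reach (F : Type*) [Field F] (L : Type*) [LieRing L] [LieAlgebra F L]
    (X Y : L) : Prop :=
  ∃ l : List L, (∀ N ∈ l, IsNilpotent ((LieAlgebra.ad F L N : Module.End F L)))
    ∧ l.foldr (fun N v => expEnd (LieAlgebra.ad F L N : Module.End F L) v) X = Y

/-- The subspace `g^{x₋} ⊗ A` of `A ⊗ g`. -/
noncomputable def centSub (F : Type*) [Field F] {A : Type*} [CommRing A] [Algebra F A]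
    {g : Type*} [LieRing g] [LieAlgebra F g] (xm : g) : Submodule F (A ⊗[F] g) :=
  LinearMap.range (TensorProduct.map (LinearMap.id : A →ₗ[F] A) (cent F g xm).subtype)

/-- The transversal slice `t = x₊ ⊗ 1 + g^{x₋} ⊗ A ⊆ g ⊗ A`. -/
def tSlice (F : Type*) [Field F] {A : Type*} [CommRing A] [Algebra F A]
    {g : Type*} [LieRing g] [LieAlgebra F g] (xp xm : g) : Set (A ⊗[F] g) :=
  {Z | Z - (1 : A) ⊗ₜ[F] xp ∈ centSub F xm}

section
open scoped TensorProduct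
set_option linter.unusedSectionVars false
set_option linter.unusedVariables false

section ExpBasics
variable {F : Type*} [Field F] [CharZero F] {L : Type*} [LieRing L] [LieAlgebra F L]
  [FiniteDimensional F L]

lemma expEnd_apply_of_pow {M : Type*} [AddCommGroup M] [Module F M] [FiniteDimensional F M]
    (D : Module.End F M) (hD : IsNilpotent D) (m : ℕ) (v : M) (hv : (D ^ m) v = 0) :
    expEnd D v = ∑ n ∈ Finset.range m, ((n.factorial : F)⁻¹) • (D ^ n) v := by
  have hK : D ^ (Module.finrank F M + 1) = 0 := by
    have h1 := (LinearMap.isNilpotent_iff_charpoly D).1 hD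
    have h2 := LinearMap.aeval_self_charpoly D
    rw [h1] at h2
    rw [pow_succ, show D ^ Module.finrank F M = 0 by simpa using h2, zero_mul]
  have key : ∀ a b : ℕ, a ≤ b → (D ^ a) v = 0 →
      ∑ n ∈ Finset.range a, ((n.factorial : F)⁻¹) • (D ^ n) v
      = ∑ n ∈ Finset.range b, ((n.factorial : F)⁻¹) • (D ^ n) v := by
    intro a b hab ha
    refine Finset.sum_subset (Finset.range_mono hab) ?_
    intro n _ hn
    have hn' : a ≤ n := by simpa using hn
    obtain ⟨c, rfl⟩ := Nat.exists_eq_add_of_le hn'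
    rw [add_comm, pow_add, Module.End.mul_apply, ha, map_zero, smul_zero]
  have h1 : expEnd D v = ∑ n ∈ Finset.range (Module.finrank F M + 1),
      ((n.factorial : F)⁻¹) • (D ^ n) v := by
    simp [expEnd, LinearMap.sum_apply]
  rw [h1]
  rcases le_total m (Module.finrank F M + 1) with h | h
  · exact (key _ _ h hv).symm
  · exact key _ _ h (by rw [hK]; rfl)

lemma expEnd_apply_sub_mem {M : Type*} [AddCommGroup M] [Module F M] [FiniteDimensional F M]
    (D : Module.End F M) (hD : IsNilpotent D) (W : Submodule F M) (v : M)
    (hv : ∀ n, 2 ≤ n → (D ^ n) v ∈ W) :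
    expEnd D v - (v + D v) ∈ W := by
  obtain ⟨m, hm⟩ := hD
  have hm2 : D ^ (m + 2) = 0 := by rw [pow_add, hm, zero_mul]
  rw [expEnd_apply_of_pow D ⟨m, hm⟩ (m + 2) v (by rw [hm2]; rfl)]
  rw [Finset.sum_range_succ', Finset.sum_range_succ']
  simp only [zero_add, pow_one, pow_zero, Module.End.one_apply, Nat.factorial_zero, Nat.factorial_one,
    Nat.cast_one, inv_one, one_smul]
  have : ∀ a b c : M, a + b + c - (c + b) = a := by intros; abel
  rw [this]
  exact Submodule.sum_mem _ fun n _ => W.smul_mem _ (hv _ (by omega))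

lemma exists_lieEquiv_expEnd (N : L) (hN : IsNilpotent (LieAlgebra.ad F L N : Module.End F L)) :
    ∃ θ : L ≃ₗ⁅F⁆ L, ∀ v, θ v = expEnd (LieAlgebra.ad F L N : Module.End F L) v := by
  let _ : Module ℚ L := Module.compHom L (algebraMap ℚ F)
  have : IsScalarTower ℚ F L := IsScalarTower.of_algebraMap_smul (fun r x => rfl)
  let _ : LieAlgebra ℚ L :=
    { lie_smul := fun t x y => by
        change ⁅x, (algebraMap ℚ F t) • y⁆ = (algebraMap ℚ F t) • ⁅x, y⁆
        rw [lie_smul] }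
  refine ⟨LieDerivation.exp (LieDerivation.ad F L N) (by
    have : (LieDerivation.ad F L N).toLinearMap = LieAlgebra.ad F L N := by
      ext; simp
    rw [this]; exact hN), ?_⟩
  intro v
  have : (LieDerivation.ad F L N).toLinearMap = LieAlgebra.ad F L N := by
      ext; simp
  rw [LieDerivation.exp_map_apply, this]
  obtain ⟨m, hm⟩ := hN
  rw [IsNilpotent.exp_eq_sum hm, expEnd_apply_of_pow _ ⟨m, hm⟩ m v (by rw [hm]; rfl)]
  rw [LinearMap.sum_apply]
  refine Finset.sum_congr rfl fun n _ => ?_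
  rw [LinearMap.smul_apply]
  rw [← algebraMap_smul F ((n.factorial : ℚ)⁻¹)]
  simp

/-- inner automorphisms -/
def Inn (θ : L ≃ₗ⁅F⁆ L) : Prop :=
  ∃ l : List L, (∀ N ∈ l, IsNilpotent ((LieAlgebra.ad F L N : Module.End F L)))
    ∧ ∀ v, l.foldr (fun N v => expEnd (LieAlgebra.ad F L N : Module.End F L) v) v = θ v

lemma Inn.reach {θ : L ≃ₗ⁅F⁆ L} (h : Inn θ) (X : L) : reach F L X (θ X) := by
  obtain ⟨l, h1, h2⟩ := h
  exact ⟨l, h1, h2 X⟩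

lemma Inn.refl : Inn (LieEquiv.refl : L ≃ₗ⁅F⁆ L) := ⟨[], by simp, by simp⟩

lemma Inn.trans {θ η : L ≃ₗ⁅F⁆ L} (h : Inn θ) (h' : Inn η) : Inn (θ.trans η) := by
  obtain ⟨l, h1, h2⟩ := h
  obtain ⟨l', h1', h2'⟩ := h'
  refine ⟨l' ++ l, ?_, ?_⟩
  · intro N hN
    rcases List.mem_append.1 hN with h | h
    · exact h1' N h
    · exact h1 N h
  · intro v
    rw [List.foldr_append, h2, h2', LieEquiv.trans_apply]

lemma Inn.of_exp {θ : L ≃ₗ⁅F⁆ L} (N : L)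
    (hN : IsNilpotent (LieAlgebra.ad F L N : Module.End F L))
    (h : ∀ v, θ v = expEnd (LieAlgebra.ad F L N : Module.End F L) v) : Inn θ :=
  ⟨[N], by simpa using hN, fun v => by simp [h]⟩

/-- the exponential automorphism -/
noncomputable def expAut (N : L) (hN : IsNilpotent (LieAlgebra.ad F L N : Module.End F L)) :
    L ≃ₗ⁅F⁆ L := (exists_lieEquiv_expEnd N hN).choose

lemma expAut_apply (N : L) (hN : IsNilpotent (LieAlgebra.ad F L N : Module.End F L)) (v : L) :
    expAut N hN v = expEnd (LieAlgebra.ad F L N : Module.End F L) v :=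
  (exists_lieEquiv_expEnd N hN).choose_spec v

lemma expAut_inn (N : L) (hN : IsNilpotent (LieAlgebra.ad F L N : Module.End F L)) :
    Inn (expAut N hN) := Inn.of_exp N hN (expAut_apply N hN)

lemma expEnd_mul_neg {M : Type*} [AddCommGroup M] [Module F M] [FiniteDimensional F M]
    (D : Module.End F M) (hD : IsNilpotent D) : expEnd (-D) * expEnd D = 1 := by
  let _ : Module ℚ M := Module.compHom M (algebraMap ℚ F)
  have : IsScalarTower ℚ F M := IsScalarTower.of_algebraMap_smul (fun r x => rfl)
  have key : ∀ D : Module.End F M, IsNilpotent D → expEnd D = IsNilpotent.exp D := by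
    intro D hD
    ext v
    obtain ⟨m, hm⟩ := hD
    rw [IsNilpotent.exp_eq_sum hm, expEnd_apply_of_pow _ ⟨m, hm⟩ m v (by rw [hm]; rfl)]
    rw [LinearMap.sum_apply]
    refine Finset.sum_congr rfl fun n _ => ?_
    rw [LinearMap.smul_apply]
    rw [← algebraMap_smul F ((n.factorial : ℚ)⁻¹)]
    simp
  rw [key D hD, key (-D) hD.neg]
  exact hD.exp_neg_mul_exp_self

lemma Inn.symm {θ : L ≃ₗ⁅F⁆ L} (h : Inn θ) : Inn θ.symm := by
  obtain ⟨l, h1, h2⟩ := h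
  induction l generalizing θ with
  | nil =>
    refine ⟨[], by simp, fun v => ?_⟩
    have := h2 (θ.symm v)
    simp at this ⊢
    exact this.symm
  | cons N l ih =>
    have hN := h1 N (by simp)
    have hN' : IsNilpotent (LieAlgebra.ad F L (-N) : Module.End F L) := by
      rw [map_neg]; exact hN.neg
    set η := θ.trans (expAut (-N) hN') with hη
    have hη2 : ∀ v, l.foldr (fun N v => expEnd (LieAlgebra.ad F L N : Module.End F L) v) v = η v := by
      intro v
      rw [hη, LieEquiv.trans_apply, ← h2 v, List.foldr_cons, expAut_apply, map_neg,
        ← Module.End.mul_apply, expEnd_mul_neg _ hN]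
      rfl
    have := ih (fun M hM => h1 M (by simp [hM])) hη2
    have h3 := (expAut_inn (-N) hN').trans this
    convert h3 using 1
    ext v
    rw [LieEquiv.trans_apply]
    apply η.injective
    change η (θ.symm v) = η (η.symm _)
    rw [LieEquiv.apply_symm_apply, hη, LieEquiv.trans_apply, LieEquiv.apply_symm_apply]

/-- two elements are related by an inner automorphism -/
def InnRel (F : Type*) [Field F] {L : Type*} [LieRing L] [LieAlgebra F L] (X Y : L) : Prop :=
  ∃ θ : L ≃ₗ⁅F⁆ L, Inn θ ∧ θ X = Y

lemma InnRel.refl (X : L) : InnRel F X X := ⟨LieEquiv.refl, Inn.refl, rfl⟩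

lemma InnRel.trans {X Y Z : L} (h : InnRel F X Y) (h' : InnRel F Y Z) : InnRel F X Z := by
  obtain ⟨θ, h1, rfl⟩ := h
  obtain ⟨η, h2, rfl⟩ := h'
  exact ⟨θ.trans η, h1.trans h2, by rw [LieEquiv.trans_apply]⟩

lemma InnRel.symm {X Y : L} (h : InnRel F X Y) : InnRel F Y X := by
  obtain ⟨θ, h1, rfl⟩ := h
  exact ⟨θ.symm, h1.symm, by simp⟩

lemma InnRel.exp (N : L) (hN : IsNilpotent (LieAlgebra.ad F L N : Module.End F L)) (X : L) :
    InnRel F X (expEnd (LieAlgebra.ad F L N : Module.End F L) X) :=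
  ⟨expAut N hN, expAut_inn N hN, expAut_apply N hN X⟩

end ExpBasics
end

section
open scoped TensorProduct
set_option linter.unusedSectionVars false
set_option linter.unusedVariables false

section Sl2
variable {F : Type*} [Field F] [CharZero F] {V : Type*} [AddCommGroup V] [Module F V]
  [FiniteDimensional F V]

/-- an sl2-triple of operators -/
structure OpTriple (h e f : Module.End F V) : Prop where
  he : h * e = e * h + (2 : F) • e
  hf : h * f = f * h - (2 : F) • f
  ef : e * f = f * e + h

lemma isNilpotent_of_shift (h e : Module.End F V) (c : F) (hc : c ≠ 0)
    (he : h * e = e * h + c • e) : IsNilpotent e := by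
  have key : ∀ k : ℕ, h * e ^ k = e ^ k * h + (k * c) • e ^ k := by
    intro k
    induction k with
    | zero => simp
    | succ k ih =>
      rw [pow_succ, ← mul_assoc, ih, add_mul, mul_assoc, he, mul_add, ← mul_assoc]
      simp only [smul_mul_assoc, mul_smul_comm, Nat.cast_succ, add_mul, one_mul, add_smul]
      abel
  by_contra hn
  have hne : ∀ k, e ^ k ≠ 0 := fun k hk => hn ⟨k, hk⟩
  have hinj : Function.Injective (fun k : ℕ => (k : F) * c) := by
    intro a b hab
    exact_mod_cast mul_right_cancel₀ hc hab
  have hli := Module.End.eigenvectors_linearIndependent'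
    (LinearMap.mulLeft F h - LinearMap.mulRight F h) (fun k : ℕ => (k : F) * c) hinj
    (fun k => e ^ k) (fun k => ⟨Module.End.mem_eigenspace_iff.2 (by
      simp [key k]), hne k⟩)
  exact not_finite_iff_infinite.2 inferInstance (hli.finite)

namespace OpTriple
variable {h e f : Module.End F V}

lemma he' (T : OpTriple h e f) (v : V) : h (e v) = e (h v) + (2 : F) • e v := by
  simpa using LinearMap.congr_fun T.he v
lemma hf' (T : OpTriple h e f) (v : V) : h (f v) = f (h v) - (2 : F) • f v := by
  simpa using LinearMap.congr_fun T.hf v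
lemma ef' (T : OpTriple h e f) (v : V) : e (f v) = f (e v) + h v := by
  simpa using LinearMap.congr_fun T.ef v

lemma swap (T : OpTriple h e f) : OpTriple (-h) f e where
  he := by rw [neg_mul, T.hf, mul_neg]; abel
  hf := by rw [neg_mul, T.he, mul_neg]; abel
  ef := by rw [T.ef]; abel

lemma nil_e (T : OpTriple h e f) : IsNilpotent e :=
  isNilpotent_of_shift h e 2 two_ne_zero T.he
lemma nil_f (T : OpTriple h e f) : IsNilpotent f := T.swap.nil_e

lemma h_pow_f (T : OpTriple h e f) (j : ℕ) (v : V) :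
    h ((f ^ j) v) = (f ^ j) (h v) - (2 * j : F) • (f ^ j) v := by
  induction j with
  | zero => simp
  | succ j ih =>
    rw [pow_succ', Module.End.mul_apply, Module.End.mul_apply, T.hf', ih]
    simp only [map_sub, map_smul, Nat.cast_succ]
    module

lemma h_pow_e (T : OpTriple h e f) (j : ℕ) (v : V) :
    h ((e ^ j) v) = (e ^ j) (h v) + (2 * j : F) • (e ^ j) v := by
  have := T.swap.h_pow_f j v
  simp only [LinearMap.neg_apply, map_neg] at this
  rw [← neg_inj, this]; module

lemma e_pow_f (T : OpTriple h e f) (j : ℕ) (v : V) (hv : e v = 0) :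
    e ((f ^ (j + 1)) v) = (j + 1 : F) • (f ^ j) (h v - (j : F) • v) := by
  induction j with
  | zero => simp [T.ef', hv]
  | succ j ih =>
    rw [pow_succ', Module.End.mul_apply, T.ef', ih, T.h_pow_f]
    have : f ((f ^ j) (h v - (j : F) • v)) = (f ^ (j+1)) (h v - (j : F) • v) := by
      rw [pow_succ', Module.End.mul_apply]
    rw [map_smul, this]
    simp only [map_sub, map_smul, Nat.cast_succ]
    module

lemma h_ker_e (T : OpTriple h e f) (v : V) (hv : e v = 0) : e (h v) = 0 := by
  have := T.he' v
  simpa [hv] using this.symm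

open Polynomial in
lemma e_aeval (T : OpTriple h e f) (p : F[X]) (v : V) :
    e (aeval h p v) = aeval h (p.comp (X - C 2)) (e v) := by
  induction p using Polynomial.induction_on' with
  | add p q hp hq => simp [hp, hq]
  | monomial n a =>
    have : ∀ v : V, e ((h ^ n) v) = ((h - algebraMap F _ 2) ^ n) (e v) := by
      induction n with
      | zero => simp
      | succ n ih =>
        intro v
        rw [pow_succ, Module.End.mul_apply, ih, pow_succ, Module.End.mul_apply]
        congr 1
        simp [T.he', Module.algebraMap_end_apply]
    simp [← C_mul_X_pow_eq_monomial, Module.algebraMap_end_apply, this]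

/-- the polynomial `∏_{i<n} (X - i)` -/
noncomputable def Q (F : Type*) [Field F] (n : ℕ) : Polynomial F :=
  ∏ i ∈ Finset.range n, (Polynomial.X - Polynomial.C (i : F))

open Polynomial in
lemma aeval_ker_e (T : OpTriple h e f) (p : F[X]) (v : V) (hv : e v = 0) :
    e (aeval h p v) = 0 := by
  rw [T.e_aeval, hv, map_zero]

open Polynomial in
lemma e_pow_f_pow (T : OpTriple h e f) (j : ℕ) (v : V) (hv : e v = 0) :
    (e ^ j) ((f ^ j) v) = (j.factorial : F) • aeval h (Q F j) v := by
  induction j generalizing v with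
  | zero => simp [Q]
  | succ j ih =>
    rw [pow_succ, Module.End.mul_apply, T.e_pow_f j v hv, map_smul, ih]
    · have hQ : Q F (j+1) = Q F j * (X - C (j:F)) := by rw [Q, Finset.prod_range_succ, ← Q]
      rw [hQ, map_mul, Module.End.mul_apply, smul_smul]
      simp [Nat.factorial_succ, Nat.cast_smul_eq_nsmul]
    · simp [T.h_ker_e v hv, hv]

open Polynomial in
/-- On `ker e` the operator `h` is killed by some `Q n`. -/
lemma exists_Q (T : OpTriple h e f) : ∃ n, ∀ v, e v = 0 → aeval h (Q F n) v = 0 := by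
  obtain ⟨n, hn⟩ := T.nil_f
  refine ⟨n, fun v hv => ?_⟩
  have := T.e_pow_f_pow n v hv
  rw [hn, LinearMap.zero_apply, map_zero] at this
  exact (smul_eq_zero.1 this.symm).resolve_left (by exact_mod_cast n.factorial_ne_zero)

open Polynomial in
/-- eigenspaces span the kernel of a product of distinct linear factors -/
lemma mem_iSup_of_Q (h : Module.End F V) (n : ℕ) (v : V) (hv : aeval h (Q F n) v = 0) :
    v ∈ ⨆ i : ℕ, Module.End.eigenspace h (i : F) := by
  induction n generalizing v with
  | zero => simp [Q] at hv; simp [hv]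
  | succ n ih =>
    have hco : IsCoprime (Q F n) (X - C (n : F)) := by
      rw [Q]
      refine IsCoprime.prod_left fun i hi => ?_
      refine Polynomial.isCoprime_X_sub_C_of_isUnit_sub ?_
      rw [isUnit_iff_ne_zero, sub_ne_zero]
      have := Finset.mem_range.1 hi
      exact_mod_cast this.ne
    have hQ : Q F (n+1) = Q F n * (X - C (n:F)) := by rw [Q, Finset.prod_range_succ, ← Q]
    obtain ⟨a, b, hab⟩ := hco
    have : v = aeval h (b * (X - C (n:F))) v + aeval h (a * Q F n) v := by
      rw [← LinearMap.add_apply, ← map_add, add_comm, hab]; simp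
    rw [this]
    refine Submodule.add_mem _ (ih _ ?_) ?_
    · rw [← Module.End.mul_apply, ← map_mul, show Q F n * (b * (X - C (n:F))) = b * Q F (n+1) by
        rw [hQ]; ring, map_mul, Module.End.mul_apply, hv, map_zero]
    · refine Submodule.mem_iSup_of_mem n ?_
      rw [Module.End.mem_eigenspace_iff, ← sub_eq_zero]
      have : aeval h (X - C (n:F)) (aeval h (a * Q F n) v) = 0 := by
        rw [← Module.End.mul_apply, ← map_mul, show (X - C (n:F)) * (a * Q F n) = a * Q F (n+1) by
          rw [hQ]; ring, map_mul, Module.End.mul_apply, hv, map_zero]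
      simpa [Module.algebraMap_end_apply, Nat.cast_smul_eq_nsmul] using this

lemma ker_e_le (T : OpTriple h e f) (v : V) (hv : e v = 0) :
    v ∈ ⨆ i : ℕ, Module.End.eigenspace h (i : F) := by
  obtain ⟨n, hn⟩ := T.exists_Q
  exact mem_iSup_of_Q h n v (hn v hv)


lemma casimir_f (T : OpTriple h e f) (v : V) :
    (4:F) • f (e (f v)) + h (h (f v)) + (2:F) • h (f v) =
      f ((4:F) • f (e v) + h (h v) + (2:F) • h v) := by
  simp only [T.ef', T.hf', map_add, map_sub, map_smul]
  module

lemma casimir_pow_f (T : OpTriple h e f) (k : ℕ) (v : V) :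
    (4:F) • f (e ((f ^ k) v)) + h (h ((f ^ k) v)) + (2:F) • h ((f ^ k) v) =
      (f ^ k) ((4:F) • f (e v) + h (h v) + (2:F) • h v) := by
  induction k with
  | zero => simp
  | succ k ih =>
    rw [pow_succ', Module.End.mul_apply, T.casimir_f, ih, Module.End.mul_apply]

lemma inj_fe (T : OpTriple h e f) (a : ℕ) (w : V) (hw : h w = -(a + 2 : F) • w)
    (hfe : f (e w) = 0) : w = 0 := by
  by_contra hne
  have hex : ∃ k, (f ^ k) w = 0 := by
    obtain ⟨n, hn⟩ := T.nil_f
    exact ⟨n, by rw [hn]; rfl⟩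
  classical
  obtain ⟨k, hk⟩ : ∃ k, Nat.find hex = k + 1 := by
    refine Nat.exists_eq_succ_of_ne_zero fun h0 => ?_
    have := Nat.find_spec hex
    rw [h0] at this
    exact hne (by simpa using this)
  have h1 : f ((f ^ k) w) = 0 := by
    have := Nat.find_spec hex
    rwa [hk, pow_succ', Module.End.mul_apply] at this
  have h2 : (f ^ k) w ≠ 0 := Nat.find_min hex (by omega)
  have h3 : h ((f ^ k) w) = -(a + 2 + 2 * k : F) • (f ^ k) w := by
    rw [T.h_pow_f, hw, map_smul]; module
  have h4 := T.casimir_pow_f k w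
  have h5 : f (e ((f ^ k) w)) = - h ((f ^ k) w) := by
    have := T.ef' ((f ^ k) w)
    rw [h1, map_zero] at this
    rw [eq_neg_iff_add_eq_zero]; exact this.symm
  rw [h5, h3, hfe, hw] at h4
  simp only [map_smul, h3, hw, smul_zero, zero_add, map_add] at h4
  rw [← sub_eq_zero] at h4
  have h6 : (((a + 2 + 2 * k : ℕ) * (a + 2 + 2 * k + 2 : ℕ) : F) - ((a * (a + 2) : ℕ) : F)) • (f ^ k) w = 0 := by
    rw [← h4]; push_cast; module
  have h7 := (smul_eq_zero.1 h6).resolve_right h2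
  rw [sub_eq_zero] at h7
  have h8 : (a + 2 + 2 * k) * (a + 2 + 2 * k + 2) = a * (a + 2) := by exact_mod_cast h7
  nlinarith

open Polynomial in
/-- `ker f ∩ im e = 0` on eigenvectors -/
lemma ker_f_im_e_aux (T : OpTriple h e f) (a : ℕ) (w : V) (hw : h (e w) = -(a : F) • e w)
    (hfe : f (e w) = 0) : e w = 0 := by
  obtain ⟨n, hn⟩ := T.exists_Q
  have h1 : e (h w + (a + 2 : F) • w) = 0 := by
    have := T.he' w
    rw [hw] at this
    rw [map_add, map_smul, ← sub_eq_zero.2 this.symm]; module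
  have h2 := hn _ h1
  set w1 := aeval h (Q F n) w with hw1
  have h3 : h w1 = -(a + 2 : F) • w1 := by
    have hc : aeval h (Q F n) (h w) = h w1 := by
      have h4 : aeval h (Q F n * X) = aeval h (X * Q F n) := by rw [mul_comm]
      have h5 := LinearMap.congr_fun h4 w
      simpa using h5
    rw [map_add, map_smul, hc] at h2
    rw [neg_smul, eq_neg_iff_add_eq_zero]; exact h2
  have h4 : e w1 = (eval (-(a:F) - 2) (Q F n)) • e w := by
    rw [hw1, T.e_aeval]
    have := Module.End.aeval_apply_of_hasEigenvector (f := h) (μ := -(a:F)) (x := e w)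
      (p := (Q F n).comp (X - C 2))
    by_cases h0 : e w = 0
    · simp [h0]
    · rw [this ⟨Module.End.mem_eigenspace_iff.2 hw, h0⟩]
      simp
  have h5 : w1 = 0 := T.inj_fe a w1 h3 (by rw [h4, map_smul, hfe, smul_zero])
  rw [h5, map_zero] at h4
  refine (smul_eq_zero.1 h4.symm).resolve_left ?_
  rw [Q, eval_prod]
  refine Finset.prod_ne_zero_iff.2 ?_
  intro i _
  have : ((a + 2 + i : ℕ) : F) ≠ 0 := by exact_mod_cast (by omega)
  intro h0
  apply this
  push_cast
  simp at h0
  linear_combination -h0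

lemma ker_f_im_e (T : OpTriple h e f) (v : V) (hf : f v = 0) (he : v ∈ LinearMap.range e) : v = 0 := by
  -- use the polynomial decomposition
  by_contra hne
  obtain ⟨n, hn⟩ := T.swap.exists_Q
  -- among all polynomials multiples: find last nonzero
  have hex : ∃ k, Polynomial.aeval (-h) (Q F k) v = 0 := ⟨n, hn v hf⟩
  classical
  obtain ⟨k, hk⟩ : ∃ k, Nat.find hex = k + 1 := by
    refine Nat.exists_eq_succ_of_ne_zero fun h0 => ?_
    have := Nat.find_spec hex
    rw [h0] at this
    exact hne (by simpa [Q] using this)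
  have h1 := Nat.find_spec hex
  have h2 : Polynomial.aeval (-h) (Q F k) v ≠ 0 := Nat.find_min hex (by omega)
  set u := Polynomial.aeval (-h) (Q F k) v with hu
  have h3 : h u = -(k:F) • u := by
    have hQ : Q F (k+1) = (Polynomial.X - Polynomial.C (k:F)) * Q F k := by
      rw [Q, Finset.prod_range_succ, ← Q, mul_comm]
    rw [hk, hQ, map_mul, Module.End.mul_apply, ← hu] at h1
    simp at h1
    rw [← Nat.cast_smul_eq_nsmul F] at h1
    rw [sub_eq_zero] at h1
    rw [neg_smul, ← h1, neg_neg]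
  have h4 : f u = 0 := T.swap.aeval_ker_e _ v hf
  obtain ⟨w, hw⟩ := he
  have h5 : ∀ p : Polynomial F, ∃ w', e w' = Polynomial.aeval (-h) p v := by
    intro p
    refine ⟨Polynomial.aeval h ((p.comp (-Polynomial.X)).comp (Polynomial.X + Polynomial.C 2)) w, ?_⟩
    rw [T.e_aeval, hw]
    congr 1
    rw [Polynomial.comp_assoc]
    simp [Polynomial.aeval_comp]
  obtain ⟨w', hw'⟩ := h5 (Q F k)
  rw [← hu] at hw'
  exact h2 (hw' ▸ T.ker_f_im_e_aux k w' (by rw [hw', h3]) (by rw [hw', h4]))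

lemma isCompl_ker_f_im_e (T : OpTriple h e f) : IsCompl (LinearMap.ker f) (LinearMap.range e) := by
  have h1 : Disjoint (LinearMap.ker f) (LinearMap.range e) :=
    Submodule.disjoint_def.2 fun v hv hv' => T.ker_f_im_e v hv hv'
  have h2 : Disjoint (LinearMap.ker e) (LinearMap.range f) :=
    Submodule.disjoint_def.2 fun v hv hv' => T.swap.ker_f_im_e v hv hv'
  refine ⟨h1, codisjoint_iff.2 ?_⟩
  apply Submodule.eq_top_of_finrank_eq
  have a1 := Submodule.finrank_sup_add_finrank_inf_eq (LinearMap.ker f) (LinearMap.range e)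
  have a2 := Submodule.finrank_sup_add_finrank_inf_eq (LinearMap.ker e) (LinearMap.range f)
  rw [h1.eq_bot, finrank_bot] at a1
  rw [h2.eq_bot, finrank_bot] at a2
  have a3 := LinearMap.finrank_range_add_finrank_ker e
  have a4 := LinearMap.finrank_range_add_finrank_ker f
  have a5 := Submodule.finrank_le (LinearMap.ker e ⊔ LinearMap.range f)
  have a6 := Submodule.finrank_le (LinearMap.ker f ⊔ LinearMap.range e)
  omega

lemma e_eig (T : OpTriple h e f) (c : F) (v : V) (hv : v ∈ Module.End.eigenspace h c) :
    e v ∈ Module.End.eigenspace h (c + 2) := by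
  rw [Module.End.mem_eigenspace_iff] at *
  rw [T.he', hv, map_smul]; module

/-- h is diagonalizable with integer eigenvalues -/
lemma iSup_eigenspace (T : OpTriple h e f) :
    ⨆ i : ℤ, Module.End.eigenspace h (i : F) = ⊤ := by
  set W := ⨆ i : ℤ, Module.End.eigenspace h (i : F) with hW
  have hker : LinearMap.ker f ≤ W := by
    intro v hv
    have := T.swap.ker_e_le v hv
    refine (iSup_le fun i => ?_ : (⨆ i : ℕ, Module.End.eigenspace (-h) (i : F)) ≤ W) this
    intro u hu
    refine Submodule.mem_iSup_of_mem (-(i:ℤ)) ?_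
    replace hu := Module.End.mem_eigenspace_iff.1 hu
    refine Module.End.mem_eigenspace_iff.2 ?_
    rw [Int.cast_neg, Int.cast_natCast, neg_smul, ← hu, LinearMap.neg_apply, neg_neg]
  have hstab : ∀ v ∈ W, e v ∈ W := by
    have : W ≤ W.comap e := by
      conv_lhs => rw [hW]
      refine iSup_le fun i v hv => ?_
      refine Submodule.mem_iSup_of_mem (i + 2) ?_
      have := T.e_eig _ v hv
      push_cast
      exact this
    exact this
  have key : ∀ n : ℕ, ∀ v, ∃ w, v - (e ^ n) w ∈ W := by
    intro n
    induction n with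
    | zero => intro v; exact ⟨v, by simp⟩
    | succ n ih =>
      intro v
      obtain ⟨w, hw⟩ := ih v
      have : w ∈ LinearMap.ker f ⊔ LinearMap.range e := by
        rw [T.isCompl_ker_f_im_e.sup_eq_top]; trivial
      obtain ⟨a, ha, b, ⟨c, rfl⟩, rfl⟩ := Submodule.mem_sup.1 this
      refine ⟨c, ?_⟩
      have h1 : (e ^ n) a ∈ W := by
        have : ∀ n : ℕ, (e ^ n) a ∈ W := by
          intro n
          induction n with
          | zero => simpa using hker ha
          | succ n ih => rw [pow_succ', Module.End.mul_apply]; exact hstab _ ih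
        exact this n
      have := W.add_mem hw h1
      rw [map_add] at this
      rw [pow_succ, Module.End.mul_apply]
      convert this using 1
      abel
  rw [eq_top_iff]
  intro v _
  obtain ⟨n, hn⟩ := T.nil_e
  obtain ⟨w, hw⟩ := key n v
  simpa [hn] using hw

end OpTriple

end Sl2
end

section
open scoped TensorProduct
set_option linter.unusedSectionVars false
set_option linter.unusedVariables false

section Sl2b
variable {F : Type*} [Field F] [CharZero F] {V : Type*} [AddCommGroup V] [Module F V]
  [FiniteDimensional F V]

lemma exists_proj {ι : Type*} [DecidableEq ι] (h : Module.End F V) (c : ι → F)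
    (hc : Function.Injective c)
    (htop : ⨆ i : ι, Module.End.eigenspace h (c i) = ⊤) :
    ∃ P : ι → Module.End F V, (∀ c' v, P c' v ∈ Module.End.eigenspace h (c c')) ∧
      (∀ c' v, v ∈ Module.End.eigenspace h (c c') → P c' v = v) ∧
      (∀ c' c'' v, c' ≠ c'' → v ∈ Module.End.eigenspace h (c c') → P c'' v = 0) := by
  have hind : iSupIndep (fun i : ι => Module.End.eigenspace h (c i)) :=
    (Module.End.eigenspaces_iSupIndep h).comp hc
  have hint := DirectSum.isInternal_submodule_of_iSupIndep_of_iSup_eq_top hind htop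
  let _ := hint.chooseDecomposition
  refine ⟨fun i => (Submodule.subtype _) ∘ₗ (DirectSum.component F ι _ i) ∘ₗ
    (DirectSum.decomposeLinearEquiv (fun i : ι => Module.End.eigenspace h (c i))).toLinearMap,
    ?_, ?_, ?_⟩
  · intro c v
    simp
  · intro c' v hv
    simp only [LinearMap.comp_apply, Submodule.subtype_apply, LinearEquiv.coe_coe]
    exact DirectSum.decompose_of_mem_same (fun i : ι => Module.End.eigenspace h (c i)) hv
  · intro c' c'' v hne hv
    simp only [LinearMap.comp_apply, Submodule.subtype_apply, LinearEquiv.coe_coe]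
    exact DirectSum.decompose_of_mem_ne (fun i : ι => Module.End.eigenspace h (c i)) hv hne

namespace OpTriple
variable {h e f : Module.End F V}

lemma f_eig (T : OpTriple h e f) (c : F) (v : V) (hv : v ∈ Module.End.eigenspace h c) :
    f v ∈ Module.End.eigenspace h (c - 2) := by
  rw [Module.End.mem_eigenspace_iff] at *
  rw [T.hf', hv, map_smul]; module

lemma eig_decomp (T : OpTriple h e f) (c : ℤ) (v : V) (hv : v ∈ Module.End.eigenspace h (c : F)) :
    ∃ a ∈ Module.End.eigenspace h (c : F), f a = 0 ∧
      ∃ w ∈ Module.End.eigenspace h ((c - 2 : ℤ) : F), v = a + e w := by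
  obtain ⟨P, h1, h2, h3⟩ := exists_proj h (fun i : ℤ => (i : F)) Int.cast_injective T.iSup_eigenspace
  have hall : ∀ (p : V → Prop), (∀ i : ℤ, ∀ x ∈ Module.End.eigenspace h (i : F), p x) →
      p 0 → (∀ x y, p x → p y → p (x + y)) → ∀ x, p x := by
    intro p q1 q2 q3 x
    have : x ∈ ⨆ i : ℤ, Module.End.eigenspace h (i : F) := by rw [T.iSup_eigenspace]; trivial
    exact Submodule.iSup_induction _ (motive := p) this q1 q2 q3
  have hPe : ∀ c : ℤ, ∀ x, P c (e x) = e (P (c - 2) x) := by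
    intro c
    refine hall _ ?_ (by simp) (fun x y hx hy => by simp [hx, hy])
    intro i x hx
    have hx' : e x ∈ Module.End.eigenspace h ((i + 2 : ℤ) : F) := by
      push_cast; exact T.e_eig _ _ hx
    by_cases hi : i = c - 2
    · subst hi
      rw [h2 _ _ hx, h2 _ _ (by simpa using hx')]
    · rw [h3 i (c-2) x hi hx, h3 (i+2) c _ (by omega) hx', map_zero]
  have hPf : ∀ c : ℤ, ∀ x, P c (f x) = f (P (c + 2) x) := by
    intro c
    refine hall _ ?_ (by simp) (fun x y hx hy => by simp [hx, hy])
    intro i x hx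
    have hx' : f x ∈ Module.End.eigenspace h ((i - 2 : ℤ) : F) := by
      push_cast; exact T.f_eig _ _ hx
    by_cases hi : i = c + 2
    · subst hi
      rw [h2 _ _ hx, h2 _ _ (by simpa using hx')]
    · rw [h3 i (c+2) x hi hx, h3 (i-2) c _ (by omega) hx', map_zero]
  have : v ∈ LinearMap.ker f ⊔ LinearMap.range e := by
    rw [T.isCompl_ker_f_im_e.sup_eq_top]; trivial
  obtain ⟨a, ha, b, ⟨w, rfl⟩, hab⟩ := Submodule.mem_sup.1 this
  refine ⟨P c a, h1 _ _, ?_, P (c-2) w, h1 _ _, ?_⟩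
  · have := hPf (c-2) a
    rw [show c - 2 + 2 = c by ring, LinearMap.mem_ker.1 ha, map_zero] at this
    exact this.symm
  · rw [← hPe, ← map_add, hab, h2 c v hv]

lemma ker_f_pos (T : OpTriple h e f) (c : ℤ) (hc : 0 < c) (v : V)
    (hv : v ∈ Module.End.eigenspace h (c : F)) (hf : f v = 0) : v = 0 := by
  by_contra hne
  obtain ⟨n, hn⟩ := T.swap.exists_Q
  have h1 := hn v hf
  rw [Module.End.aeval_apply_of_hasEigenvector (μ := -(c:F))
    ⟨Module.End.mem_eigenspace_iff.2 (by
      rw [LinearMap.neg_apply, Module.End.mem_eigenspace_iff.1 hv, neg_smul]), hne⟩] at h1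
  have h2 := (smul_eq_zero.1 h1).resolve_right hne
  rw [Q, Polynomial.eval_prod] at h2
  obtain ⟨i, _, hi⟩ := Finset.prod_eq_zero_iff.1 h2
  simp at hi
  have : (-c - i : ℤ) = 0 := by exact_mod_cast (show ((-c - i : ℤ) : F) = 0 by push_cast; exact hi)
  omega

lemma e_surj (T : OpTriple h e f) (c : ℤ) (hc : 0 < c) (v : V)
    (hv : v ∈ Module.End.eigenspace h (c : F)) :
    ∃ w ∈ Module.End.eigenspace h ((c - 2 : ℤ) : F), e w = v := by
  obtain ⟨a, ha, hfa, w, hw, rfl⟩ := T.eig_decomp c v hv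
  exact ⟨w, hw, by rw [T.ker_f_pos c hc a ha hfa, zero_add]⟩

lemma e_inj (T : OpTriple h e f) (c : ℤ) (hc : c < 0) (v : V)
    (hv : v ∈ Module.End.eigenspace h (c : F)) (he : e v = 0) : v = 0 := by
  refine T.swap.ker_f_pos (-c) (by omega) v ?_ he
  rw [Module.End.mem_eigenspace_iff] at *
  simp [hv]

/-- a bound on eigenvalues -/
lemma exists_bound (h : Module.End F V) : ∃ M : ℕ, ∀ c : ℤ, (M : ℤ) ≤ |c| →
    Module.End.eigenspace h (c : F) = ⊥ := by
  have hfin : {c : ℤ | Module.End.HasEigenvalue h (c : F)}.Finite :=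
    Set.Finite.preimage (Int.cast_injective.injOn) (Module.End.finite_hasEigenvalue h)
  obtain ⟨M, hM⟩ := (hfin.image (fun c => c.natAbs)).bddAbove
  refine ⟨M + 1, fun c hc => ?_⟩
  by_contra hne
  have : c.natAbs ≤ M := hM ⟨c, hne, rfl⟩
  rw [Int.abs_eq_natAbs] at hc
  omega

/-- sums of eigenspaces -/
def Wge (h : Module.End F V) (S : Set ℤ) : Submodule F V :=
  ⨆ i ∈ S, Module.End.eigenspace h (i : F)

lemma Wge_mono (h : Module.End F V) {S T : Set ℤ} (hST : S ⊆ T) : Wge h S ≤ Wge h T :=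
  biSup_mono hST

lemma Wge_union (h : Module.End F V) (S T : Set ℤ) : Wge h (S ∪ T) = Wge h S ⊔ Wge h T :=
  iSup_union

lemma Wge_singleton (h : Module.End F V) (c : ℤ) : Wge h {c} = Module.End.eigenspace h (c : F) := by
  simp [Wge]

lemma eig_le_Wge (h : Module.End F V) {S : Set ℤ} {c : ℤ} (hc : c ∈ S) :
    Module.End.eigenspace h (c : F) ≤ Wge h S :=
  le_biSup (fun c : ℤ => Module.End.eigenspace h (c : F)) hc

lemma Wge_disjoint (h : Module.End F V) {S T : Set ℤ} (hST : Disjoint S T) :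
    Disjoint (Wge h S) (Wge h T) := by
  have h1 := Module.End.eigenspaces_iSupIndep h
  have hind := iSupIndep.comp (f := fun i : ℤ => (i : F)) h1 Int.cast_injective
  unfold Wge
  exact hind.disjoint_biSup_biSup hST

lemma finrank_Wge_union (h : Module.End F V) {S T : Set ℤ} (hST : Disjoint S T) :
    Module.finrank F (Wge h (S ∪ T)) = Module.finrank F (Wge h S) + Module.finrank F (Wge h T) := by
  have := Submodule.finrank_sup_add_finrank_inf_eq (Wge h S) (Wge h T)
  rw [(Wge_disjoint h hST).eq_bot, finrank_bot, ← Wge_union] at this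
  omega

lemma Wge_le (h : Module.End F V) {S : Set ℤ} {W : Submodule F V}
    (hW : ∀ c ∈ S, ∀ v ∈ Module.End.eigenspace h (c : F), v ∈ W) : Wge h S ≤ W :=
  iSup₂_le fun c hc v hv => hW c hc v hv

lemma finrank_le_ker_add (e : Module.End F V) (W W' : Submodule F V) (hW : ∀ v ∈ W, e v ∈ W') :
    Module.finrank F W ≤ Module.finrank F (LinearMap.ker e) + Module.finrank F W' := by
  have h1 := LinearMap.finrank_range_add_finrank_ker (e.domRestrict W)
  have h2 : Module.finrank F (LinearMap.range (e.domRestrict W)) ≤ Module.finrank F W' := by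
    apply Submodule.finrank_mono
    rintro _ ⟨w, rfl⟩
    exact hW _ w.2
  have h3 : Module.finrank F (LinearMap.ker (e.domRestrict W)) ≤ Module.finrank F (LinearMap.ker e) := by
    let φ : LinearMap.ker (e.domRestrict W) →ₗ[F] LinearMap.ker e :=
      LinearMap.codRestrict _ ((Submodule.subtype W) ∘ₗ Submodule.subtype _) (fun x => x.2)
    refine LinearMap.finrank_le_finrank_of_injective (f := φ) ?_
    intro a b hab
    have := congrArg Subtype.val hab
    exact Subtype.ext (Subtype.ext this)
  omega

/-- no eigenvalue one, when `dim ker e ≤ dim ker h` -/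
lemma eig_neg_one (T : OpTriple h e f)
    (hdim : Module.finrank F (LinearMap.ker e) ≤ Module.finrank F (LinearMap.ker h)) :
    Module.End.eigenspace h ((-1 : ℤ) : F) = ⊥ := by
  have h1 := finrank_le_ker_add e (Wge h (Set.Ici (-1))) (Wge h (Set.Ici 1)) (by
    have : Wge h (Set.Ici (-1)) ≤ (Wge h (Set.Ici 1)).comap e := by
      refine Wge_le h fun c hc v hv => ?_
      have := T.e_eig _ v hv
      refine eig_le_Wge h (c := c + 2) (by simp at hc ⊢; omega) (by push_cast; exact this)
    exact this)
  have h2 : Set.Ici (-1 : ℤ) = ({-1} ∪ {0}) ∪ Set.Ici 1 := by ext x; simp; omega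
  rw [h2, finrank_Wge_union h (by
    rw [Set.disjoint_left]; intro x hx; simp at hx ⊢; omega), finrank_Wge_union h (by simp),
    Wge_singleton, Wge_singleton] at h1
  have h3 : Module.End.eigenspace h ((0:ℤ) : F) = LinearMap.ker h := by simp
  rw [h3] at h1
  rw [← Submodule.finrank_eq_zero (R := F)]
  omega

lemma eig_one (T : OpTriple h e f)
    (hdim : Module.finrank F (LinearMap.ker e) ≤ Module.finrank F (LinearMap.ker h)) :
    Module.End.eigenspace h ((1 : ℤ) : F) = ⊥ := by
  rw [Submodule.eq_bot_iff]
  intro v hv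
  obtain ⟨w, hw, rfl⟩ := T.e_surj 1 (by norm_num) v hv
  have : (1 - 2 : ℤ) = -1 := by norm_num
  rw [this, T.eig_neg_one hdim] at hw
  rw [(Submodule.mem_bot F).1 hw, map_zero]

end OpTriple
end Sl2b
end

section
open scoped TensorProduct
set_option linter.unusedSectionVars false
set_option linter.unusedVariables false

section Jordan
variable {F : Type*} [Field F] [CharZero F] [IsAlgClosed F] {g : Type*} [LieRing g] [LieAlgebra F g]
  [FiniteDimensional F g] [LieAlgebra.IsKilling F g]

lemma eq_of_le_of_indep {ι V : Type*} [AddCommGroup V] [Module F V]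
    (E G : ι → Submodule F V) (h : ∀ i, E i ≤ G i) (hE : ⨆ i, E i = ⊤) (hG : iSupIndep G) (i : ι) :
    G i ≤ E i := by
  intro v hv
  have h1 : v ∈ E i ⊔ ⨆ (j) (_ : j ≠ i), E j := by
    have h2 : ⨆ j, E j ≤ E i ⊔ ⨆ (j) (_ : j ≠ i), E j := by
      refine iSup_le fun j => ?_
      by_cases hj : j = i
      · subst hj; exact le_sup_left
      · exact le_sup_of_le_right (le_iSup₂_of_le j hj le_rfl)
    exact h2 (by rw [hE]; trivial)
  obtain ⟨a, ha, b, hb, rfl⟩ := Submodule.mem_sup.1 h1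
  have hb1 : b ∈ G i := by
    have := (G i).sub_mem hv (h i ha)
    simpa using this
  have hb2 : b ∈ ⨆ (j) (_ : j ≠ i), G j := (iSup₂_mono fun j _ => h j) hb
  rw [Submodule.disjoint_def.1 (hG i) b hb1 hb2, add_zero]
  exact ha

lemma jc_end {V : Type*} [AddCommGroup V] [Module F V] [FiniteDimensional F V]
    (D : Module.End F V) : ∃ N S : Module.End F V, IsNilpotent N ∧ Commute N S ∧
      ⨆ c : F, S.eigenspace c = ⊤ ∧ D = N + S := by
  obtain ⟨N, hN, S, hS, hNn, hSs, hDNS⟩ := Module.End.exists_isNilpotent_isSemisimple (f := D)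
  refine ⟨N, S, hNn, ?_, hSs.iSup_eigenspace_eq_top, hDNS⟩
  have h1 : Commute N D := (Algebra.commute_of_mem_adjoin_self hN).symm
  have : S = D - N := by rw [hDNS]; abel
  rw [this]
  exact h1.sub_right (Commute.refl N)

/-- ad-diagonalizable elements -/
def adDiag (F : Type*) [Field F] {g : Type*} [LieRing g] [LieAlgebra F g] (s : g) : Prop :=
  ⨆ c : F, Module.End.eigenspace (LieAlgebra.ad F g s : Module.End F g) c = ⊤

lemma jordan (x : g) : ∃ s n : g, x = s + n ∧ ⁅s, n⁆ = 0 ∧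
    IsNilpotent (LieAlgebra.ad F g n : Module.End F g) ∧ adDiag F s ∧
    ∀ (y : g) (c : F), ⁅x, y⁆ = c • y → ⁅s, y⁆ = c • y := by
  set D : Module.End F g := LieAlgebra.ad F g x with hD
  obtain ⟨N, S, hNn, hcomm, hE, hDNS⟩ := jc_end D
  have hEG : ∀ c, S.eigenspace c ≤ D.maxGenEigenspace c := by
    intro c v hv
    rw [Module.End.mem_maxGenEigenspace]
    obtain ⟨k, hk⟩ := hNn
    refine ⟨k, ?_⟩
    have key : ∀ k : ℕ, ((D - c • 1) ^ k) v = (N ^ k) v := by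
      intro k
      induction k with
      | zero => simp
      | succ k ih =>
        rw [pow_succ', Module.End.mul_apply, ih, hDNS, pow_succ', Module.End.mul_apply]
        have h2 : S ((N ^ k) v) = c • (N ^ k) v := by
          have := LinearMap.congr_fun ((hcomm.pow_left k).eq) v
          simp only [Module.End.mul_apply] at this
          rw [← this, Module.End.mem_eigenspace_iff.1 hv, map_smul]
        simp [h2]
    rw [key, hk]; rfl
  have hGE : ∀ c, D.maxGenEigenspace c ≤ S.eigenspace c :=
    eq_of_le_of_indep _ _ hEG hE (Module.End.independent_maxGenEigenspace D)
  have hder : ∀ a b : g, S ⁅a, b⁆ = ⁅a, S b⁆ - ⁅b, S a⁆ := by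
    intro a b
    have ha : a ∈ ⨆ c : F, S.eigenspace c := by rw [hE]; trivial
    have hb : b ∈ ⨆ c : F, S.eigenspace c := by rw [hE]; trivial
    induction ha using Submodule.iSup_induction' with
    | zero => simp
    | add a a' _ _ h1 h2 => simp [h1, h2]; abel
    | mem c a ha =>
      induction hb using Submodule.iSup_induction' with
      | zero => simp
      | add b b' _ _ h1 h2 => simp [h1, h2]; abel
      | mem c' b hb =>
        have : ⁅a, b⁆ ∈ S.eigenspace (c + c') :=
          hGE _ (LieModule.lie_mem_maxGenEigenspace_toEnd (hEG _ ha) (hEG _ hb))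
        rw [Module.End.mem_eigenspace_iff] at *
        rw [this, ha, hb, lie_smul, lie_smul, ← lie_skew b a]
        module
  obtain ⟨s, hs⟩ := LieDerivation.IsKilling.exists_eq_ad
    (⟨S, hder⟩ : LieDerivation F g g)
  have hs' : (LieAlgebra.ad F g s : Module.End F g) = S := by
    ext y
    have := LieDerivation.congr_fun hs y
    simpa using this
  have h5 : ∀ (y : g) (c : F), ⁅x, y⁆ = c • y → ⁅s, y⁆ = c • y := by
    intro y c hy
    have : y ∈ S.eigenspace c := hGE c (Module.End.mem_maxGenEigenspace _ _ _ |>.2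
      ⟨1, by simp [hD, hy]⟩)
    rw [Module.End.mem_eigenspace_iff, ← hs'] at this
    simpa using this
  refine ⟨s, x - s, by abel, ?_, ?_, ?_, h5⟩
  · have := h5 x 0 (by simp)
    simpa using this
  · have : (LieAlgebra.ad F g (x - s) : Module.End F g) = N := by
      rw [map_sub, hs', ← hD, hDNS]; abel
    rw [this]; exact hNn
  · unfold adDiag; rw [hs']; exact hE


lemma adDiag.top {s : g} (hs : adDiag F s) (v : g) :
    ∃ a b : g, v = a + ⁅s, b⁆ ∧ ⁅s, a⁆ = 0 := by
  have hv : v ∈ ⨆ c : F, Module.End.eigenspace (LieAlgebra.ad F g s : Module.End F g) c := by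
    rw [hs]; trivial
  induction hv using Submodule.iSup_induction' with
  | zero => exact ⟨0, 0, by simp, by simp⟩
  | add x y _ _ hx hy =>
    obtain ⟨a, b, rfl, ha⟩ := hx
    obtain ⟨a', b', rfl, ha'⟩ := hy
    exact ⟨a + a', b + b', by rw [lie_add]; abel, by simp [ha, ha']⟩
  | mem c x hx =>
    rw [Module.End.mem_eigenspace_iff, LieAlgebra.ad_apply] at hx
    by_cases hc : c = 0
    · exact ⟨x, 0, by simp, by rw [hx, hc, zero_smul]⟩
    · exact ⟨0, c⁻¹ • x, by rw [lie_smul, hx, smul_smul, inv_mul_cancel₀ hc]; simp, by simp⟩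

lemma adDiag.ker_range {s : g} (hs : adDiag F s) (w : g) (h : ⁅s, ⁅s, w⁆⁆ = 0) : ⁅s, w⁆ = 0 := by
  have h1 : LinearMap.ker (LieAlgebra.ad F g s : Module.End F g) ⊔
      LinearMap.range (LieAlgebra.ad F g s : Module.End F g) = ⊤ := by
    rw [eq_top_iff]
    intro v _
    obtain ⟨a, b, rfl, ha⟩ := hs.top v
    exact Submodule.add_mem_sup (by simpa using ha) ⟨b, rfl⟩
  have h2 := Submodule.finrank_sup_add_finrank_inf_eq
    (LinearMap.ker (LieAlgebra.ad F g s : Module.End F g))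
    (LinearMap.range (LieAlgebra.ad F g s : Module.End F g))
  have h3 := LinearMap.finrank_range_add_finrank_ker (LieAlgebra.ad F g s : Module.End F g)
  rw [h1, finrank_top] at h2
  have h4 : Module.finrank F (LinearMap.ker (LieAlgebra.ad F g s : Module.End F g) ⊓
    LinearMap.range (LieAlgebra.ad F g s : Module.End F g) : Submodule F g) = 0 := by omega
  rw [Submodule.finrank_eq_zero] at h4
  have : ⁅s, w⁆ ∈ (LinearMap.ker (LieAlgebra.ad F g s : Module.End F g) ⊓
    LinearMap.range (LieAlgebra.ad F g s : Module.End F g) : Submodule F g) :=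
    ⟨by simpa using h, ⟨w, rfl⟩⟩
  rw [h4] at this
  exact (Submodule.mem_bot F).1 this

lemma mem_range_ad_of_nilp {n : g} (hn : IsNilpotent (LieAlgebra.ad F g n : Module.End F g)) :
    ∃ y, ⁅n, y⁆ = n := by
  set κ := killingForm F g with hκ
  have hnd : κ.Nondegenerate := LieAlgebra.IsKilling.killingForm_nondegenerate F g
  have hrefl : κ.IsRefl := fun x y h => by rw [← h]; exact LieModule.traceForm_comm F g g y x
  set W := LinearMap.range (LieAlgebra.ad F g n : Module.End F g) with hW
  have h1 : κ.orthogonal (κ.orthogonal W) = W :=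
    LinearMap.BilinForm.orthogonal_orthogonal hnd hrefl W
  have h2 : n ∈ κ.orthogonal (κ.orthogonal W) := by
    rw [LinearMap.BilinForm.mem_orthogonal_iff]
    intro z hz
    rw [LinearMap.BilinForm.mem_orthogonal_iff] at hz
    have h3 : ⁅n, z⁆ = 0 := by
      refine hnd.2 _ fun y => ?_
      have h4 : κ ⁅n, y⁆ z = 0 := hz ⁅n, y⁆ ⟨y, rfl⟩
      have h5 : κ ⁅n, y⁆ z = - κ y ⁅n, z⁆ := LieModule.traceForm_apply_lie_apply' F g g n y z
      rw [h4] at h5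
      exact (neg_eq_zero.1 h5.symm)
    have h4 : Commute (LieAlgebra.ad F g z : Module.End F g) (LieAlgebra.ad F g n : Module.End F g) := by
      ext y
      simp only [Module.End.mul_apply, LieAlgebra.ad_apply]
      rw [leibniz_lie n z y, h3, zero_lie, zero_add]
    change LieModule.traceForm F g g z n = 0
    rw [LieModule.traceForm_apply_apply]
    exact (LinearMap.isNilpotent_trace_of_isNilpotent (h4.isNilpotent_mul_left hn)).eq_zero
  rw [h1] at h2
  obtain ⟨y, hy⟩ := h2
  exact ⟨y, hy⟩


lemma exists_grading_elt {s n : g} (hsn : ⁅s, n⁆ = 0) (hs : adDiag F s)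
    (hn : IsNilpotent (LieAlgebra.ad F g n : Module.End F g)) :
    ∃ k : g, ⁅k, s⁆ = 0 ∧ ⁅k, n⁆ = n ∧ adDiag F k := by
  obtain ⟨y, hy⟩ := mem_range_ad_of_nilp hn
  obtain ⟨a, b, hab, ha⟩ := hs.top (-y)
  have h1 : ⁅-y, n⁆ = n := by rw [neg_lie, lie_skew, hy]
  have h2 : ⁅s, ⁅a, n⁆⁆ = 0 := by rw [leibniz_lie, ha, hsn]; simp
  have h3 : n - ⁅a, n⁆ = ⁅s, ⁅b, n⁆⁆ := by
    rw [leibniz_lie s b n, hsn, lie_zero, add_zero]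
    nth_rewrite 1 [← h1]
    rw [hab, add_lie]; abel
  have h4 : ⁅s, ⁅b, n⁆⁆ = 0 := by
    refine hs.ker_range _ ?_
    rw [← h3, lie_sub, hsn, h2, sub_zero]
  have h5 : ⁅a, n⁆ = n := by rw [h4, sub_eq_zero] at h3; exact h3.symm
  obtain ⟨k, m, _, _, _, hk, hk'⟩ := jordan (F := F) a
  refine ⟨k, ?_, ?_, hk⟩
  · have := hk' s 0 (by rw [← lie_skew, ha]; simp)
    simpa using this
  · have := hk' n 1 (by simpa using h5)
    simpa using this

/-- the common centralizer of two elements -/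
noncomputable def cent2 (F : Type*) [Field F] {g : Type*} [LieRing g] [LieAlgebra F g] (s k : g) :
    LieSubalgebra F g where
  __ := cent F g s ⊓ cent F g k
  lie_mem' := by
    rintro x y ⟨hx, hx'⟩ ⟨hy, hy'⟩
    have h1 : ⁅s, x⁆ = 0 := hx
    have h2 : ⁅s, y⁆ = 0 := hy
    have h3 : ⁅k, x⁆ = 0 := hx'
    have h4 : ⁅k, y⁆ = 0 := hy'
    refine ⟨?_, ?_⟩
    · change ⁅s, ⁅x, y⁆⁆ = 0
      rw [leibniz_lie, h1, h2]; simp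
    · change ⁅k, ⁅x, y⁆⁆ = 0
      rw [leibniz_lie, h3, h4]; simp

lemma mem_cent2 {s k x : g} : x ∈ cent2 F s k ↔ ⁅s, x⁆ = 0 ∧ ⁅k, x⁆ = 0 := Iff.rfl

lemma exists_cartan {s k : g} (hsk : ⁅k, s⁆ = 0) (hs : adDiag F s) (hk : adDiag F k) :
    ∃ H : LieSubalgebra F g, H.IsCartanSubalgebra ∧ s ∈ H ∧ k ∈ H := by
  set C := cent2 F s k with hC
  obtain ⟨x, hx⟩ := LieAlgebra.exists_isCartanSubalgebra_engel F C
  set E := LieSubalgebra.engel F x with hE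
  have hsC : s ∈ C := mem_cent2.2 ⟨lie_self s, hsk⟩
  have hkC : k ∈ C := mem_cent2.2 ⟨by rw [← lie_skew, hsk, neg_zero], lie_self k⟩
  have hmem : ∀ y : C, ⁅x, y⁆ = 0 → y ∈ E := by
    intro y hy
    rw [hE, LieSubalgebra.mem_engel_iff]
    exact ⟨1, by simpa using hy⟩
  have hsE : (⟨s, hsC⟩ : C) ∈ E := hmem _ (Subtype.ext (by
    change ⁅(x : g), s⁆ = 0
    rw [← lie_skew, (mem_cent2.1 x.2).1, neg_zero]))
  have hkE : (⟨k, hkC⟩ : C) ∈ E := hmem _ (Subtype.ext (by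
    change ⁅(x : g), k⁆ = 0
    rw [← lie_skew, (mem_cent2.1 x.2).2, neg_zero]))
  refine ⟨E.map C.incl, ⟨?_, ?_⟩, ⟨_, hsE, rfl⟩, ⟨_, hkE, rfl⟩⟩
  · have := hx.nilpotent
    let φ : E →ₗ⁅F⁆ (E.map C.incl) :=
      { toFun := fun x => ⟨x.1.1, ⟨x.1, x.2, rfl⟩⟩
        map_add' := fun _ _ => rfl
        map_smul' := fun _ _ => rfl
        map_lie' := rfl }
    refine Function.Surjective.lieAlgebra_isNilpotent (f := φ) ?_
    rintro ⟨_, z, hz, rfl⟩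
    exact ⟨⟨z, hz⟩, rfl⟩
  · apply le_antisymm
    · intro y hy
      rw [LieSubalgebra.mem_normalizer_iff] at hy
      have hle : ∀ z, z ∈ E.map C.incl → z ∈ C := by
        rintro _ ⟨z, _, rfl⟩
        exact z.2
      have h1 : ⁅s, y⁆ = 0 := by
        refine hs.ker_range y ?_
        have h2 := (mem_cent2.1 (hle _ (hy s ⟨_, hsE, rfl⟩))).1
        rw [← lie_skew s y, lie_neg, h2, neg_zero]
      have h3 : ⁅k, y⁆ = 0 := by
        refine hk.ker_range y ?_
        have h2 := (mem_cent2.1 (hle _ (hy k ⟨_, hkE, rfl⟩))).2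
        rw [← lie_skew k y, lie_neg, h2, neg_zero]
      refine ⟨⟨y, mem_cent2.2 ⟨h1, h3⟩⟩, ?_, rfl⟩
      change _ ∈ E
      rw [← hx.self_normalizing, LieSubalgebra.mem_normalizer_iff]
      intro z hz
      obtain ⟨w, hw, hw'⟩ := hy z ⟨z, hz, rfl⟩
      have : ⁅(⟨y, mem_cent2.2 ⟨h1, h3⟩⟩ : C), z⁆ = w := Subtype.ext hw'.symm
      rw [this]; exact hw
    · exact LieSubalgebra.le_normalizer _

end Jordan
end

section
open scoped TensorProduct
set_option linter.unusedSectionVars false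
set_option linter.unusedVariables false

/-- concrete root data for a Cartan subalgebra -/
structure RD (F : Type*) [Field F] {g : Type*} [LieRing g] [LieAlgebra F g]
    (H : LieSubalgebra F g) (ι : Type*) [Fintype ι] where
  al : ι → H →ₗ[F] F
  ev : ι → g
  fv : ι → g
  cr : ι → H
  ab : ∀ x y : H, ⁅(x : g), (y : g)⁆ = 0
  ev_ne : ∀ i, ev i ≠ 0
  al_ne : ∀ i, al i ≠ 0
  ev_eig : ∀ i (z : H), ⁅(z : g), ev i⁆ = al i z • ev i
  fv_eig : ∀ i (z : H), ⁅(z : g), fv i⁆ = -(al i z • fv i)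
  ef : ∀ i, ⁅ev i, fv i⁆ = (cr i : g)
  al_cr : ∀ i, al i (cr i) = 2
  span : H.toSubmodule ⊔ Submodule.span F (Set.range ev) = ⊤
  inj : Function.Injective al
  cosep : ∀ φ : H →ₗ[F] F, (∀ i, φ (cr i) = 0) → φ = 0
  neg : ∀ i, ∃ j, al j = - al i
  kil : ∀ z w : H, killingForm F g z w = ∑ i, al i z * al i w

section RDex
variable {F : Type*} [Field F] [CharZero F] [IsAlgClosed F] {g : Type*} [LieRing g] [LieAlgebra F g]
  [FiniteDimensional F g] [LieAlgebra.IsKilling F g]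

open LieAlgebra LieAlgebra.IsKilling LieModule in
lemma RD.exists (H : LieSubalgebra F g) [H.IsCartanSubalgebra] : Nonempty (RD F H H.root) := by
  have hsl : ∀ α : H.root, ∃ h e f : g, IsSl2Triple h e f ∧ e ∈ rootSpace H α.1 ∧ f ∈ rootSpace H (-α.1) :=
    fun α => exists_isSl2Triple_of_weight_isNonZero (LieSubalgebra.isNonZero_coe_root α)
  choose hh e f ht he hf using hsl
  refine ⟨{ al := fun α => α.1.toLinear, ev := e, fv := f, cr := fun α => coroot α.1, ab := ?_,
            ev_ne := ?_, al_ne := ?_, ev_eig := ?_, fv_eig := ?_, ef := ?_, al_cr := ?_, span := ?_,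
            inj := ?_, cosep := ?_, neg := ?_, kil := ?_ }⟩
  · intro x y
    have : ⁅x, y⁆ = 0 := trivial_lie_zero _ _ x y
    exact congrArg Subtype.val this
  · exact fun i => (ht i).e_ne_zero
  · intro i h0
    refine LieSubalgebra.isNonZero_coe_root i ?_
    ext x
    exact LinearMap.congr_fun h0 x
  · intro i z
    exact lie_eq_smul_of_mem_rootSpace (he i) z
  · intro i z
    have := lie_eq_smul_of_mem_rootSpace (hf i) z
    rw [← neg_smul]
    exact this
  · intro i
    rw [(ht i).lie_e_f]
    exact (ht i).h_eq_coroot (LieSubalgebra.isNonZero_coe_root i) (he i) (hf i)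
  · intro i
    exact root_apply_coroot (LieSubalgebra.isNonZero_coe_root i)
  · rw [eq_top_iff]
    have h1 := congrArg LieSubmodule.toSubmodule (iSup_genWeightSpace_eq_top' F H g)
    rw [LieSubmodule.iSup_toSubmodule, LieSubmodule.top_toSubmodule] at h1
    rw [← h1]
    refine iSup_le fun χ => ?_
    by_cases hχ : χ.IsZero
    · refine le_sup_of_le_left ?_
      have h2 := rootSpace_zero_eq F g H
      have h3 : (χ : H → F) = 0 := hχ
      rw [h3]
      change (rootSpace H (0 : H → F)).toSubmodule ≤ _
      rw [h2]; exact le_rfl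
    · refine le_sup_of_le_right ?_
      have hm : χ ∈ H.root := by simpa using hχ
      have h2 := finrank_rootSpace_eq_one χ hχ
      intro x hx
      obtain ⟨c, hc⟩ := (finrank_eq_one_iff_of_nonzero' (⟨e ⟨χ, hm⟩, he ⟨χ, hm⟩⟩ : rootSpace H χ)
        (by intro h0; exact (ht ⟨χ, hm⟩).e_ne_zero (congrArg Subtype.val h0))).1 h2 ⟨x, hx⟩
      have hc' : c • e ⟨χ, hm⟩ = x := congrArg Subtype.val hc
      rw [← hc']
      exact Submodule.smul_mem _ _ (Submodule.subset_span ⟨_, rfl⟩)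
  · intro a b hab
    ext x
    exact LinearMap.congr_fun hab x
  · intro φ hφ
    have h1 := RootPairing.IsRootSystem.span_coroot_eq_top (P := rootSystem H)
    refine LinearMap.ext_on h1 ?_
    rintro _ ⟨i, rfl⟩
    simpa using hφ i
  · intro i
    refine ⟨⟨-i.1, by simpa using (LieSubalgebra.isNonZero_coe_root i)⟩, ?_⟩
    ext x
    simp
  · intro z w
    have := LinearMap.congr_fun (LinearMap.congr_fun (restrict_killingForm_eq_sum (K := F) (L := g) (H := H)) z) w
    rw [← Finset.sum_coe_sort H.root] at this
    simp only [LinearMap.sum_apply] at this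
    exact this
end RDex

section RDbasic
variable {F : Type*} [Field F] [CharZero F] {g : Type*} [LieRing g] [LieAlgebra F g]
  [FiniteDimensional F g] {H : LieSubalgebra F g} {ι : Type*} [Fintype ι] (R : RD F H ι)
namespace RD

lemma exists_reg : ∃ z : H, (∀ i, R.al i z ≠ 0) ∧ Function.Injective (fun i => R.al i z) := by
  let f : ι ⊕ {p : ι × ι // p.1 ≠ p.2} → Module.Dual F H :=
    Sum.elim R.al (fun p => R.al p.1.1 - R.al p.1.2)
  obtain ⟨z, hz⟩ := Module.Dual.exists_forall_ne_zero_of_forall_exists f (by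
    have key : ∀ k, f k ≠ 0 := by
      rintro (i | p)
      · exact R.al_ne i
      · intro h0
        exact p.2 (R.inj (sub_eq_zero.1 h0))
    intro k
    by_contra! hk
    exact key k (LinearMap.ext hk))
  refine ⟨z, fun i => hz (Sum.inl i), fun i j hij => ?_⟩
  by_contra hne
  apply hz (Sum.inr ⟨(i, j), hne⟩)
  simp only [f, Sum.elim_inr, LinearMap.sub_apply, sub_eq_zero]
  exact hij

lemma exists_dec (v : g) : ∃ z : H, ∃ c : ι → F, v = z + ∑ i, c i • R.ev i := by
  have hv : v ∈ H.toSubmodule ⊔ Submodule.span F (Set.range R.ev) := by rw [R.span]; trivial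
  obtain ⟨z, hz, w, hw, rfl⟩ := Submodule.mem_sup.1 hv
  obtain ⟨c, rfl⟩ := (Submodule.mem_span_range_iff_exists_fun F).1 hw
  exact ⟨⟨z, hz⟩, c, rfl⟩

lemma coords : ∃ (p0 : g →ₗ[F] g) (co : ι → g →ₗ[F] F), (∀ v, p0 v ∈ H) ∧ (∀ z : H, p0 z = z) ∧
    (∀ i, p0 (R.ev i) = 0) ∧ (∀ i, co i (R.ev i) = 1) ∧ (∀ i j, i ≠ j → co i (R.ev j) = 0) ∧
    (∀ i (z : H), co i z = 0) ∧ ∀ v, v = p0 v + ∑ i, co i v • R.ev i := by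
  classical
  obtain ⟨z, hz1, hz2⟩ := R.exists_reg
  let c : Option ι → F := fun o => o.elim 0 (fun i => R.al i z)
  have hcinj : Function.Injective c := by
    rintro (_ | i) (_ | j) h
    · rfl
    · exact absurd h.symm (hz1 j)
    · exact absurd h (hz1 i)
    · exact congrArg some (hz2 h)
  let D : Module.End F g := LieAlgebra.ad F g (z : g)
  have hH : ∀ w : H, (w : g) ∈ Module.End.eigenspace D (c none) := fun w =>
    Module.End.mem_eigenspace_iff.2 (by
      change ⁅(z : g), (w : g)⁆ = (0 : F) • (w : g)
      rw [R.ab, zero_smul])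
  have he : ∀ i, R.ev i ∈ Module.End.eigenspace D (c (some i)) := fun i =>
    Module.End.mem_eigenspace_iff.2 (R.ev_eig i z)
  have htop : ⨆ o, Module.End.eigenspace D (c o) = ⊤ := by
    rw [eq_top_iff]
    intro v _
    obtain ⟨w, d, rfl⟩ := R.exists_dec v
    refine Submodule.add_mem _ (Submodule.mem_iSup_of_mem none (hH w)) (Submodule.sum_mem _ fun i _ => ?_)
    exact Submodule.smul_mem _ _ (Submodule.mem_iSup_of_mem (some i) (he i))
  obtain ⟨P, hP1, hP2, hP3⟩ := exists_proj D c hcinj htop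
  have hψ : ∀ i, ∃ ψ : Module.Dual F g, ψ (R.ev i) = 1 := by
    intro i
    obtain ⟨ψ, hψ⟩ := Module.exists_dual_forall_apply_ne_zero (K := F) (fun _ : Unit => R.ev i) (fun _ => R.ev_ne i)
    exact ⟨(ψ (R.ev i))⁻¹ • ψ, by simpa using inv_mul_cancel₀ (hψ ())⟩
  choose ψ hψ using hψ
  have q1 : ∀ w : H, P none w = w := fun w => hP2 none _ (hH w)
  have q2 : ∀ i, P none (R.ev i) = 0 := fun i => hP3 (some i) none _ (by simp) (he i)
  have q3 : ∀ i, ψ i (P (some i) (R.ev i)) = 1 := fun i => by rw [hP2 (some i) _ (he i), hψ]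
  have q4 : ∀ i j, i ≠ j → ψ i (P (some i) (R.ev j)) = 0 := fun i j hij => by
    rw [hP3 (some j) (some i) _ (by simpa using hij.symm) (he j), map_zero]
  have q5 : ∀ i (w : H), ψ i (P (some i) w) = 0 := fun i w => by
    rw [hP3 none (some i) _ (by simp) (hH w), map_zero]
  have q6 : ∀ (w : H) (d : ι → F), P none (w + ∑ i, d i • R.ev i) = w := by
    intro w d
    rw [map_add, q1, map_sum]; simp [q2]
  have q7 : ∀ (w : H) (d : ι → F) i, ψ i (P (some i) (w + ∑ i, d i • R.ev i)) = d i := by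
    intro w d i
    rw [map_add, map_add, q5, map_sum, map_sum, Finset.sum_eq_single i]
    · rw [map_smul, map_smul, q3]; simp
    · intro j _ hj
      rw [map_smul, map_smul, q4 i j hj.symm, smul_zero]
    · simp
  refine ⟨P none, fun i => ψ i ∘ₗ P (some i), ?_, q1, q2, q3, q4, q5, ?_⟩
  · intro v
    obtain ⟨w, d, rfl⟩ := R.exists_dec v
    rw [q6]; exact w.2
  · intro v
    obtain ⟨w, d, rfl⟩ := R.exists_dec v
    rw [q6]
    congr 1
    refine Finset.sum_congr rfl fun i _ => ?_
    rw [LinearMap.comp_apply, q7]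

/-- the projection to the Cartan subalgebra -/
noncomputable def p0 : g →ₗ[F] g := R.coords.choose
/-- the root coordinates -/
noncomputable def co : ι → g →ₗ[F] F := R.coords.choose_spec.choose
lemma p0_mem (v : g) : R.p0 v ∈ H := R.coords.choose_spec.choose_spec.1 v
lemma p0_coe (z : H) : R.p0 z = z := R.coords.choose_spec.choose_spec.2.1 z
lemma p0_ev (i) : R.p0 (R.ev i) = 0 := R.coords.choose_spec.choose_spec.2.2.1 i
lemma co_self (i) : R.co i (R.ev i) = 1 := R.coords.choose_spec.choose_spec.2.2.2.1 i
lemma co_ne (i j) (h : i ≠ j) : R.co i (R.ev j) = 0 := R.coords.choose_spec.choose_spec.2.2.2.2.1 i j h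
lemma co_coe (i) (z : H) : R.co i z = 0 := R.coords.choose_spec.choose_spec.2.2.2.2.2.1 i z
lemma dec (v : g) : v = R.p0 v + ∑ i, R.co i v • R.ev i := R.coords.choose_spec.choose_spec.2.2.2.2.2.2 v

lemma ext_co {v w : g} (h0 : R.p0 v = R.p0 w) (h : ∀ i, R.co i v = R.co i w) : v = w := by
  rw [R.dec v, R.dec w, h0]; simp [h]

lemma co_sum (w : H) (d : ι → F) (i : ι) : R.co i (w + ∑ i, d i • R.ev i) = d i := by
  rw [map_add, R.co_coe, map_sum, Finset.sum_eq_single i]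
  · rw [map_smul, R.co_self]; simp
  · intro j _ hj
    rw [map_smul, R.co_ne i j hj.symm, smul_zero]
  · simp

lemma p0_sum (w : H) (d : ι → F) : R.p0 (w + ∑ i, d i • R.ev i) = w := by
  rw [map_add, R.p0_coe, map_sum]; simp [R.p0_ev]

lemma lie_dec (z : H) (v : g) : ⁅(z : g), v⁆ = ∑ i, (R.al i z * R.co i v) • R.ev i := by
  conv_lhs => rw [R.dec v]
  rw [lie_add, R.ab z ⟨R.p0 v, R.p0_mem v⟩, zero_add, lie_sum]
  refine Finset.sum_congr rfl fun i _ => ?_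
  rw [lie_smul, R.ev_eig, smul_smul, mul_comm]

lemma co_lie (z : H) (v : g) (i : ι) : R.co i ⁅(z : g), v⁆ = R.al i z * R.co i v := by
  rw [R.lie_dec]
  have := R.co_sum 0 (fun i => R.al i z * R.co i v) i
  simpa using this

lemma p0_lie (z : H) (v : g) : R.p0 ⁅(z : g), v⁆ = 0 := by
  rw [R.lie_dec]
  have := R.p0_sum 0 (fun i => R.al i z * R.co i v)
  simpa using this

lemma cent_reg (z : H) (hz : ∀ i, R.al i z ≠ 0) (v : g) (hv : ⁅(z : g), v⁆ = 0) : v ∈ H := by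
  rw [R.dec v]
  have : ∀ i, R.co i v = 0 := fun i => by
    have := R.co_lie z v i
    rw [hv, map_zero] at this
    exact (mul_eq_zero.1 this.symm).resolve_left (hz i)
  simp [this, R.p0_mem]

lemma eig_iff (z : H) (c : F) (v : g) : ⁅(z : g), v⁆ = c • v ↔
    (c • R.p0 v = 0 ∧ ∀ i, (R.al i z - c) * R.co i v = 0) := by
  constructor
  · intro h
    refine ⟨?_, fun i => ?_⟩
    · rw [← map_smul, ← h, R.p0_lie]
    · have := R.co_lie z v i
      rw [h, map_smul, smul_eq_mul] at this
      rw [sub_mul, this, sub_self]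
  · rintro ⟨h0, h1⟩
    refine R.ext_co ?_ fun i => ?_
    · rw [R.p0_lie, map_smul, h0]
    · rw [R.co_lie, map_smul, smul_eq_mul]
      have := h1 i
      rw [sub_mul, sub_eq_zero] at this
      exact this

lemma adDiag_mem (R : RD F H ι) (z : H) : adDiag F (z : g) := by
  unfold adDiag
  rw [eq_top_iff]
  intro v _
  obtain ⟨w, d, rfl⟩ := R.exists_dec v
  refine Submodule.add_mem _ (Submodule.mem_iSup_of_mem 0 ?_) (Submodule.sum_mem _ fun i _ => 
    Submodule.smul_mem _ _ (Submodule.mem_iSup_of_mem (R.al i z) ?_))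
  · exact Module.End.mem_eigenspace_iff.2 (by
      change ⁅(z : g), (w : g)⁆ = (0 : F) • (w : g)
      rw [R.ab, zero_smul])
  · exact Module.End.mem_eigenspace_iff.2 (R.ev_eig i z)

end RD
end RDbasic
end

section
open scoped TensorProduct
set_option linter.unusedSectionVars false
set_option linter.unusedVariables false

/-- principal data -/
structure Prin {F : Type*} [Field F] {g : Type*} [LieRing g] [LieAlgebra F g]
    {H : LieSubalgebra F g} {ι : Type*} [Fintype ι] (R : RD F H ι) (xp xm : g) (h : H) where
  T : OpTriple (LieAlgebra.ad F g (h : g)) (LieAlgebra.ad F g xp) (LieAlgebra.ad F g xm)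
  hp : ⁅(h : g), xp⁆ = (2 : F) • xp
  hm : ⁅(h : g), xm⁆ = (-2 : F) • xm
  pm : ⁅xp, xm⁆ = h
  preg : ∀ z : g, Module.finrank F (cent F g xp) ≤ Module.finrank F (cent F g z)
  hreg : ∀ z : g, Module.finrank F (cent F g (h : g)) ≤ Module.finrank F (cent F g z)
  ht : ι → ℤ
  al_h : ∀ i, R.al i h = (ht i : F)
  ht_ne : ∀ i, ht i ≠ 0
  ht_one : ∀ i, ht i ≠ 1

section
variable {F : Type*} [Field F] [CharZero F]  {g : Type*} [LieRing g] [LieAlgebra F g]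
  [FiniteDimensional F g] 

lemma isRegular.le {L : Type*} [LieRing L] [LieAlgebra F L] {x : L} (h : isRegular F L x) (z : L) :
    Module.finrank F (cent F L x) ≤ Module.finrank F (cent F L z) := by
  unfold isRegular at h
  rw [h]
  exact Nat.sInf_le ⟨z, rfl⟩

lemma opTriple_ad {xp xm h : g} (hp : ⁅h, xp⁆ = (2 : F) • xp) (hm : ⁅h, xm⁆ = (-2 : F) • xm)
    (pm : ⁅xp, xm⁆ = h) :
    OpTriple (F := F) (LieAlgebra.ad F g h) (LieAlgebra.ad F g xp) (LieAlgebra.ad F g xm) := by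
  have key : ∀ a b : g, (LieAlgebra.ad F g a : Module.End F g) * LieAlgebra.ad F g b =
      LieAlgebra.ad F g b * LieAlgebra.ad F g a + LieAlgebra.ad F g ⁅a, b⁆ := by
    intro a b
    ext y
    simp only [Module.End.mul_apply, LinearMap.add_apply, LieAlgebra.ad_apply]
    rw [leibniz_lie a b y, add_comm]
  refine ⟨?_, ?_, ?_⟩
  · rw [key h xp, hp]; simp [ofNat_smul_eq_nsmul]
  · rw [key h xm, hm]; simp [ofNat_smul_eq_nsmul, sub_eq_add_neg]
  · rw [key xp xm, pm]

lemma cent_eq_ker (x : g) : cent F g x = LinearMap.ker (LieAlgebra.ad F g x : Module.End F g) := by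
  ext y; exact Iff.rfl

lemma exists_prin [IsAlgClosed F] [LieAlgebra.IsKilling F g] {xp xm h : g}
    (hp : ⁅h, xp⁆ = (2 : F) • xp) (hm : ⁅h, xm⁆ = (-2 : F) • xm)
    (pm : ⁅xp, xm⁆ = h) (hpreg : isRegular F g xp) (hhreg : isRegular F g h) :
    ∃ (H : LieSubalgebra F g) (_ : H.IsCartanSubalgebra) (hh : h ∈ H) (R : RD F H (LieSubalgebra.root (H := H))),
      Nonempty (Prin R xp xm ⟨h, hh⟩) := by
  have T := opTriple_ad hp hm pm
  have hd : adDiag F h := by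
    unfold adDiag
    rw [eq_top_iff, ← T.iSup_eigenspace]
    exact iSup_le fun i => le_iSup (fun c : F => Module.End.eigenspace (LieAlgebra.ad F g h : Module.End F g) c) (i : F)
  obtain ⟨H, hH, hhH, _⟩ := exists_cartan (F := F) (s := h) (k := h) (lie_self h) hd hd
  obtain ⟨R⟩ := RD.exists H
  obtain ⟨z, hz, _⟩ := R.exists_reg
  have h1 : cent F g (z : g) ≤ H.toSubmodule := fun v hv => R.cent_reg z hz v hv
  have h2 : H.toSubmodule ≤ cent F g h := fun v hv => R.ab ⟨h, hhH⟩ ⟨v, hv⟩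
  have h3 : cent F g (z : g) = cent F g h :=
    Submodule.eq_of_le_of_finrank_le (h1.trans h2) (hhreg.le z)
  have h4 : cent F g h ≤ H.toSubmodule := h3 ▸ h1
  have hne : ∀ i, R.al i ⟨h, hhH⟩ ≠ 0 := by
    intro i h0
    have h5 : R.ev i ∈ H := h4 (by
      change ⁅h, R.ev i⁆ = 0
      have := R.ev_eig i ⟨h, hhH⟩
      rw [h0, zero_smul] at this
      exact this)
    have := R.co_coe i ⟨_, h5⟩
    rw [R.co_self] at this
    exact one_ne_zero this
  have hint : ∀ i, ∃ n : ℤ, R.al i ⟨h, hhH⟩ = n := by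
    intro i
    by_contra! hn
    have hind := Module.End.eigenspaces_iSupIndep (LieAlgebra.ad F g h : Module.End F g)
    have h6 : R.ev i ∈ Module.End.eigenspace (LieAlgebra.ad F g h : Module.End F g) (R.al i ⟨h, hhH⟩) :=
      Module.End.mem_eigenspace_iff.2 (R.ev_eig i ⟨h, hhH⟩)
    have h7 : R.ev i ∈ ⨆ (j : F) (_ : j ≠ R.al i ⟨h, hhH⟩),
        Module.End.eigenspace (LieAlgebra.ad F g h : Module.End F g) j := by
      have : ⨆ i : ℤ, Module.End.eigenspace (LieAlgebra.ad F g h : Module.End F g) (i : F) ≤ 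
        ⨆ (j : F) (_ : j ≠ R.al i ⟨h, hhH⟩),
        Module.End.eigenspace (LieAlgebra.ad F g h : Module.End F g) j :=
        iSup_le fun n => le_iSup₂_of_le (n : F) (hn n).symm le_rfl
      apply this
      rw [T.iSup_eigenspace]; trivial
    exact R.ev_ne i (Submodule.disjoint_def.1 (hind _) _ h6 h7)
  choose ht hht using hint
  refine ⟨H, hH, hhH, R, ⟨⟨T, hp, hm, pm, hpreg.le, hhreg.le, ht, hht, fun i h0 => ?_, fun i h0 => ?_⟩⟩⟩
  · apply hne i; rw [hht, h0]; simp
  · have := T.eig_one (by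
      have := hpreg.le (h : g)
      rw [cent_eq_ker, cent_eq_ker] at this
      exact this)
    apply R.ev_ne i
    have h6 : R.ev i ∈ Module.End.eigenspace (LieAlgebra.ad F g h : Module.End F g) ((1 : ℤ) : F) :=
      Module.End.mem_eigenspace_iff.2 (by
        have := R.ev_eig i ⟨h, hhH⟩
        rw [hht, h0] at this
        exact this)
    rw [this] at h6
    exact (Submodule.mem_bot F).1 h6
end
end

section
open scoped TensorProduct
set_option linter.unusedSectionVars false
set_option linter.unusedVariables false

section Meet
variable {F : Type*} [Field F] [IsAlgClosed F]

lemma exists_point (B : Type*) [CommRing B] [Nontrivial B] [Algebra F B] [Algebra.FiniteType F B] :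
    Nonempty (B →ₐ[F] F) := by
  obtain ⟨m, hm⟩ := Ideal.exists_maximal B
  let _ : Field (B ⧸ m) := Ideal.Quotient.field m
  have : Algebra.FiniteType F (B ⧸ m) := Algebra.FiniteType.of_surjective
    (Ideal.Quotient.mkₐ F m) (Ideal.Quotient.mkₐ_surjective F m)
  have hfin : Module.Finite F (B ⧸ m) := finite_of_finite_type_of_isJacobsonRing F (B ⧸ m)
  have : Algebra.IsAlgebraic F (B ⧸ m) := Algebra.IsAlgebraic.of_finite F _
  exact ⟨(IsAlgClosed.lift (R := F) (S := B ⧸ m) (M := F)).comp (Ideal.Quotient.mkₐ F m)⟩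

universe uu1 uu2 uu3
lemma common_ext {K : Type uu1} {K1 : Type uu2} {K2 : Type uu3} [Field K] [Field K1] [Field K2] [Algebra F K] [Algebra F K1]
    [Algebra F K2] (f1 : K →ₐ[F] K1) (f2 : K →ₐ[F] K2) :
    ∃ (Ω : Type (max uu2 uu3)) (_ : Field Ω) (_ : Algebra F Ω) (j1 : K1 →ₐ[F] Ω) (j2 : K2 →ₐ[F] Ω),
      ∀ x, j1 (f1 x) = j2 (f2 x) := by
  let _ : Algebra K K1 := f1.toRingHom.toAlgebra
  let _ : Algebra K K2 := f2.toRingHom.toAlgebra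
  have : IsScalarTower F K K1 := IsScalarTower.of_algebraMap_eq fun x => (f1.commutes x).symm
  have : IsScalarTower F K K2 := IsScalarTower.of_algebraMap_eq fun x => (f2.commutes x).symm
  let T := K1 ⊗[K] K2
  obtain ⟨m, hm⟩ := Ideal.exists_maximal T
  let Ω := T ⧸ m
  let _ : Field Ω := Ideal.Quotient.field m
  let j1 : K1 →ₐ[F] Ω := (Ideal.Quotient.mkₐ F m).comp
    ((Algebra.TensorProduct.includeLeft : K1 →ₐ[K] T).restrictScalars F)
  let j2 : K2 →ₐ[F] Ω := (Ideal.Quotient.mkₐ F m).comp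
    ((Algebra.TensorProduct.includeRight : K2 →ₐ[K] T).restrictScalars F)
  have hj : ∀ x : K, j1 (f1 x) = j2 (f2 x) := by
    intro x
    change Ideal.Quotient.mk m _ = Ideal.Quotient.mk m _
    congr 1
    have e1 := (Algebra.TensorProduct.includeLeft : K1 →ₐ[K] T).commutes x
    have e2 := (Algebra.TensorProduct.includeRight : K2 →ₐ[K] T).commutes x
    exact e1.trans e2.symm
  exact ⟨Ω, inferInstance, inferInstance, j1, j2, hj⟩

lemma meet {σ σ' κ : Type*} [Finite σ] [Finite σ'] (P : κ → MvPolynomial σ F)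
    (P' : κ → MvPolynomial σ' F)
    (hP : Function.Injective (MvPolynomial.aeval P : MvPolynomial κ F →ₐ[F] _))
    (hP' : Function.Injective (MvPolynomial.aeval P' : MvPolynomial κ F →ₐ[F] _))
    (b : MvPolynomial σ F) (hb : b ≠ 0) :
    ∃ (y : σ → F) (y' : σ' → F), (∀ i, MvPolynomial.eval y (P i) = MvPolynomial.eval y' (P' i)) ∧
      MvPolynomial.eval y b ≠ 0 := by
  let K := FractionRing (MvPolynomial κ F)
  let K1 := FractionRing (MvPolynomial σ F)
  let K2 := FractionRing (MvPolynomial σ' F)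
  let i1 : MvPolynomial σ F →ₐ[F] K1 := IsScalarTower.toAlgHom F _ _
  let i2 : MvPolynomial σ' F →ₐ[F] K2 := IsScalarTower.toAlgHom F _ _
  have hi1 : Function.Injective i1 := IsFractionRing.injective (MvPolynomial σ F) K1
  have hi2 : Function.Injective i2 := IsFractionRing.injective (MvPolynomial σ' F) K2
  let f1 : K →ₐ[F] K1 := IsFractionRing.liftAlgHom (g := i1.comp (MvPolynomial.aeval P)) (hi1.comp hP)
  let f2 : K →ₐ[F] K2 := IsFractionRing.liftAlgHom (g := i2.comp (MvPolynomial.aeval P')) (hi2.comp hP')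
  have hf1 : ∀ x, f1 (algebraMap _ K x) = i1 (MvPolynomial.aeval P x) := fun x =>
    IsFractionRing.lift_algebraMap (g := (i1.comp (MvPolynomial.aeval P)).toRingHom) (hi1.comp hP) x
  have hf2 : ∀ x, f2 (algebraMap _ K x) = i2 (MvPolynomial.aeval P' x) := fun x =>
    IsFractionRing.lift_algebraMap (g := (i2.comp (MvPolynomial.aeval P')).toRingHom) (hi2.comp hP') x
  obtain ⟨Ω, _, _, j1, j2, hj⟩ := common_ext f1 f2
  let k1 := j1.comp i1
  let k2 := j2.comp i2
  have hk : ∀ i, k1 (P i) = k2 (P' i) := by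
    intro i
    have h1 := hf1 (MvPolynomial.X i)
    have h2 := hf2 (MvPolynomial.X i)
    rw [MvPolynomial.aeval_X] at h1 h2
    change j1 (i1 (P i)) = j2 (i2 (P' i))
    rw [← h1, ← h2, hj]
  have hb' : k1 b ≠ 0 := by
    intro h0
    have h1 : Function.Injective k1 := (RingHom.injective j1.toRingHom).comp hi1
    exact hb (h1 (h0.trans (map_zero k1).symm))
  let B : Subalgebra F Ω := (k1.range ⊔ k2.range) ⊔ Algebra.adjoin F {(k1 b)⁻¹}
  have hfg : B.FG := by
    refine Subalgebra.FG.sup (Subalgebra.FG.sup ?_ ?_) ?_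
    · rw [← Algebra.map_top]
      exact Subalgebra.FG.map _ (Algebra.FiniteType.out)
    · rw [← Algebra.map_top]
      exact Subalgebra.FG.map _ (Algebra.FiniteType.out)
    · exact ⟨{(k1 b)⁻¹}, by simp⟩
  have : Algebra.FiniteType F B := (Subalgebra.fg_iff_finiteType B).1 hfg
  obtain ⟨ε⟩ := exists_point (F := F) B
  have m1 : ∀ x, k1 x ∈ B := fun x => (le_sup_left.trans le_sup_left : k1.range ≤ B) ⟨x, rfl⟩
  have m2 : ∀ x, k2 x ∈ B := fun x => (le_sup_right.trans le_sup_left : k2.range ≤ B) ⟨x, rfl⟩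
  have m3 : (k1 b)⁻¹ ∈ B := (le_sup_right : _ ≤ B) (Algebra.subset_adjoin rfl)
  let l1 : MvPolynomial σ F →ₐ[F] F := ε.comp (k1.codRestrict B m1)
  let l2 : MvPolynomial σ' F →ₐ[F] F := ε.comp (k2.codRestrict B m2)
  have e1 : ∀ x, MvPolynomial.eval (fun s => l1 (MvPolynomial.X s)) x = l1 x := by
    intro x
    have := DFunLike.congr_fun (MvPolynomial.aeval_unique l1) x
    rw [MvPolynomial.aeval_eq_eval] at this
    exact this.symm
  have e2 : ∀ x, MvPolynomial.eval (fun s => l2 (MvPolynomial.X s)) x = l2 x := by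
    intro x
    have := DFunLike.congr_fun (MvPolynomial.aeval_unique l2) x
    rw [MvPolynomial.aeval_eq_eval] at this
    exact this.symm
  refine ⟨fun s => l1 (MvPolynomial.X s), fun s => l2 (MvPolynomial.X s), fun i => ?_, ?_⟩
  · rw [e1, e2]
    change ε _ = ε _
    congr 1
    exact Subtype.ext (hk i)
  · rw [e1]
    intro h0
    have h1 : ε ⟨k1 b, m1 b⟩ = 0 := h0
    have h2 : (⟨k1 b, m1 b⟩ : B) * ⟨(k1 b)⁻¹, m3⟩ = 1 := Subtype.ext (mul_inv_cancel₀ hb')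
    have h3 := congrArg ε h2
    rw [map_mul, h1, zero_mul, map_one] at h3
    exact zero_ne_one h3

end Meet

section Low
variable {F : Type*} [Field F] [CharZero F] {κ : Type*} [Finite κ]
open Polynomial

lemma lowest0 (G : MvPolynomial κ F) (hG : G ≠ 0) : ∃ u : κ → F, ∀ Q : κ → F[X],
    MvPolynomial.aeval (fun i => X * (C (u i) + X * Q i)) G ≠ 0 := by
  classical
  have hex : ∃ d, MvPolynomial.homogeneousComponent d G ≠ 0 := by
    by_contra! h
    apply hG
    rw [← MvPolynomial.sum_homogeneousComponent G]
    simp [h]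
  let d := Nat.find hex
  have hd : MvPolynomial.homogeneousComponent d G ≠ 0 := Nat.find_spec hex
  have hmin : ∀ k < d, MvPolynomial.homogeneousComponent k G = 0 := fun k hk => by
    have := Nat.find_min hex hk
    simpa using this
  obtain ⟨u, hu⟩ : ∃ u, MvPolynomial.eval u (MvPolynomial.homogeneousComponent d G) ≠ 0 := by
    by_contra! h
    exact hd (MvPolynomial.funext (by simpa using h))
  refine ⟨u, fun Q h0 => hu ?_⟩
  set y : κ → F[X] := fun i => C (u i) + X * Q i with hy
  have hhom : ∀ k, MvPolynomial.aeval (fun i => X * y i) (MvPolynomial.homogeneousComponent k G) =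
      X ^ k * MvPolynomial.aeval y (MvPolynomial.homogeneousComponent k G) := by
    intro k
    have := (MvPolynomial.homogeneousComponent_isHomogeneous k G)
    rw [MvPolynomial.aeval_def, MvPolynomial.aeval_def, MvPolynomial.eval₂_eq, MvPolynomial.eval₂_eq, Finset.mul_sum]
    refine Finset.sum_congr rfl fun m hm => ?_
    have hk := this (MvPolynomial.mem_support_iff.1 hm)
    simp only [mul_pow, Finset.prod_mul_distrib]
    rw [Finset.prod_pow_eq_pow_sum]
    have : ∑ i ∈ m.support, m i = k := by
      rw [← hk, Finsupp.weight_apply]; simp [Finsupp.sum]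
    rw [this]; ring
  rw [← MvPolynomial.sum_homogeneousComponent G, map_sum] at h0
  have hdle : d ≤ G.totalDegree := by
    by_contra! hlt
    exact hd (MvPolynomial.homogeneousComponent_eq_zero _ _ hlt)
  have h1 : X ^ d * ∑ k ∈ Finset.range (G.totalDegree + 1),
      (if k < d then 0 else X ^ (k - d) * MvPolynomial.aeval y (MvPolynomial.homogeneousComponent k G)) = (0 : F[X]) := by
    refine Eq.trans ?_ h0
    rw [Finset.mul_sum]
    refine Finset.sum_congr rfl fun k _ => ?_
    split_ifs with hk
    · rw [hmin k hk]; simp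
    · rw [hhom, ← mul_assoc, ← pow_add]; congr 2; omega
  have h2 := (mul_eq_zero.1 h1).resolve_left (pow_ne_zero _ X_ne_zero)
  have h3 := congrArg (Polynomial.eval 0) h2
  rw [Polynomial.eval_finsetSum, Finset.sum_eq_single d] at h3
  · rw [if_neg (lt_irrefl d), Nat.sub_self, pow_zero, one_mul, Polynomial.eval_zero] at h3
    rw [← h3]
    have key : ∀ p : MvPolynomial κ F, MvPolynomial.eval u p = Polynomial.eval 0 (MvPolynomial.aeval y p) := by
      intro p
      have : (MvPolynomial.aeval u : MvPolynomial κ F →ₐ[F] F) = (Polynomial.aeval (0 : F)).comp (MvPolynomial.aeval y) := by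
        ext i
        simp [hy]
      have := DFunLike.congr_fun this p
      rw [MvPolynomial.aeval_eq_eval] at this
      rw [AlgHom.comp_apply, Polynomial.coe_aeval_eq_eval] at this
      exact this
    exact key _
  · intro k _ hk
    split_ifs with hlt
    · simp
    · have : k - d ≠ 0 := by omega
      simp [this]
  · intro hn; exact absurd (Finset.mem_range.2 (by omega)) hn

lemma lowest (a : κ → F) (G : MvPolynomial κ F) (hG : G ≠ 0) : ∃ u : κ → F, ∀ Q : κ → F[X],
    MvPolynomial.aeval (fun i => C (a i) + X * C (u i) + X ^ 2 * Q i) G ≠ 0 := by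
  let τ : MvPolynomial κ F →ₐ[F] MvPolynomial κ F := MvPolynomial.aeval (fun i => MvPolynomial.X i + MvPolynomial.C (a i))
  let τ' : MvPolynomial κ F →ₐ[F] MvPolynomial κ F := MvPolynomial.aeval (fun i => MvPolynomial.X i - MvPolynomial.C (a i))
  have h1 : τ'.comp τ = AlgHom.id F _ := by
    ext i
    simp [τ, τ', MvPolynomial.algebraMap_eq]
  have h2 : τ G ≠ 0 := by
    intro h0
    apply hG
    have := DFunLike.congr_fun h1 G
    rw [AlgHom.comp_apply, h0, map_zero] at this
    exact this.symm
  obtain ⟨u, hu⟩ := lowest0 (τ G) h2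
  refine ⟨u, fun Q h0 => hu Q ?_⟩
  rw [← h0]
  have : (MvPolynomial.aeval (fun i => X * (C (u i) + X * Q i))).comp τ = 
      MvPolynomial.aeval (fun i => C (a i) + X * C (u i) + X ^ 2 * Q i) := by
    ext1 i
    simp only [AlgHom.comp_apply, τ, MvPolynomial.aeval_X, map_add]
    rw [← MvPolynomial.algebraMap_eq, AlgHom.commutes, Polynomial.algebraMap_eq]
    ring
  exact DFunLike.congr_fun this G
end Low
end

section
open scoped TensorProduct
set_option linter.unusedSectionVars false
set_option linter.unusedVariables false

section PolyMap
variable {F : Type*} [Field F] [CharZero F] {g : Type*} [LieRing g] [LieAlgebra F g]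
  [FiniteDimensional F g]

lemma expEnd_ad_smul (c : F) (e v : g) : expEnd (LieAlgebra.ad F g (c • e) : Module.End F g) v =
    ∑ n ∈ Finset.range (Module.finrank F g + 1), (((n.factorial : F)⁻¹) * c ^ n) •
      ((LieAlgebra.ad F g e : Module.End F g) ^ n) v := by
  unfold expEnd
  rw [map_smul, LinearMap.sum_apply]
  refine Finset.sum_congr rfl fun n _ => ?_
  rw [smul_pow, LinearMap.smul_apply, LinearMap.smul_apply, smul_smul]

/-- polynomial maps into `g` -/
def IsPolyMap {σ : Type*} (f : (σ → F) → g) : Prop :=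
  ∀ ψ : g →ₗ[F] F, ∃ P : MvPolynomial σ F, ∀ y, MvPolynomial.eval y P = ψ (f y)

lemma IsPolyMap.exp {σ : Type*} {f : (σ → F) → g} (hf : IsPolyMap f) (i : σ) (e : g) :
    IsPolyMap (fun y => expEnd (LieAlgebra.ad F g (y i • e) : Module.End F g) (f y)) := by
  intro ψ
  choose P hP using fun n : ℕ => hf (ψ ∘ₗ ((LieAlgebra.ad F g e : Module.End F g) ^ n))
  refine ⟨∑ n ∈ Finset.range (Module.finrank F g + 1),
    MvPolynomial.C ((n.factorial : F)⁻¹) * MvPolynomial.X i ^ n * P n, fun y => ?_⟩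
  beta_reduce
  rw [expEnd_ad_smul, map_sum, map_sum]
  refine Finset.sum_congr rfl fun n _ => ?_
  simp [hP]

/-- first order expansions -/
def Jet (f : F → g) (a b : g) : Prop :=
  ∀ ψ : g →ₗ[F] F, ∃ Q : Polynomial F, ∀ t, ψ (f t) = ψ a + t * ψ b + t ^ 2 * Q.eval t

lemma Jet.exp {f : F → g} {a b : g} (hf : Jet f a b) (c : F) (e : g) (hfin : 1 ≤ Module.finrank F g) :
    Jet (fun t => expEnd (LieAlgebra.ad F g ((t * c) • e) : Module.End F g) (f t)) a (b + c • ⁅e, a⁆) := by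
  intro ψ
  choose Q hQ using fun n : ℕ => hf (ψ ∘ₗ ((LieAlgebra.ad F g e : Module.End F g) ^ n))
  obtain ⟨m, hm⟩ : ∃ m, Module.finrank F g + 1 = m + 2 := ⟨Module.finrank F g - 1, by omega⟩
  refine ⟨Q 0 + Polynomial.C c * (Polynomial.C (ψ ⁅e, b⁆) + Polynomial.X * Q 1) + 
    ∑ n ∈ Finset.range m, Polynomial.C (((n + 2).factorial : F)⁻¹ * c ^ (n + 2)) * Polynomial.X ^ n * 
    (Polynomial.C (ψ (((LieAlgebra.ad F g e : Module.End F g) ^ (n + 2)) a)) + 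
     Polynomial.X * Polynomial.C (ψ (((LieAlgebra.ad F g e : Module.End F g) ^ (n + 2)) b)) + Polynomial.X ^ 2 * Q (n + 2)),
    fun t => ?_⟩
  simp only [LinearMap.comp_apply] at hQ
  have h0 := hQ 0 t
  have h1 := hQ 1 t
  simp only [pow_zero, Module.End.one_apply, pow_one, LieAlgebra.ad_apply] at h0 h1
  beta_reduce
  rw [expEnd_ad_smul, map_sum, hm, Finset.sum_range_succ', Finset.sum_range_succ']
  simp only [map_smul, smul_eq_mul, hQ (_ + 1 + 1) t, Polynomial.eval_add, Polynomial.eval_mul,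
    Polynomial.eval_C, Polynomial.eval_X, Polynomial.eval_pow, Polynomial.eval_finsetSum, map_add]
  simp only [Nat.zero_add, pow_zero, pow_one, Module.End.one_apply, LieAlgebra.ad_apply, h0, h1,
    Nat.factorial_zero, Nat.factorial_one, Nat.cast_one, inv_one, one_mul]
  rw [mul_add (t ^ 2), Finset.mul_sum]
  have : ∀ x ∈ Finset.range m, ((x + 1 + 1).factorial : F)⁻¹ * (t * c) ^ (x + 1 + 1) *
      (ψ (((LieAlgebra.ad F g e : Module.End F g) ^ (x + 1 + 1)) a) + t * ψ (((LieAlgebra.ad F g e : Module.End F g) ^ (x + 1 + 1)) b) +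
        t ^ 2 * Polynomial.eval t (Q (x + 1 + 1))) = t ^ 2 * (((x + 2).factorial : F)⁻¹ * c ^ (x + 2) * t ^ x *
      (ψ (((LieAlgebra.ad F g e : Module.End F g) ^ (x + 2)) a) + t * ψ (((LieAlgebra.ad F g e : Module.End F g) ^ (x + 2)) b) +
        t ^ 2 * Polynomial.eval t (Q (x + 2)))) := fun x _ => by ring
  rw [Finset.sum_congr rfl this]
  ring

/-- the parametrization -/
noncomputable def parm {ι τ : Type*} (e : ι → g) (zz : (τ → F) →ₗ[F] g) : List ι → (ι ⊕ τ → F) → g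
  | [], y => zz (fun k => y (Sum.inr k))
  | i :: l, y => expEnd (LieAlgebra.ad F g (y (Sum.inl i) • e i) : Module.End F g) (parm e zz l y)

variable {ι τ : Type*} [Finite τ] (e : ι → g) (zz : (τ → F) →ₗ[F] g)

lemma parm_poly (l : List ι) : IsPolyMap (parm e zz l) := by
  induction l with
  | nil =>
    intro ψ
    classical
    let _ := Fintype.ofFinite τ
    refine ⟨∑ k, MvPolynomial.X (Sum.inr k) * MvPolynomial.C (ψ (zz (Pi.single k 1))), fun y => ?_⟩
    simp only [map_sum, map_mul, MvPolynomial.eval_X, MvPolynomial.eval_C, parm]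
    conv_rhs => rw [LinearMap.pi_apply_eq_sum_univ zz]
    simp only [map_sum, map_smul, smul_eq_mul]
    refine Finset.sum_congr rfl fun k _ => ?_
    congr 3
    ext j; simp [Pi.single_apply, eq_comm]
  | cons i l ih => exact ih.exp (Sum.inl i) (e i)

lemma parm_jet (hfin : 1 ≤ Module.finrank F g) (w : τ → F) (v : ι ⊕ τ → F) (l : List ι) :
    Jet (fun t => parm e zz l (fun s => Sum.elim (0 : ι → F) w s + t * v s)) (zz w)
      (zz (fun k => v (Sum.inr k)) + (l.map fun i => v (Sum.inl i) • ⁅e i, zz w⁆).sum) := by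
  induction l with
  | nil =>
    intro ψ
    refine ⟨0, fun t => ?_⟩
    simp only [parm, Sum.elim_inr]
    have : (fun k => w k + t * v (Sum.inr k)) = w + t • (fun k => v (Sum.inr k)) := rfl
    rw [this, map_add, map_smul]
    simp
  | cons i l ih =>
    have := ih.exp (v (Sum.inl i)) (e i) hfin
    convert this using 1
    · funext t; simp [parm]
    · simp; abel

lemma parm_inn (he : ∀ i, IsNilpotent (LieAlgebra.ad F g (e i) : Module.End F g)) (l : List ι) (y : ι ⊕ τ → F) :
    InnRel F (zz (fun k => y (Sum.inr k))) (parm e zz l y) := by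
  induction l with
  | nil => exact InnRel.refl _
  | cons i l ih =>
    refine ih.trans (InnRel.exp _ ?_ _)
    rw [map_smul]
    exact (he i).smul _

lemma parm_inj [Fintype ι] {κ : Type*} [Finite κ] (B : Module.Basis κ F g) (w : τ → F)
    (hsurj : ∀ u : g, ∃ v : ι ⊕ τ → F, u = zz (fun k => v (Sum.inr k)) + ∑ i, v (Sum.inl i) • ⁅e i, zz w⁆)
    (P : κ → MvPolynomial (ι ⊕ τ) F)
    (hP : ∀ i y, MvPolynomial.eval y (P i) = B.coord i (parm e zz Finset.univ.toList y)) :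
    Function.Injective (MvPolynomial.aeval P : MvPolynomial κ F →ₐ[F] _) := by
  let _ := Fintype.ofFinite κ
  rw [injective_iff_map_eq_zero]
  intro G hG
  by_contra hne
  obtain ⟨u, hu⟩ := lowest (fun i => B.coord i (zz w)) G hne
  by_cases hfin : 1 ≤ Module.finrank F g
  · obtain ⟨v, hv⟩ := hsurj (B.equivFun.symm u)
    have hj := parm_jet e zz hfin w v Finset.univ.toList
    rw [Finset.sum_map_toList, ← hv] at hj
    choose Q hQ using fun i => hj (B.coord i)
    refine hu Q (Polynomial.funext fun t => ?_)
    rw [Polynomial.eval_zero]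
    have h1 : ∀ p : MvPolynomial κ F, Polynomial.eval t (MvPolynomial.aeval (fun i => Polynomial.C (B.coord i (zz w)) +
        Polynomial.X * Polynomial.C (u i) + Polynomial.X ^ 2 * Q i) p) = 
        MvPolynomial.eval (fun s => Sum.elim (0 : ι → F) w s + t * v s) (MvPolynomial.aeval P p) := by
      intro p
      have : (Polynomial.aeval t).comp (MvPolynomial.aeval (fun i => Polynomial.C (B.coord i (zz w)) +
        Polynomial.X * Polynomial.C (u i) + Polynomial.X ^ 2 * Q i)) = 
        (MvPolynomial.aeval (fun s => Sum.elim (0 : ι → F) w s + t * v s)).comp (MvPolynomial.aeval P) := by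
        ext i
        simp only [AlgHom.comp_apply, MvPolynomial.aeval_X, Polynomial.coe_aeval_eq_eval, MvPolynomial.aeval_eq_eval]
        change _ = MvPolynomial.eval _ (P i)
        rw [hP, hQ]
        have hui : B.coord i (B.equivFun.symm u) = u i := congr_fun (B.equivFun.apply_symm_apply u) i
        rw [hui]
        simp only [Polynomial.eval_add, Polynomial.eval_mul, Polynomial.eval_C, Polynomial.eval_X, Polynomial.eval_pow]
      have := DFunLike.congr_fun this p
      simpa [MvPolynomial.aeval_eq_eval, Polynomial.coe_aeval_eq_eval] using this
    rw [h1, hG, map_zero]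
  · have h0 : Module.finrank F g = 0 := by omega
    have : IsEmpty κ := by
      rw [Module.finrank_eq_card_basis B] at h0
      exact Fintype.card_eq_zero_iff.1 h0
    obtain ⟨c, rfl⟩ := MvPolynomial.C_surjective κ G
    rw [← MvPolynomial.algebraMap_eq, AlgHom.commutes] at hG
    apply hne
    rw [← MvPolynomial.algebraMap_eq, (FaithfulSMul.algebraMap_eq_zero_iff F (MvPolynomial (ι ⊕ τ) F)).1 hG, map_zero]

end PolyMap

section Conj
variable {F : Type*} [Field F] [CharZero F] [IsAlgClosed F] {g : Type*} [LieRing g] [LieAlgebra F g]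
  [FiniteDimensional F g] {H : LieSubalgebra F g} {ι : Type*} [Fintype ι] (R : RD F H ι)

lemma RD.triple (i : ι) : OpTriple (F := F) (LieAlgebra.ad F g (R.cr i : g)) (LieAlgebra.ad F g (R.ev i)) (LieAlgebra.ad F g (R.fv i)) :=
  opTriple_ad (by rw [R.ev_eig, R.al_cr]) (by rw [R.fv_eig, R.al_cr, neg_smul]) (R.ef i)

lemma RD.exists_parm (R : RD F H ι) : ∃ (n : ℕ) (zz : (Fin n → F) →ₗ[F] g), LinearMap.range zz = H.toSubmodule ∧ 
    ∀ P : Fin (Module.finrank F g) → MvPolynomial (ι ⊕ Fin n) F, 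
    (∀ i y, MvPolynomial.eval y (P i) = (Module.finBasis F g).coord i (parm R.ev zz Finset.univ.toList y)) → 
    Function.Injective (MvPolynomial.aeval P : MvPolynomial _ F →ₐ[F] _) := by
  let bH := Module.finBasis F H
  let zz : (Fin (Module.finrank F H) → F) →ₗ[F] g := H.toSubmodule.subtype ∘ₗ bH.equivFun.symm.toLinearMap
  have hr : LinearMap.range zz = H.toSubmodule := by
    rw [LinearMap.range_comp, LinearEquiv.range, Submodule.map_top]
    exact Submodule.range_subtype _
  refine ⟨_, zz, hr, fun P hP => ?_⟩
  obtain ⟨z, hz, _⟩ := R.exists_reg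
  refine parm_inj R.ev zz (Module.finBasis F g) (bH.equivFun z) (fun u => ?_) P hP
  have hzz : zz (bH.equivFun z) = z := by simp [zz]
  obtain ⟨w, d, rfl⟩ := R.exists_dec u
  refine ⟨Sum.elim (fun i => - (d i * (R.al i z)⁻¹)) (bH.equivFun w), ?_⟩
  simp only [Sum.elim_inl, Sum.elim_inr]
  rw [hzz]
  congr 1
  · simp [zz]
  · refine Finset.sum_congr rfl fun i _ => ?_
    rw [← lie_skew, R.ev_eig, smul_neg, smul_smul, neg_mul, neg_smul, neg_neg, mul_assoc, inv_mul_cancel₀ (hz i), mul_one]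

lemma RD.conj (R : RD F H ι) {H' : LieSubalgebra F g} {ι' : Type*} [Fintype ι'] (R' : RD F H' ι') :
    ∃ θ : g ≃ₗ⁅F⁆ g, Inn θ ∧ ∀ w ∈ H', θ w ∈ H := by
  obtain ⟨n, zz, hr, hinj⟩ := R.exists_parm
  obtain ⟨n', zz', hr', hinj'⟩ := R'.exists_parm
  choose P hP using fun i => parm_poly R.ev zz Finset.univ.toList ((Module.finBasis F g).coord i)
  choose P' hP' using fun i => parm_poly R'.ev zz' Finset.univ.toList ((Module.finBasis F g).coord i)
  have hmem : ∀ w, zz w ∈ H := fun w => by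
    have : zz w ∈ LinearMap.range zz := ⟨w, rfl⟩
    rw [hr] at this; exact this
  have hmem' : ∀ w, zz' w ∈ H' := fun w => by
    have : zz' w ∈ LinearMap.range zz' := ⟨w, rfl⟩
    rw [hr'] at this; exact this
  let zH : (Fin n → F) →ₗ[F] H := zz.codRestrict H.toSubmodule hmem
  classical
  let b : MvPolynomial (ι ⊕ Fin n) F := ∏ i : ι, ∑ k : Fin n, MvPolynomial.X (Sum.inr k) * MvPolynomial.C (R.al i (zH (Pi.single k 1)))
  have hb : ∀ y, MvPolynomial.eval y b = ∏ i, R.al i (zH (fun k => y (Sum.inr k))) := by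
    intro y
    simp only [b, map_prod, map_sum, map_mul, MvPolynomial.eval_X, MvPolynomial.eval_C]
    refine Finset.prod_congr rfl fun i _ => ?_
    conv_rhs => rw [LinearMap.pi_apply_eq_sum_univ zH]
    simp only [map_sum, map_smul, smul_eq_mul]
    refine Finset.sum_congr rfl fun k _ => ?_
    congr 3
    ext j; simp [Pi.single_apply, eq_comm]
  have hb0 : b ≠ 0 := by
    intro h0
    obtain ⟨z, hz, _⟩ := R.exists_reg
    have : (z : g) ∈ LinearMap.range zz := by rw [hr]; exact z.2
    obtain ⟨w, hw⟩ := this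
    have h1 := hb (Sum.elim 0 w)
    rw [h0, map_zero] at h1
    have h2 : zH w = z := Subtype.ext hw
    have h3 : (fun k => (Sum.elim 0 w : ι ⊕ Fin n → F) (Sum.inr k)) = w := rfl
    rw [h3, h2] at h1
    exact Finset.prod_ne_zero_iff.2 (fun i _ => hz i) h1.symm
  obtain ⟨y, y', hyy, hby⟩ := meet P P' (hinj P hP) (hinj' P' hP') b hb0
  have heq : parm R.ev zz Finset.univ.toList y = parm R'.ev zz' Finset.univ.toList y' := by
    refine (Module.finBasis F g).ext_elem fun i => ?_
    have := hyy i
    rw [hP, hP'] at this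
    exact this
  have h1 := parm_inn R.ev zz (fun i => (R.triple i).nil_e) Finset.univ.toList y
  have h2 := parm_inn R'.ev zz' (fun i => (R'.triple i).nil_e) Finset.univ.toList y'
  rw [heq] at h1
  obtain ⟨θ, hθ, hθz⟩ := h2.trans h1.symm
  refine ⟨θ, hθ, fun w hw => ?_⟩
  rw [hb] at hby
  refine R.cent_reg (zH (fun k => y (Sum.inr k))) (fun i => Finset.prod_ne_zero_iff.1 hby i (Finset.mem_univ i)) _ ?_
  change ⁅zz (fun k => y (Sum.inr k)), θ w⁆ = 0
  rw [← hθz, ← LieEquiv.map_lie]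
  rw [R'.ab ⟨_, hmem' _⟩ ⟨w, hw⟩, map_zero]
end Conj
end

section
open scoped TensorProduct
set_option linter.unusedSectionVars false
set_option linter.unusedVariables false

section Weyl
variable {F : Type*} [Field F] [CharZero F] [IsAlgClosed F] {g : Type*} [LieRing g] [LieAlgebra F g]
  [FiniteDimensional F g] {H : LieSubalgebra F g} {ι : Type*} [Fintype ι] (R : RD F H ι)

lemma exp_two (N v : g) (hN : IsNilpotent (LieAlgebra.ad F g N : Module.End F g)) (h : ⁅N, ⁅N, v⁆⁆ = 0) :
    expEnd (LieAlgebra.ad F g N : Module.End F g) v = v + ⁅N, v⁆ := by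
  rw [expEnd_apply_of_pow _ hN 2 v (by simpa [pow_succ] using h)]
  simp [Finset.sum_range_succ]

lemma exp_three (N v : g) (hN : IsNilpotent (LieAlgebra.ad F g N : Module.End F g)) (h : ⁅N, ⁅N, ⁅N, v⁆⁆⁆ = 0) :
    expEnd (LieAlgebra.ad F g N : Module.End F g) v = v + ⁅N, v⁆ + (2 : F)⁻¹ • ⁅N, ⁅N, v⁆⁆ := by
  rw [expEnd_apply_of_pow _ hN 3 v (by simpa [pow_succ] using h)]
  simp [Finset.sum_range_succ, pow_succ, Nat.factorial]

namespace RD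

lemma exists_refl (i : ι) : ∃ θ : g ≃ₗ⁅F⁆ g, Inn θ ∧ ∀ z : H, θ z = z - R.al i z • (R.cr i : g) := by
  have he := (R.triple i).nil_e
  have hf : IsNilpotent (LieAlgebra.ad F g (-R.fv i) : Module.End F g) := by
    rw [map_neg]; exact (R.triple i).nil_f.neg
  refine ⟨((expAut _ he).trans (expAut _ hf)).trans (expAut _ he),
    ((expAut_inn _ _).trans (expAut_inn _ _)).trans (expAut_inn _ _), fun z => ?_⟩
  have ez : ∀ z : H, ⁅R.ev i, (z : g)⁆ = -(R.al i z • R.ev i) := fun z => by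
    rw [← lie_skew, R.ev_eig]
  have fz : ∀ z : H, ⁅R.fv i, (z : g)⁆ = (R.al i z • R.fv i) := fun z => by
    rw [← lie_skew, R.fv_eig, neg_neg]
  have fe : ⁅R.fv i, R.ev i⁆ = - (R.cr i : g) := by rw [← lie_skew, R.ef]
  have e1 : ∀ z : H, expAut _ he (z : g) = z - R.al i z • R.ev i := fun z => by
    rw [expAut_apply, exp_two _ _ he, ez, sub_eq_add_neg]
    rw [ez, lie_neg, lie_smul, lie_self, smul_zero, neg_zero]
  have e2 : expAut _ he (R.ev i) = R.ev i := by
    rw [expAut_apply, exp_two _ _ he, lie_self, add_zero]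
    rw [lie_self, lie_zero]
  have f1 : ∀ z : H, expAut _ hf (z : g) = z - R.al i z • R.fv i := fun z => by
    rw [expAut_apply, exp_two _ _ hf, neg_lie, fz, sub_eq_add_neg]
    simp only [neg_lie, fz, lie_neg, lie_smul, lie_self, smul_zero, neg_zero]
  have f2 : expAut _ hf (R.ev i) = R.ev i + (R.cr i : g) - R.fv i := by
    rw [expAut_apply, exp_three _ _ hf]
    · simp only [neg_lie, fe, fz, R.al_cr, neg_neg, smul_neg, smul_smul]
      rw [inv_mul_cancel₀ two_ne_zero, one_smul]; abel
    · simp only [neg_lie, fe, lie_neg, fz, R.al_cr, lie_smul, lie_self, smul_zero, neg_zero]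
  rw [LieEquiv.trans_apply, LieEquiv.trans_apply]
  have m1 : expAut _ hf ((z : g) - R.al i z • R.ev i) = z - R.al i z • R.ev i - R.al i z • (R.cr i : g) := by
    rw [map_sub, map_smul, f1, f2]; module
  rw [e1, m1, map_sub, map_sub, map_smul, map_smul, e1, e1, e2, R.al_cr]
  module

lemma exists_int (R : RD F H ι) : ∃ n : ι → ι → ℤ, ∀ i j, R.al i (R.cr j) = (n i j : F) := by
  have : ∀ i j, ∃ n : ℤ, R.al i (R.cr j) = n := by
    intro i j
    by_contra hn
    push Not at hn
    have h1 := (Module.End.eigenspaces_iSupIndep (LieAlgebra.ad F g (R.cr j : g) : Module.End F g)) (R.al i (R.cr j))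
    have h2 : ⨆ ν, ⨆ (_ : ν ≠ R.al i (R.cr j)), Module.End.eigenspace (LieAlgebra.ad F g (R.cr j : g) : Module.End F g) ν = ⊤ := by
      rw [eq_top_iff, ← (R.triple j).iSup_eigenspace]
      refine iSup_le fun m => ?_
      exact le_iSup₂_of_le (m : F) (fun h => hn m h.symm) le_rfl
    rw [h2, disjoint_top] at h1
    have h3 : R.ev i ∈ Module.End.eigenspace (LieAlgebra.ad F g (R.cr j : g) : Module.End F g) (R.al i (R.cr j)) :=
      Module.End.mem_eigenspace_iff.2 (R.ev_eig i _)
    rw [h1] at h3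
    exact R.ev_ne i h3
  choose n hn using this
  exact ⟨n, hn⟩

/-- automorphisms preserving `H` permute the roots -/
lemma exists_perm (θ : g ≃ₗ⁅F⁆ g) (hθ : ∀ z ∈ H, θ z ∈ H) (i : ι) :
    ∃ j, ∀ z : H, R.al i ⟨θ z, hθ z z.2⟩ = R.al j z := by
  have h1 : ∀ z : H, ⁅(z : g), θ.symm (R.ev i)⁆ = R.al i ⟨θ z, hθ z z.2⟩ • θ.symm (R.ev i) := by
    intro z
    have := R.ev_eig i ⟨θ z, hθ z z.2⟩
    apply θ.injective
    change θ _ = θ _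
    rw [LieEquiv.map_lie, map_smul, LieEquiv.apply_symm_apply]
    exact this
  have hne : θ.symm (R.ev i) ≠ 0 := fun h => R.ev_ne i (by
    have := congrArg θ h
    rwa [LieEquiv.apply_symm_apply, map_zero] at this)
  have h2 := fun z => (R.eig_iff z _ _).1 (h1 z)
  by_cases hco : ∃ j, R.co j (θ.symm (R.ev i)) ≠ 0
  · obtain ⟨j, hj⟩ := hco
    refine ⟨j, fun z => ?_⟩
    have := (h2 z).2 j
    exact (sub_eq_zero.1 ((mul_eq_zero.1 this).resolve_right hj)).symm
  · push Not at hco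
    exfalso
    have hp0 : R.p0 (θ.symm (R.ev i)) ≠ 0 := fun h0 => hne (R.ext_co (by rw [h0, map_zero]) (fun j => by rw [hco, map_zero]))
    have h3 : ∀ z : H, R.al i ⟨θ z, hθ z z.2⟩ = 0 := fun z => (smul_eq_zero.1 (h2 z).1).resolve_right hp0
    -- θ restricted to H is surjective
    let T : H →ₗ[F] H := (θ.toLinearEquiv.toLinearMap.restrict (p := H.toSubmodule) (q := H.toSubmodule) hθ)
    have hT : Function.Injective T := fun a b hab => Subtype.ext (θ.injective (congrArg Subtype.val hab))
    have hTs := LinearMap.injective_iff_surjective.1 hT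
    obtain ⟨w, hw⟩ := hTs (R.cr i)
    have := h3 w
    have h4 : (⟨θ w, hθ w w.2⟩ : H) = R.cr i := hw
    rw [h4, R.al_cr] at this
    exact two_ne_zero this

variable {xp xm : g} {h : H} 

lemma sum_pos (P : Prin R xp xm h) (n : ι → ι → ℤ) (hn : ∀ i j, R.al i (R.cr j) = (n i j : F)) (i : ι) :
    2 * ∑ j, P.ht j * n j i = P.ht i * ∑ j, n j i ^ 2 ∧ 0 < ∑ j, n j i ^ 2 := by
  constructor
  · have h1 := R.kil h (R.cr i)
    have h2 := R.kil (R.cr i) (R.cr i)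
    have key : ∀ z : H, killingForm F g (z : g) (R.cr i) = R.al i z * killingForm F g (R.ev i) (R.fv i) := by
      intro z
      have e1 := LieModule.traceForm_apply_lie_apply F g g (z : g) (R.ev i) (R.fv i)
      rw [R.ev_eig, R.ef] at e1
      have e2 : killingForm F g = LieModule.traceForm F g g := rfl
      rw [e2, ← e1, map_smul]; rfl
    rw [key] at h1 h2
    rw [R.al_cr] at h2
    rw [P.al_h] at h1
    simp only [P.al_h, hn] at h1 h2
    have : ((2 * ∑ j, P.ht j * n j i : ℤ) : F) = ((P.ht i * ∑ j, n j i ^ 2 : ℤ) : F) := by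
      push_cast
      simp only [pow_two]
      rw [← h1, ← h2]; ring
    exact_mod_cast this
  · refine Finset.sum_pos' (fun j _ => sq_nonneg _) ⟨i, Finset.mem_univ _, ?_⟩
    have : n i i = 2 := by
      have := hn i i
      rw [R.al_cr] at this
      exact_mod_cast this.symm
    rw [this]; norm_num

lemma weyl (P : Prin R xp xm h) (φ : F →+ ℚ) (K : H) :
    ∃ (θ : g ≃ₗ⁅F⁆ g) (hθ : ∀ z ∈ H, θ z ∈ H), Inn θ ∧ ∀ i, 0 < P.ht i → 0 ≤ φ (R.al i ⟨θ K, hθ K K.2⟩) := by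
  classical
  obtain ⟨n, hn⟩ := R.exists_int
  let S : Set (ι → ι) := {σ | ∃ (θ : g ≃ₗ⁅F⁆ g) (hθ : ∀ z ∈ H, θ z ∈ H), Inn θ ∧ ∀ i (z : H), R.al i ⟨θ z, hθ z z.2⟩ = R.al (σ i) z}
  let Ψ : (ι → ι) → ℚ := fun σ => ∑ i, (P.ht i : ℚ) * φ (R.al (σ i) K)
  obtain ⟨σ, ⟨θ, hθ, hI, hσ⟩, hmax⟩ := Set.exists_max_image S Ψ (Set.toFinite S)
    ⟨id, LieEquiv.refl, fun z hz => hz, Inn.refl, fun i z => rfl⟩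
  refine ⟨θ, hθ, hI, fun i hi => ?_⟩
  obtain ⟨η, hηI, hη⟩ := R.exists_refl i
  have hηH : ∀ z ∈ H, η z ∈ H := fun z hz => by
    rw [hη ⟨z, hz⟩]; exact H.sub_mem hz (H.smul_mem _ (R.cr i).2)
  have hθη : ∀ z ∈ H, (θ.trans η) z ∈ H := fun z hz => hηH _ (hθ z hz)
  choose σ' hσ' using R.exists_perm (θ.trans η) hθη
  have := hmax σ' ⟨θ.trans η, hθη, hI.trans hηI, hσ'⟩
  have e1 : ∀ j, R.al (σ' j) K = R.al (σ j) K - n j i • R.al i ⟨θ K, hθ K K.2⟩ := by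
    intro j
    rw [← hσ', ← hσ]
    have : (⟨(θ.trans η) K, hθη K K.2⟩ : H) = ⟨θ K, hθ K K.2⟩ - R.al i ⟨θ K, hθ K K.2⟩ • R.cr i := Subtype.ext (hη ⟨θ K, hθ K K.2⟩)
    rw [this, map_sub, map_smul, hn, smul_eq_mul]
    congr 1
    rw [zsmul_eq_mul, mul_comm]
  have e2 : Ψ σ' = Ψ σ - (∑ j, P.ht j * n j i : ℤ) * φ (R.al i ⟨θ K, hθ K K.2⟩) := by
    simp only [Ψ, e1, map_sub, map_zsmul]
    simp only [zsmul_eq_mul]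
    push_cast
    rw [Finset.sum_mul, ← Finset.sum_sub_distrib]
    refine Finset.sum_congr rfl fun j _ => by ring
  rw [e2] at this
  obtain ⟨p1, p2⟩ := sum_pos R P n hn i
  have p3 : 0 < ∑ j, P.ht j * n j i := by
    have : 0 < 2 * ∑ j, P.ht j * n j i := by rw [p1]; positivity
    omega
  have p4 : (0 : ℚ) < (∑ j, P.ht j * n j i : ℤ) := by exact_mod_cast p3
  by_contra hneg
  push Not at hneg
  nlinarith
end RD
end Weyl
end

section
open scoped TensorProduct
set_option linter.unusedSectionVars false
set_option linter.unusedVariables false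

section Torus
variable {F : Type*} [Field F] [CharZero F] [IsAlgClosed F] {g : Type*} [LieRing g] [LieAlgebra F g]
  [FiniteDimensional F g] {H : LieSubalgebra F g} {ι : Type*} [Fintype ι] (R : RD F H ι)

lemma lieEquiv_ad_pow (δ : g ≃ₗ⁅F⁆ g) (N v : g) (n : ℕ) :
    δ (((LieAlgebra.ad F g N : Module.End F g) ^ n) v) = ((LieAlgebra.ad F g (δ N) : Module.End F g) ^ n) (δ v) := by
  induction n generalizing v with
  | zero => simp
  | succ n ih => 
    rw [pow_succ, pow_succ, Module.End.mul_apply, Module.End.mul_apply, ih, LieAlgebra.ad_apply, LieAlgebra.ad_apply, LieEquiv.map_lie]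

lemma lieEquiv_nilp (δ : g ≃ₗ⁅F⁆ g) (N : g) (hN : IsNilpotent (LieAlgebra.ad F g N : Module.End F g)) :
    IsNilpotent (LieAlgebra.ad F g (δ N) : Module.End F g) := by
  obtain ⟨k, hk⟩ := hN
  refine ⟨k, ?_⟩
  ext v
  have := lieEquiv_ad_pow δ N (δ.symm v) k
  rw [hk, LieEquiv.apply_symm_apply] at this
  rw [← this]; simp

lemma lieEquiv_exp (δ : g ≃ₗ⁅F⁆ g) (N v : g) :
    δ (expEnd (LieAlgebra.ad F g N : Module.End F g) v) = expEnd (LieAlgebra.ad F g (δ N) : Module.End F g) (δ v) := by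
  unfold expEnd
  simp only [LinearMap.sum_apply, map_sum, LinearMap.smul_apply, map_smul, lieEquiv_ad_pow]

lemma Inn.conj {θ : g ≃ₗ⁅F⁆ g} (h : Inn θ) (δ : g ≃ₗ⁅F⁆ g) : Inn ((δ.symm.trans θ).trans δ) := by
  obtain ⟨l, h1, h2⟩ := h
  refine ⟨l.map δ, ?_, fun v => ?_⟩
  · intro N hN
    obtain ⟨N', hN', rfl⟩ := List.mem_map.1 hN
    exact lieEquiv_nilp δ N' (h1 N' hN')
  · have : ∀ w, (l.map δ).foldr (fun N v => expEnd (LieAlgebra.ad F g N : Module.End F g) v) (δ w) =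
      δ (l.foldr (fun N v => expEnd (LieAlgebra.ad F g N : Module.End F g) v) w) := by
      intro w
      clear h1 h2
      induction l with
      | nil => rfl
      | cons N l ih => rw [List.map_cons, List.foldr_cons, ih, List.foldr_cons, lieEquiv_exp]
    have h3 := this (δ.symm v)
    rw [LieEquiv.apply_symm_apply, h2] at h3
    rw [h3]; rfl

namespace RD

/-- scaling operator -/
noncomputable def dil (n : ι → ℤ) (c : F) : g →ₗ[F] g :=
  R.p0 + ∑ i, (c ^ n i) • (R.co i).smulRight (R.ev i)

lemma dil_apply (n : ι → ℤ) (c : F) (v : g) : R.dil n c v = R.p0 v + ∑ i, (c ^ n i * R.co i v) • R.ev i := by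
  simp [dil, smul_smul]

lemma dil_coe (n : ι → ℤ) (c : F) (z : H) : R.dil n c z = z := by
  rw [dil_apply, R.p0_coe]; simp [R.co_coe]

lemma dil_eig (z0 : H) (n : ι → ℤ) (hn : ∀ i, R.al i z0 = n i) (c : F) (m : ℤ) (v : g)
    (hv : ⁅(z0 : g), v⁆ = (m : F) • v) : R.dil n c v = c ^ m • v := by
  obtain ⟨h1, h2⟩ := (R.eig_iff z0 m v).1 hv
  rw [dil_apply]
  conv_rhs => rw [R.dec v]
  rw [smul_add, Finset.smul_sum]
  congr 1
  · rcases smul_eq_zero.1 h1 with h | h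
    · have : m = 0 := by exact_mod_cast h
      rw [this, zpow_zero, one_smul]
    · rw [h, smul_zero]
  · refine Finset.sum_congr rfl fun i _ => ?_
    rw [smul_smul]
    rcases mul_eq_zero.1 (h2 i) with h | h
    · rw [hn, sub_eq_zero] at h
      have : n i = m := by exact_mod_cast h
      rw [this]
    · rw [h, mul_zero, mul_zero]

lemma dil_ev (z0 : H) (n : ι → ℤ) (hn : ∀ i, R.al i z0 = n i) (c : F) (i : ι) :
    R.dil n c (R.ev i) = c ^ n i • R.ev i := 
  R.dil_eig z0 n hn c (n i) _ (by rw [R.ev_eig, hn])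

lemma dil_lie (z0 : H) (n : ι → ℤ) (hn : ∀ i, R.al i z0 = n i) (c : F) (hc : c ≠ 0) (u v : g) :
    R.dil n c ⁅u, v⁆ = ⁅R.dil n c u, R.dil n c v⁆ := by
  have key : ∀ (a b : ℤ) (u v : g), ⁅(z0 : g), u⁆ = (a : F) • u → ⁅(z0 : g), v⁆ = (b : F) • v → 
      R.dil n c ⁅u, v⁆ = ⁅R.dil n c u, R.dil n c v⁆ := by
    intro a b u v hu hv
    rw [R.dil_eig z0 n hn c a u hu, R.dil_eig z0 n hn c b v hv, R.dil_eig z0 n hn c (a + b) ⁅u, v⁆]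
    · rw [smul_lie, lie_smul, smul_smul, zpow_add₀ hc]
    · rw [leibniz_lie, hu, hv, smul_lie, lie_smul]; push_cast; rw [add_smul]
  have h0 : ∀ z : H, ⁅(z0 : g), (z : g)⁆ = ((0 : ℤ) : F) • (z : g) := fun z => by
    rw [R.ab z0 z]; simp
  have h1 : ∀ i, ⁅(z0 : g), R.ev i⁆ = (n i : F) • R.ev i := fun i => by rw [R.ev_eig, hn]
  obtain ⟨z, d, rfl⟩ := R.exists_dec u
  obtain ⟨w, d', rfl⟩ := R.exists_dec v
  simp only [add_lie, lie_add, sum_lie, lie_sum, smul_lie, lie_smul, map_add, map_sum, map_smul]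
  simp only [key _ _ _ _ (h0 _) (h0 _), key _ _ _ _ (h0 _) (h1 _), key _ _ _ _ (h1 _) (h0 _), key _ _ _ _ (h1 _) (h1 _)]

lemma dil_dil (z0 : H) (n : ι → ℤ) (hn : ∀ i, R.al i z0 = n i) (c d : F) (hcd : c * d = 1) (v : g) :
    R.dil n c (R.dil n d v) = v := by
  obtain ⟨z, b, rfl⟩ := R.exists_dec v
  simp only [map_add, map_sum, map_smul, R.dil_coe, R.dil_ev z0 n hn, smul_smul]
  congr 1
  refine Finset.sum_congr rfl fun i _ => ?_
  rw [mul_assoc, ← mul_zpow, mul_comm d c, hcd, one_zpow, mul_one]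

lemma exists_dil (z0 : H) (n : ι → ℤ) (hn : ∀ i, R.al i z0 = n i) (c : F) (hc : c ≠ 0) :
    ∃ θ : g ≃ₗ⁅F⁆ g, (∀ v, θ v = R.dil n c v) ∧ ∀ v, θ.symm v = R.dil n c⁻¹ v := 
  ⟨{ toFun := R.dil n c
     map_add' := map_add _
     map_smul' := map_smul _
     map_lie' := by intro u v; exact R.dil_lie z0 n hn c hc u v
     invFun := R.dil n c⁻¹
     left_inv := R.dil_dil z0 n hn _ _ (inv_mul_cancel₀ hc)
     right_inv := R.dil_dil z0 n hn _ _ (mul_inv_cancel₀ hc) }, fun v => rfl, fun v => rfl⟩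

lemma exists_torus (j : ι) (n : ι → ℤ) (hn : ∀ i, R.al i (R.cr j) = n i) (c : F) (hc : c ≠ 0) :
    ∃ θ : g ≃ₗ⁅F⁆ g, Inn θ ∧ (∀ z : H, θ z = z) ∧ ∀ i, θ (R.ev i) = c ^ n i • R.ev i := by
  obtain ⟨b, hb⟩ := IsAlgClosed.exists_pow_nat_eq c (n := 2) (by norm_num)
  have hb0 : b ≠ 0 := by rintro rfl; apply hc; rw [← hb]; simp
  obtain ⟨δ, hδ, hδ'⟩ := R.exists_dil (R.cr j) n hn b hb0
  obtain ⟨W, hW, hWz⟩ := R.exists_refl j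
  have hI := hW.symm.trans (hW.conj δ)
  have key : ∀ (m : ℤ) (v : g), ⁅(R.cr j : g), v⁆ = (m : F) • v → 
      W.symm.trans ((δ.symm.trans W).trans δ) v = c ^ m • v := by
    intro m v hv
    have h1 : ⁅(R.cr j : g), W.symm v⁆ = ((-m : ℤ) : F) • W.symm v := by
      apply W.injective
      change W _ = W _
      rw [LieEquiv.map_lie, map_smul, LieEquiv.apply_symm_apply, hWz, R.al_cr]
      have : (R.cr j : g) - (2 : F) • (R.cr j : g) = - (R.cr j : g) := by module
      rw [this, neg_lie, hv]; simp
    change δ (W (δ.symm (W.symm v))) = _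
    rw [hδ', R.dil_eig _ n hn _ _ _ h1, map_smul, LieEquiv.apply_symm_apply, map_smul, hδ, R.dil_eig _ n hn _ _ _ hv, smul_smul]
    congr 1
    rw [inv_zpow, zpow_neg, inv_inv, ← hb, ← zpow_add₀ hb0, ← zpow_natCast, ← zpow_mul]
    congr 1; push_cast; ring
  refine ⟨_, hI, fun z => ?_, fun i => key (n i) _ (by rw [R.ev_eig, hn])⟩
  have := key 0 (z : g) (by rw [R.ab]; simp)
  rw [this]; simp

lemma exists_torus_prod (n : ι → ι → ℤ) (hn : ∀ i j, R.al i (R.cr j) = (n i j : F)) (c : F) (hc : c ≠ 0) (m : ι → ℤ) (s : Finset ι) :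
    ∃ θ : g ≃ₗ⁅F⁆ g, Inn θ ∧ (∀ z : H, θ z = z) ∧ ∀ i, θ (R.ev i) = c ^ (∑ j ∈ s, m j * n i j) • R.ev i := by
  classical
  induction s using Finset.induction_on with
  | empty => exact ⟨LieEquiv.refl, Inn.refl, fun z => rfl, fun i => by simp⟩
  | insert j s hj ih =>
    obtain ⟨θ, h1, h2, h3⟩ := ih
    obtain ⟨η, k1, k2, k3⟩ := R.exists_torus j (fun i => n i j) (fun i => hn i j) (c ^ m j) (zpow_ne_zero _ hc)
    refine ⟨θ.trans η, h1.trans k1, fun z => ?_, fun i => ?_⟩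
    · rw [LieEquiv.trans_apply, h2, k2]
    · rw [LieEquiv.trans_apply, h3, map_smul, k3, smul_smul, Finset.sum_insert hj, add_comm, zpow_add₀ hc, zpow_mul]

end RD
end Torus
end

section
open scoped TensorProduct
set_option linter.unusedSectionVars false
set_option linter.unusedVariables false

section Simple
variable {F : Type*} [Field F] [CharZero F] [IsAlgClosed F] {g : Type*} [LieRing g] [LieAlgebra F g]
  [FiniteDimensional F g] {H : LieSubalgebra F g} {ι : Type*} [Fintype ι] {R : RD F H ι}
  {xp xm : g} {h : H} (P : Prin R xp xm h)

namespace Prin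

lemma mem_eig {v : g} {c : ℤ} : v ∈ Module.End.eigenspace (LieAlgebra.ad F g (h : g) : Module.End F g) (c : F) ↔ 
    ⁅(h : g), v⁆ = (c : F) • v := Module.End.mem_eigenspace_iff

lemma ev_mem (i : ι) : R.ev i ∈ Module.End.eigenspace (LieAlgebra.ad F g (h : g) : Module.End F g) (P.ht i : F) :=
  mem_eig.2 (by rw [R.ev_eig, P.al_h])

lemma eig_co {v : g} {c : ℤ} (hv : v ∈ Module.End.eigenspace (LieAlgebra.ad F g (h : g) : Module.End F g) (c : F))
    (i : ι) (hi : P.ht i ≠ c) : R.co i v = 0 := by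
  have := ((R.eig_iff h c v).1 (mem_eig.1 hv)).2 i
  rw [P.al_h] at this
  refine (mul_eq_zero.1 this).resolve_left (sub_ne_zero.2 fun h => hi ?_)
  exact_mod_cast h

lemma eig_p0 {v : g} {c : ℤ} (hv : v ∈ Module.End.eigenspace (LieAlgebra.ad F g (h : g) : Module.End F g) (c : F))
    (hc : c ≠ 0) : R.p0 v = 0 := by
  have := ((R.eig_iff h c v).1 (mem_eig.1 hv)).1
  exact (smul_eq_zero.1 this).resolve_left (by exact_mod_cast hc)

lemma eig_zero (P : Prin R xp xm h) {v : g} (hv : v ∈ Module.End.eigenspace (LieAlgebra.ad F g (h : g) : Module.End F g) ((0 : ℤ) : F)) :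
    v ∈ H := by
  refine R.cent_reg h (fun i => ?_) v ?_
  · rw [P.al_h]; exact_mod_cast P.ht_ne i
  · rw [mem_eig.1 hv]; simp

lemma xp_mem (P : Prin R xp xm h) : xp ∈ Module.End.eigenspace (LieAlgebra.ad F g (h : g) : Module.End F g) ((2 : ℤ) : F) :=
  mem_eig.2 (by rw [P.hp]; norm_num)

lemma exists_z (P : Prin R xp xm h) (d : ι → F) : ∃ z : H, ∀ i, P.ht i = 2 → R.al i z * R.co i xp = d i := by
  classical
  let v : g := ∑ i ∈ Finset.univ.filter (fun i => P.ht i = 2), d i • R.ev i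
  have hv : v ∈ Module.End.eigenspace (LieAlgebra.ad F g (h : g) : Module.End F g) ((2 : ℤ) : F) := by
    refine Submodule.sum_mem _ fun i hi => Submodule.smul_mem _ _ ?_
    have := P.ev_mem i
    rwa [(Finset.mem_filter.1 hi).2] at this
  obtain ⟨w, hw, hwv⟩ := P.T.e_surj 2 (by norm_num) v hv
  have hwH : w ∈ H := P.eig_zero (by simpa using hw)
  refine ⟨-⟨w, hwH⟩, fun i hi => ?_⟩
  have h1 : ⁅w, xp⁆ = - v := by rw [← lie_skew, ← hwv]; rfl
  have h2 := R.co_lie ⟨w, hwH⟩ xp i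
  change R.co i ⁅w, xp⁆ = _ at h2
  rw [h1, map_neg] at h2
  rw [map_neg, neg_mul, ← h2, neg_neg]
  have := R.co_sum 0 (fun i => if P.ht i = 2 then d i else 0) i
  rw [if_pos hi] at this
  rw [← this]
  congr 1
  simp only [v, Finset.sum_filter, ite_smul, zero_smul]
  simp

lemma co_xp_ne (i : ι) (hi : P.ht i = 2) : R.co i xp ≠ 0 := by
  intro h0
  obtain ⟨z, hz⟩ := P.exists_z (fun _ => 1)
  have := hz i hi
  rw [h0, mul_zero] at this
  exact zero_ne_one this

lemma exists_dual (P : Prin R xp xm h) (d : ι → F) : ∃ z : H, ∀ i, P.ht i = 2 → R.al i z = d i := by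
  obtain ⟨z, hz⟩ := P.exists_z (fun i => d i * R.co i xp)
  exact ⟨z, fun i hi => mul_right_cancel₀ (P.co_xp_ne i hi) (hz i hi)⟩

lemma exists_coweight (P : Prin R xp xm h) (n : ι → ι → ℤ) (hn : ∀ i j, R.al i (R.cr j) = (n i j : F)) (a : ι) :
    ∃ (D : ℕ) (m : ι → ℤ), 0 < D ∧ (P.ht a = 2 → ∑ j, m j * n a j = D) ∧ ∀ i, P.ht i = 2 → i ≠ a → ∑ j, m j * n i j = 0 := by
  classical
  let Δ := {i : ι // P.ht i = 2}
  let M : (ι → ℚ) →ₗ[ℚ] (Δ → ℚ) := LinearMap.pi fun b => ∑ j, (n b.1 j : ℚ) • LinearMap.proj j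
  have hM : ∀ q b, M q b = ∑ j, (n b.1 j : ℚ) * q j := fun q b => by simp [M]
  have hr : LinearMap.range M = ⊤ := by
    by_contra hne
    obtain ⟨f, hf0, hf⟩ := Submodule.exists_le_ker_of_lt_top _ (lt_top_iff_ne_top.2 hne)
    have hfs : ∀ x, f x = ∑ b, x b * f (Pi.single b 1) := fun x => by
      conv_lhs => rw [LinearMap.pi_apply_eq_sum_univ f x]
      refine Finset.sum_congr rfl fun b _ => ?_
      rw [smul_eq_mul]; congr 2; ext j; simp [Pi.single_apply, eq_comm]
    have h1 : ∀ j, ∑ b : Δ, (n b.1 j : ℚ) * f (Pi.single b 1) = 0 := by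
      intro j
      have : f (M (Pi.single j 1)) = 0 := hf ⟨_, rfl⟩
      rw [hfs] at this
      rw [← this]
      refine Finset.sum_congr rfl fun b _ => ?_
      rw [hM]; simp [Pi.single_apply]
    have h2 := R.cosep (∑ b : Δ, ((f (Pi.single b 1) : ℚ) : F) • R.al b.1) (fun j => by
      simp only [LinearMap.sum_apply, LinearMap.smul_apply, hn, smul_eq_mul]
      have := congrArg (fun q : ℚ => (q : F)) (h1 j)
      push_cast at this
      rw [← this]
      refine Finset.sum_congr rfl fun b _ => mul_comm _ _)
    apply hf0
    ext b
    obtain ⟨z, hz⟩ := P.exists_dual (fun i => if i = b.1 then 1 else 0)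
    have h3 := LinearMap.congr_fun h2 z
    simp only [LinearMap.sum_apply, LinearMap.smul_apply, smul_eq_mul, LinearMap.zero_apply] at h3
    rw [Finset.sum_eq_single b] at h3
    · rw [hz _ b.2, if_pos rfl, mul_one] at h3
      simpa using h3
    · intro b' _ hb'
      rw [hz _ b'.2, if_neg (fun h => hb' (Subtype.ext h)), mul_zero]
    · simp
  obtain ⟨q, hq⟩ := LinearMap.range_eq_top.1 hr (fun b => if b.1 = a then 1 else 0)
  let D : ℕ := ∏ j, (q j).den
  have hD : 0 < D := Finset.prod_pos fun j _ => (q j).den_pos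
  have hm : ∀ j, ∃ m : ℤ, (m : ℚ) = D * q j := by
    intro j
    obtain ⟨k, hk⟩ := Finset.dvd_prod_of_mem (fun j => (q j).den) (Finset.mem_univ j)
    refine ⟨k * (q j).num, ?_⟩
    have : (D : ℚ) = (q j).den * k := by exact_mod_cast hk
    rw [this]
    push_cast
    rw [mul_comm ((q j).den : ℚ), mul_assoc, Rat.den_mul_eq_num]
  choose m hm using hm
  have key : ∀ i, P.ht i = 2 → ((∑ j, m j * n i j : ℤ) : ℚ) = D * (if i = a then 1 else 0) := by
    intro i hi
    have h1 := congr_fun hq ⟨i, hi⟩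
    rw [hM] at h1
    dsimp only at h1
    rw [← h1, Finset.mul_sum]
    push_cast
    refine Finset.sum_congr rfl fun j _ => ?_
    rw [hm]; ring
  refine ⟨D, m, hD, fun ha => ?_, fun i hi hia => ?_⟩
  · have := key a ha
    rw [if_pos rfl, mul_one] at this
    exact_mod_cast this
  · have := key i hi
    rw [if_neg hia, mul_zero] at this
    exact_mod_cast this

lemma exists_scale (P : Prin R xp xm h) (t : ι → F) (ht : ∀ i, t i ≠ 0) : 
    ∃ (θ : g ≃ₗ⁅F⁆ g) (c : ι → F), Inn θ ∧ (∀ z : H, θ z = z) ∧ (∀ i, θ (R.ev i) = c i • R.ev i) ∧ 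
      (∀ i, P.ht i = 2 → c i = t i) := by
  classical
  obtain ⟨n, hn⟩ := R.exists_int
  have : ∀ s : Finset ι, ∃ (θ : g ≃ₗ⁅F⁆ g) (c : ι → F), Inn θ ∧ (∀ z : H, θ z = z) ∧ (∀ i, θ (R.ev i) = c i • R.ev i) ∧ 
      (∀ i, P.ht i = 2 → c i = if i ∈ s then t i else 1) := by
    intro s
    induction s using Finset.induction_on with
    | empty => exact ⟨LieEquiv.refl, fun _ => 1, Inn.refl, fun z => rfl, fun i => by simp, fun i _ => by simp⟩
    | insert a s ha ih =>
      obtain ⟨θ, c, h1, h2, h3, h4⟩ := ih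
      obtain ⟨D, m, hD, m1, m2⟩ := P.exists_coweight n hn a
      obtain ⟨b, hb⟩ := IsAlgClosed.exists_pow_nat_eq (t a) hD
      have hb0 : b ≠ 0 := by rintro rfl; apply ht a; rw [← hb]; simp [hD.ne']
      obtain ⟨η, k1, k2, k3⟩ := R.exists_torus_prod n hn b hb0 m Finset.univ
      refine ⟨θ.trans η, fun i => c i * b ^ (∑ j, m j * n i j), h1.trans k1, fun z => ?_, fun i => ?_, fun i hi => ?_⟩
      · rw [LieEquiv.trans_apply, h2, k2]
      · rw [LieEquiv.trans_apply, h3, map_smul, k3, smul_smul]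
      · dsimp only
        rw [h4 i hi]
        by_cases hia : i = a
        · subst hia
          rw [if_neg ha, m1 hi, if_pos (Finset.mem_insert_self _ _), one_mul, zpow_natCast, hb]
        · rw [m2 i hi hia, zpow_zero, mul_one]
          simp [hia]
  obtain ⟨θ, c, h1, h2, h3, h4⟩ := this Finset.univ
  exact ⟨θ, c, h1, h2, h3, fun i hi => by rw [h4 i hi, if_pos (Finset.mem_univ _)]⟩

end Prin
end Simple
end

section
open scoped TensorProduct
set_option linter.unusedSectionVars false
set_option linter.unusedVariables false

section Std
variable {F : Type*} [Field F] [CharZero F] [IsAlgClosed F] {g : Type*} [LieRing g] [LieAlgebra F g]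
  [FiniteDimensional F g] {H : LieSubalgebra F g} {ι : Type*} [Fintype ι] {R : RD F H ι}
  {xp xm : g} {h : H} (P : Prin R xp xm h)

lemma exists_phi (S : Finset F) : ∃ φ : F →+ ℚ, 0 < φ 1 ∧ ∀ a ∈ S, a ≠ 0 → φ a ≠ 0 := by
  classical
  let f : {a // a ∈ insert 1 S ∧ a ≠ 0} → F := fun a => a.1
  have : Finite {a // a ∈ insert 1 S ∧ a ≠ 0} := Finite.of_injective (fun a => (⟨a.1, a.2.1⟩ : {a // a ∈ insert 1 S}))
    (fun a b hab => Subtype.ext (congrArg (fun x => x.1) hab))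
  obtain ⟨φ, hφ⟩ := Module.exists_dual_forall_apply_ne_zero (K := ℚ) f (fun a => a.2.2)
  have h1 := hφ ⟨1, Finset.mem_insert_self _ _, one_ne_zero⟩
  have h2 : ∀ a ∈ S, a ≠ 0 → φ a ≠ 0 := fun a ha h0 => hφ ⟨a, Finset.mem_insert_of_mem ha, h0⟩
  rcases lt_or_gt_of_ne h1 with h | h
  · exact ⟨(-φ).toAddMonoidHom, by simpa using h, fun a ha h0 => by simpa using h2 a ha h0⟩
  · exact ⟨φ.toAddMonoidHom, h, h2⟩

namespace Prin

lemma std [LieAlgebra.IsKilling F g] (x : g) : ∃ (s : H) (n : g) (φ : F →+ ℚ), InnRel F x (s + n) ∧ 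
    (∀ i, 0 < P.ht i → R.al i s ≠ 0 → 0 < φ (R.al i s)) ∧ R.p0 n = 0 ∧
    ∀ i, R.co i n ≠ 0 → 0 < P.ht i ∧ R.al i s = 0 := by
  classical
  obtain ⟨s0, n0, hx, hsn, hn, hs, _⟩ := jordan (F := F) x
  obtain ⟨k0, hks, hkn, hk⟩ := exists_grading_elt hsn hs hn
  obtain ⟨H', hH', hsH, hkH⟩ := exists_cartan hks hs hk
  obtain ⟨R'⟩ := RD.exists H'
  obtain ⟨θ, hθ, hθH⟩ := R.conj R'
  let s1 : H := ⟨θ s0, hθH _ hsH⟩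
  let k1 : H := ⟨θ k0, hθH _ hkH⟩
  obtain ⟨φ, hφ1, hφ⟩ := exists_phi (Finset.univ.image fun i => R.al i s1)
  have hφ' : ∀ i, R.al i s1 ≠ 0 → φ (R.al i s1) ≠ 0 := fun i => hφ _ (Finset.mem_image_of_mem _ (Finset.mem_univ i))
  obtain ⟨N, hN⟩ : ∃ N : ℕ, ∀ i, R.al i s1 ≠ 0 → |φ (R.al i k1)| < N * |φ (R.al i s1)| := by
    choose M hM using fun i => exists_nat_gt (|φ (R.al i k1)| / |φ (R.al i s1)|)
    refine ⟨∑ i, M i, fun i hi => ?_⟩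
    have h0 : 0 < |φ (R.al i s1)| := abs_pos.2 (hφ' i hi)
    have h1 := (div_lt_iff₀ h0).1 (hM i)
    refine h1.trans_le ?_
    have : (M i : ℚ) ≤ (∑ i, M i : ℕ) := by exact_mod_cast Finset.single_le_sum (f := M) (fun _ _ => Nat.zero_le _) (Finset.mem_univ i)
    gcongr
  let K : H := k1 + (N : F) • s1
  obtain ⟨η, hηH, hη, hpos⟩ := R.weyl P φ K
  let s2 : H := ⟨η s1, hηH _ s1.2⟩
  have hKe : ∀ i, φ (R.al i K) = φ (R.al i k1) + N * φ (R.al i s1) := by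
    intro i
    simp only [K, map_add, map_smul, smul_eq_mul]
    rw [← nsmul_eq_mul, map_nsmul, nsmul_eq_mul]
  refine ⟨s2, η (θ n0), φ, ⟨θ.trans η, hθ.trans hη, ?_⟩, fun i hi hne => ?_, ?_⟩
  · rw [LieEquiv.trans_apply, hx, map_add, map_add]
  · obtain ⟨j, hj⟩ := R.exists_perm η hηH i
    have h1 := hpos i hi
    rw [hj K, hKe] at h1
    have h2 : R.al i s2 = R.al j s1 := hj s1
    rw [h2] at hne ⊢
    have h3 := hN j hne
    by_contra hcon
    have h4 : φ (R.al j s1) < 0 := lt_of_le_of_ne (not_lt.1 hcon) (hφ' j hne)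
    rw [abs_of_neg h4] at h3
    have := le_abs_self (φ (R.al j k1))
    nlinarith
  · have hsn' : ⁅(s2 : g), η (θ n0)⁆ = (0 : F) • η (θ n0) := by
      change ⁅η (θ s0), η (θ n0)⁆ = _
      rw [← LieEquiv.map_lie, ← LieEquiv.map_lie, hsn, map_zero, map_zero, zero_smul]
    have hKn : ⁅((⟨η K, hηH _ K.2⟩ : H) : g), η (θ n0)⁆ = (1 : F) • η (θ n0) := by
      have : (K : g) = θ k0 + (N : F) • θ s0 := rfl
      change ⁅η (θ k0 + (N : F) • θ s0), η (θ n0)⁆ = _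
      rw [← LieEquiv.map_lie, add_lie, smul_lie, ← LieEquiv.map_lie, ← LieEquiv.map_lie, hsn, hkn, map_zero, smul_zero, add_zero, one_smul]
    have e1 := (R.eig_iff _ _ _).1 hsn'
    have e2 := (R.eig_iff _ _ _).1 hKn
    refine ⟨by simpa using e2.1, fun i hi => ⟨?_, ?_⟩⟩
    · have h1 : R.al i ⟨η K, hηH _ K.2⟩ = 1 := sub_eq_zero.1 ((mul_eq_zero.1 (e2.2 i)).resolve_right hi)
      by_contra hneg
      obtain ⟨j, hj⟩ := R.neg i
      have h2 : P.ht j = - P.ht i := by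
        have := P.al_h j
        rw [hj, LinearMap.neg_apply, P.al_h] at this
        exact_mod_cast this.symm
      have h3 := hpos j (by have := P.ht_ne i; omega)
      rw [hj, LinearMap.neg_apply, h1, map_neg] at h3
      linarith
    · simpa using (mul_eq_zero.1 (e1.2 i)).resolve_right hi

/-- the sum of `g_j` for `j ≥ a` -/
def Ge (R : RD F H ι) (h : H) (a : ℤ) : Submodule F g := OpTriple.Wge (LieAlgebra.ad F g (h : g) : Module.End F g) (Set.Ici a)

lemma eig_le_Ge {a b : ℤ} (hab : a ≤ b) {v : g} (hv : v ∈ Module.End.eigenspace (LieAlgebra.ad F g (h : g) : Module.End F g) (b : F)) : v ∈ Ge R h a :=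
  OpTriple.eig_le_Wge _ (Set.mem_Ici.2 hab) hv

lemma Ge_mono {a b : ℤ} (hab : a ≤ b) : Ge R h b ≤ Ge R h a := OpTriple.Wge_mono _ (Set.Ici_subset_Ici.2 hab)

lemma lie_eig {a b : ℤ} {u v : g} (hu : u ∈ Module.End.eigenspace (LieAlgebra.ad F g (h : g) : Module.End F g) (a : F))
    (hv : v ∈ Module.End.eigenspace (LieAlgebra.ad F g (h : g) : Module.End F g) (b : F)) :
    ⁅u, v⁆ ∈ Module.End.eigenspace (LieAlgebra.ad F g (h : g) : Module.End F g) ((a + b : ℤ) : F) := by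
  refine mem_eig.2 ?_
  rw [leibniz_lie, mem_eig.1 hu, mem_eig.1 hv, smul_lie, lie_smul]; push_cast; rw [add_smul]

lemma lie_Ge {a b : ℤ} {u v : g} (hu : u ∈ Ge R h a) (hv : v ∈ Ge R h b) : ⁅u, v⁆ ∈ Ge R h (a + b) := by
  have h1 : Ge R h a ≤ (Ge R h (a + b)).comap (LieAlgebra.ad F g v : Module.End F g) := by
    refine OpTriple.Wge_le _ fun c hc w hw => ?_
    have h2 : Ge R h b ≤ (Ge R h (a + b)).comap (LieAlgebra.ad F g w : Module.End F g) := by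
      refine OpTriple.Wge_le _ fun d hd w' hw' => ?_
      exact eig_le_Ge (R := R) (add_le_add (Set.mem_Ici.1 hc) (Set.mem_Ici.1 hd)) (lie_eig hw hw')
    have := h2 hv
    change ⁅v, w⁆ ∈ Ge R h (a + b)
    rw [← lie_skew]
    exact Submodule.neg_mem _ this
  have := h1 hu
  rw [← lie_skew]
  exact Submodule.neg_mem _ this

lemma Ge_p0 (P : Prin R xp xm h) {v : g} (hv : v ∈ Ge R h 1) : R.p0 v = 0 := by
  have : Ge R h 1 ≤ LinearMap.ker R.p0 := OpTriple.Wge_le _ fun c hc w hw => by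
    have := Set.mem_Ici.1 hc
    exact eig_p0 (R := R) hw (by omega)
  exact this hv

lemma Ge_co {a : ℤ} {v : g} (hv : v ∈ Ge R h a) (i : ι) (hi : P.ht i < a) : R.co i v = 0 := by
  have : Ge R h a ≤ LinearMap.ker (R.co i) := OpTriple.Wge_le _ fun c hc w hw => by
    have := Set.mem_Ici.1 hc
    exact P.eig_co hw i (by omega)
  exact this hv

lemma mem_Ge {a : ℤ} {v : g} (h0 : R.p0 v = 0) (hv : ∀ i, P.ht i < a → R.co i v = 0) : v ∈ Ge R h a := by
  rw [R.dec v, h0, zero_add]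
  refine Submodule.sum_mem _ fun i _ => ?_
  by_cases hi : P.ht i < a
  · rw [hv i hi, zero_smul]; exact Submodule.zero_mem _
  · exact Submodule.smul_mem _ _ (eig_le_Ge (not_lt.1 hi) (P.ev_mem i))

lemma coe_mem (P : Prin R xp xm h) (z : H) : (z : g) ∈ Module.End.eigenspace (LieAlgebra.ad F g (h : g) : Module.End F g) ((0 : ℤ) : F) :=
  mem_eig.2 (by rw [R.ab h z]; simp)

lemma lie_ev_zero (P : Prin R xp xm h) {i a b : ι} (hb : R.al b = - R.al a) (hi : P.ht i = P.ht a) (hia : i ≠ a) : ⁅R.ev i, R.ev b⁆ = 0 := by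
  have hht : P.ht b = - P.ht a := by
    have := P.al_h b
    rw [hb, LinearMap.neg_apply, P.al_h] at this
    exact_mod_cast this.symm
  have h1 := lie_eig (P.ev_mem i) (P.ev_mem b)
  rw [hht, hi, add_neg_cancel] at h1
  have h2 := P.eig_zero h1
  obtain ⟨z, hz⟩ : ∃ z, R.al i z ≠ R.al a z := by
    by_contra hcon
    push Not at hcon
    exact hia (R.inj (LinearMap.ext hcon))
  have h3 := R.ab z ⟨_, h2⟩
  change ⁅(z : g), ⁅R.ev i, R.ev b⁆⁆ = 0 at h3
  rw [leibniz_lie, R.ev_eig, R.ev_eig, smul_lie, lie_smul, ← add_smul, hb, LinearMap.neg_apply, ← sub_eq_add_neg] at h3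
  exact (smul_eq_zero.1 h3).resolve_left (sub_ne_zero.2 hz)

lemma co_ne_of_reg (s : H) (n : g) (h0 : R.p0 n = 0) (hn : ∀ i, R.co i n ≠ 0 → 0 < P.ht i)
    (hreg : ∀ z, Module.finrank F (cent F g ((s : g) + n)) ≤ Module.finrank F (cent F g z))
    (a : ι) (ha : P.ht a = 2) (has : R.al a s = 0) : R.co a n ≠ 0 := by
  intro hcon
  obtain ⟨b, hb⟩ := R.neg a
  have hht : P.ht b = - 2 := by
    have := P.al_h b
    rw [hb, LinearMap.neg_apply, P.al_h, ha] at this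
    exact_mod_cast this.symm
  have hnG : n ∈ Ge R h 1 := P.mem_Ge h0 fun i hi => by
    by_contra hne
    have := hn i hne; omega
  let Φ : (Ge R h 1 × H × F) →ₗ[F] g := (Ge R h 1).subtype.coprod (H.toSubmodule.subtype.coprod (LinearMap.toSpanSingleton F g (R.ev b)))
  have hΦ : ∀ v z c, Φ (v, z, c) = (v : g) + (z + c • R.ev b) := fun v z c => by simp [Φ]
  have hinj : Function.Injective Φ := by
    rw [injective_iff_map_eq_zero]
    rintro ⟨v, z, c⟩ hv
    rw [hΦ] at hv
    have e1 := congrArg R.p0 hv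
    rw [map_add, map_add, P.Ge_p0 v.2, R.p0_coe, map_smul, R.p0_ev, smul_zero, add_zero, zero_add, map_zero] at e1
    have e2 := congrArg (R.co b) hv
    rw [map_add, map_add, P.Ge_co v.2 b (by omega), R.co_coe, map_smul, R.co_self, zero_add, zero_add, map_zero, smul_eq_mul, mul_one] at e2
    rw [e1, e2, zero_smul, add_zero, add_zero] at hv
    ext
    · exact hv
    · exact e1
    · exact e2
  have h1 := LinearMap.finrank_range_of_inj hinj
  rw [Module.finrank_prod, Module.finrank_prod, Module.finrank_self] at h1
  have hx0 : (s : g) + n ∈ Ge R h 0 := Submodule.add_mem _ (eig_le_Ge le_rfl (P.coe_mem s)) (Ge_mono (by norm_num) hnG)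
  have hcl : ⁅n, R.ev b⁆ ∈ Ge R h 1 := by
    conv => rw [R.dec n, h0, zero_add, sum_lie]
    refine Submodule.sum_mem _ fun i _ => ?_
    rw [smul_lie]
    by_cases hi : R.co i n = 0
    · rw [hi, zero_smul]; exact Submodule.zero_mem _
    refine Submodule.smul_mem _ _ ?_
    by_cases h2 : P.ht i = 2
    · by_cases hia : i = a
      · subst hia; exact absurd hcon hi
      · rw [P.lie_ev_zero hb (by rw [h2, ha]) hia]; exact Submodule.zero_mem _
    · have p1 := hn i hi
      have p2 := P.ht_one i
      exact eig_le_Ge (by omega) (lie_eig (P.ev_mem i) (P.ev_mem b))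
  have h2 := OpTriple.finrank_le_ker_add (LieAlgebra.ad F g ((s : g) + n) : Module.End F g) (LinearMap.range Φ) (Ge R h 1) (by
    rintro _ ⟨⟨v, z, c⟩, rfl⟩
    rw [hΦ, LieAlgebra.ad_apply, lie_add, lie_add, lie_smul]
    refine Submodule.add_mem _ (by simpa using lie_Ge hx0 v.2) (Submodule.add_mem _ ?_ (Submodule.smul_mem _ _ ?_))
    · rw [add_lie, R.ab, zero_add]
      simpa using lie_Ge hnG (eig_le_Ge le_rfl (P.coe_mem z))
    · rw [add_lie, R.ev_eig, hb, LinearMap.neg_apply, has, neg_zero, zero_smul, zero_add]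
      exact hcl)
  rw [← cent_eq_ker] at h2
  have h3 := hreg (h : g)
  have h4 : cent F g (h : g) ≤ H.toSubmodule := fun v hv => R.cent_reg h (fun i => by rw [P.al_h]; exact_mod_cast P.ht_ne i) v hv
  have h5 := Submodule.finrank_mono h4
  change _ ≤ Module.finrank F H at h5
  omega
end Prin
end Std
end

section
open scoped TensorProduct
set_option linter.unusedSectionVars false
set_option linter.unusedVariables false

section Deg
variable {F : Type*} [Field F] [CharZero F] [IsAlgClosed F] {g : Type*} [LieRing g] [LieAlgebra F g]
  [FiniteDimensional F g] {H : LieSubalgebra F g} {ι : Type*} [Fintype ι] {R : RD F H ι}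
  {xp xm : g} {h : H} (P : Prin R xp xm h)

namespace Prin

lemma nil_eig {m : ℤ} (hm : m ≠ 0) {u : g} (hu : u ∈ Module.End.eigenspace (LieAlgebra.ad F g (h : g) : Module.End F g) (m : F)) :
    IsNilpotent (LieAlgebra.ad F g u : Module.End F g) := by
  refine isNilpotent_of_shift (LieAlgebra.ad F g (h : g) : Module.End F g) _ (m : F) (by exact_mod_cast hm) ?_
  ext y
  simp only [Module.End.mul_apply, LinearMap.add_apply, LinearMap.smul_apply, LieAlgebra.ad_apply]
  rw [leibniz_lie, mem_eig.1 hu, smul_lie, add_comm]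

lemma exp_Ge {m b : ℤ} (hm : 1 ≤ m) {u y : g} (hu : u ∈ Module.End.eigenspace (LieAlgebra.ad F g (h : g) : Module.End F g) (m : F))
    (hy : ⁅u, ⁅u, y⁆⁆ ∈ Ge R h b) :
    expEnd (LieAlgebra.ad F g u : Module.End F g) y - (y + ⁅u, y⁆) ∈ Ge R h b := by
  refine expEnd_apply_sub_mem _ (nil_eig (by omega) hu) _ _ fun n hn => ?_
  induction n, hn using Nat.le_induction with
  | base => simpa [pow_succ] using hy
  | succ n hn ih =>
    rw [pow_succ', Module.End.mul_apply, LieAlgebra.ad_apply]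
    exact Ge_mono (by omega) (lie_Ge (eig_le_Ge le_rfl hu) ih)

lemma Ge_bot (R : RD F H ι) (h : H) : ∃ M : ℕ, Ge R h M = ⊥ := by
  obtain ⟨M, hM⟩ := OpTriple.exists_bound (LieAlgebra.ad F g (h : g) : Module.End F g)
  refine ⟨M, eq_bot_iff.2 (OpTriple.Wge_le _ fun c hc v hv => ?_)⟩
  rw [hM c (le_trans (Set.mem_Ici.1 hc) (le_abs_self c))] at hv
  exact hv

lemma stepB (s : H) (j : ℤ) (hj : 2 ≤ j) (d : g) (hd : d ∈ Ge R h j)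
    (hd0 : ∀ i, P.ht i = j → R.al i s = 0 → R.co i d = 0) :
    ∃ d' ∈ Ge R h (j + 1), InnRel F ((s : g) + xp + d) (s + xp + d') := by
  classical
  let cf : ι → F := fun i => if P.ht i = j then R.co i d / R.al i s else 0
  let u : g := ∑ i, cf i • R.ev i
  have hu : u ∈ Module.End.eigenspace (LieAlgebra.ad F g (h : g) : Module.End F g) (j : F) := by
    refine Submodule.sum_mem _ fun i _ => ?_
    by_cases hi : P.ht i = j
    · refine Submodule.smul_mem _ _ ?_
      have := P.ev_mem i
      rwa [hi] at this
    · simp [cf, hi]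
  have hcu : ∀ i, R.co i u = cf i := fun i => by
    have := R.co_sum 0 cf i
    rw [ZeroMemClass.coe_zero, zero_add] at this
    exact this
  have hxpd : xp + d ∈ Ge R h 2 := Submodule.add_mem _ (eig_le_Ge le_rfl P.xp_mem) (Ge_mono hj hd)
  have hs : (s : g) ∈ Ge R h 0 := eig_le_Ge le_rfl (P.coe_mem s)
  have hy : (s : g) + xp + d ∈ Ge R h 0 := by
    rw [add_assoc]; exact Submodule.add_mem _ hs (Ge_mono (by omega) hxpd)
  have huG : u ∈ Ge R h j := eig_le_Ge le_rfl hu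
  have h1 := exp_Ge (R := R) (b := j + 1) (by omega) hu (y := (s : g) + xp + d) (Ge_mono (by omega) (lie_Ge huG (lie_Ge huG hy)))
  refine ⟨expEnd (LieAlgebra.ad F g u : Module.End F g) ((s : g) + xp + d) - (s + xp), ?_, ?_⟩
  · have h2 : d + ⁅u, (s : g)⁆ ∈ Ge R h (j + 1) := by
      have hp0 : R.p0 (d + ⁅u, (s : g)⁆) = 0 := by
        rw [map_add, ← lie_skew, map_neg, R.p0_lie, P.Ge_p0 (Ge_mono (by omega) hd)]; simp
      refine P.mem_Ge hp0 fun i hi => ?_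
      rw [map_add, ← lie_skew, map_neg, R.co_lie, hcu]
      by_cases hij : P.ht i = j
      · simp only [cf, if_pos hij]
        by_cases h0 : R.al i s = 0
        · rw [h0, hd0 i hij h0]; simp
        · field_simp; ring
      · simp only [cf, if_neg hij]
        rw [P.Ge_co hd i (by omega)]; simp
    have h3 : ⁅u, xp + d⁆ ∈ Ge R h (j + 1) := Ge_mono (by omega) (lie_Ge huG hxpd)
    have : expEnd (LieAlgebra.ad F g u : Module.End F g) ((s : g) + xp + d) - (s + xp) = 
      (expEnd (LieAlgebra.ad F g u : Module.End F g) ((s : g) + xp + d) - ((s : g) + xp + d + ⁅u, (s : g) + xp + d⁆)) + 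
      (d + ⁅u, (s : g)⁆) + ⁅u, xp + d⁆ := by
      simp only [lie_add]; abel
    rw [this]
    exact Submodule.add_mem _ (Submodule.add_mem _ h1 h2) h3
  · rw [add_sub_cancel]
    exact InnRel.exp u (nil_eig (by omega) hu) _

lemma stepA (s : H) (φ : F →+ ℚ) (hφ : ∀ i, 0 < P.ht i → R.al i s ≠ 0 → 0 < φ (R.al i s)) 
    (j : ℤ) (hj : 3 ≤ j) (d : g) (hd : d ∈ Ge R h j) :
    ∃ d' ∈ Ge R h j, (∀ i, P.ht i = j → R.al i s = 0 → R.co i d' = 0) ∧ InnRel F ((s : g) + xp + d) (s + xp + d') := by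
  classical
  let dj : g := ∑ i, (if P.ht i = j then R.co i d else 0) • R.ev i
  have hdj : dj ∈ Module.End.eigenspace (LieAlgebra.ad F g (h : g) : Module.End F g) (j : F) := by
    refine Submodule.sum_mem _ fun i _ => ?_
    by_cases hi : P.ht i = j
    · refine Submodule.smul_mem _ _ ?_
      have := P.ev_mem i
      rwa [hi] at this
    · simp [hi]
  have hcj : ∀ i, R.co i dj = if P.ht i = j then R.co i d else 0 := fun i => by
    have := R.co_sum 0 (fun i => if P.ht i = j then R.co i d else 0) i
    simpa [dj] using this
  obtain ⟨w, hw, hwd⟩ := P.T.e_surj j (by omega) dj hdj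
  have hwx : ⁅w, xp⁆ = - dj := by rw [← lie_skew, ← hwd]; rfl
  let u : g := ∑ i, (if R.al i s = 0 then R.co i w else 0) • R.ev i
  have hcw : ∀ i, P.ht i ≠ j - 2 → R.co i w = 0 := fun i hi => P.eig_co hw i hi
  have hu : u ∈ Module.End.eigenspace (LieAlgebra.ad F g (h : g) : Module.End F g) ((j - 2 : ℤ) : F) := by
    refine Submodule.sum_mem _ fun i _ => ?_
    by_cases hi : P.ht i = j - 2
    · refine Submodule.smul_mem _ _ ?_
      have := P.ev_mem i
      rwa [hi] at this
    · simp [hcw i hi]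
  have hus : ⁅(s : g), u⁆ = 0 := by
    simp only [u, lie_sum, lie_smul, R.ev_eig, smul_smul]
    refine Finset.sum_eq_zero fun i _ => ?_
    by_cases h0 : R.al i s = 0 <;> simp [h0]
  have hus' : ⁅u, (s : g)⁆ = 0 := by rw [← lie_skew, hus, neg_zero]
  have hwu : w - u = ∑ i, (if R.al i s = 0 then 0 else R.co i w) • R.ev i := by
    conv_lhs => rw [R.dec w, eig_p0 (R := R) hw (by omega), zero_add]
    rw [← Finset.sum_sub_distrib]
    refine Finset.sum_congr rfl fun i _ => ?_
    split_ifs <;> simp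
  have key : ∀ i0, R.al i0 s = 0 → R.co i0 ⁅w - u, xp⁆ = 0 := by
    intro i0 h0
    have e1 := R.dec xp
    rw [eig_p0 (R := R) P.xp_mem (by omega), zero_add] at e1
    rw [hwu]
    conv_lhs => rw [e1]
    simp only [sum_lie, lie_sum, map_sum, smul_lie, lie_smul, map_smul]
    simp only [Finset.smul_sum]
    refine Finset.sum_eq_zero fun k _ => Finset.sum_eq_zero fun i _ => ?_
    by_cases hi : R.al i s = 0
    · simp [hi]
    by_cases hi2 : P.ht i = j - 2
    swap
    · simp [hcw i hi2]
    by_cases hk : P.ht k = 2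
    swap
    · rw [P.eig_co P.xp_mem k hk]; simp
    have hne : R.al i s + R.al k s ≠ 0 := by
      intro hz
      have p1 := hφ i (by omega) hi
      have p2 : 0 ≤ φ (R.al k s) := by
        by_cases hk0 : R.al k s = 0
        · rw [hk0, map_zero]
        · exact (hφ k (by omega) hk0).le
      have := congrArg φ hz
      rw [map_add, map_zero] at this
      linarith
    have h3 : ⁅(s : g), ⁅R.ev i, R.ev k⁆⁆ = (R.al i s + R.al k s) • ⁅R.ev i, R.ev k⁆ := by
      rw [leibniz_lie, R.ev_eig, R.ev_eig, smul_lie, lie_smul, ← add_smul]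
    have h4 := ((R.eig_iff s _ _).1 h3).2 i0
    rw [h0, zero_sub] at h4
    rw [(mul_eq_zero.1 h4).resolve_left (neg_ne_zero.2 hne)]
    simp
  have hxpd : xp + d ∈ Ge R h 2 := Submodule.add_mem _ (eig_le_Ge le_rfl P.xp_mem) (Ge_mono (by omega) hd)
  have huG : u ∈ Ge R h (j - 2) := eig_le_Ge le_rfl hu
  have huy : ⁅u, (s : g) + xp + d⁆ = ⁅u, xp⁆ + ⁅u, d⁆ := by rw [lie_add, lie_add, hus', zero_add]
  have hux : ⁅u, xp⁆ ∈ Ge R h j := Ge_mono (by omega) (lie_Ge huG (eig_le_Ge le_rfl P.xp_mem))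
  have hud : ⁅u, d⁆ ∈ Ge R h (j + 1) := Ge_mono (by omega) (lie_Ge huG hd)
  have h1 := exp_Ge (R := R) (b := j + 1) (by omega) hu (y := (s : g) + xp + d) (by
    rw [huy]
    exact Ge_mono (by omega) (lie_Ge huG (Submodule.add_mem _ hux (Ge_mono (by omega) hud))))
  have this : expEnd (LieAlgebra.ad F g u : Module.End F g) ((s : g) + xp + d) - (s + xp) = 
      (expEnd (LieAlgebra.ad F g u : Module.End F g) ((s : g) + xp + d) - ((s : g) + xp + d + ⁅u, (s : g) + xp + d⁆)) + 
      ⁅u, d⁆ + (d + ⁅u, xp⁆) := by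
      rw [huy]; abel
  refine ⟨expEnd (LieAlgebra.ad F g u : Module.End F g) ((s : g) + xp + d) - (s + xp), ?_, fun i hi h0 => ?_, ?_⟩
  · rw [this]
    exact Submodule.add_mem _ (Ge_mono (by omega) (Submodule.add_mem _ h1 hud)) (Submodule.add_mem _ hd hux)
  · rw [this, map_add, P.Ge_co (Submodule.add_mem _ h1 hud) i (by omega), zero_add, map_add]
    have h2 := key i h0
    rw [sub_lie, map_sub, hwx, map_neg, hcj, if_pos hi] at h2
    linear_combination -h2
  · rw [add_sub_cancel]
    exact InnRel.exp u (nil_eig (by omega) hu) _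

lemma deg (s : H) (φ : F →+ ℚ) (hφ : ∀ i, 0 < P.ht i → R.al i s ≠ 0 → 0 < φ (R.al i s)) 
    (d : g) (hd : d ∈ Ge R h 2) (hd0 : ∀ i, P.ht i = 2 → R.al i s = 0 → R.co i d = 0) :
    InnRel F ((s : g) + xp + d) (s + xp) := by
  have : ∀ j : ℕ, ∃ d' ∈ Ge R h (j + 3 : ℕ), InnRel F ((s : g) + xp + d) (s + xp + d') := by
    intro j
    induction j with
    | zero => 
      obtain ⟨d', h1, h2⟩ := P.stepB s 2 le_rfl d hd hd0
      exact ⟨d', by simpa using h1, h2⟩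
    | succ j ih =>
      obtain ⟨d1, h1, h2⟩ := ih
      obtain ⟨d2, h3, h4, h5⟩ := P.stepA s φ hφ (j + 3 : ℕ) (by omega) d1 h1
      obtain ⟨d3, h6, h7⟩ := P.stepB s (j + 3 : ℕ) (by omega) d2 h3 h4
      refine ⟨d3, ?_, (h2.trans h5).trans h7⟩
      convert h6 using 2
      push_cast; ring
  obtain ⟨M, hM⟩ := Ge_bot R h
  obtain ⟨d', h1, h2⟩ := this M
  have h3 : d' ∈ Ge R h M := Ge_mono (by push_cast; omega) h1
  rw [hM] at h3
  rw [(Submodule.mem_bot F).1 h3, add_zero] at h2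
  exact h2

lemma slice (P : Prin R xp xm h) (y : g) (hy : y ∈ Ge R (-h) 0) : ∃ a ∈ cent F g xm, a ∈ Ge R (-h) 0 ∧ InnRel F (xp + y) (xp + a) := by
  have hneg : ∀ (c : ℤ) (v : g), v ∈ Module.End.eigenspace (LieAlgebra.ad F g (h : g) : Module.End F g) (c : F) ↔ 
      v ∈ Module.End.eigenspace (LieAlgebra.ad F g ((-h : H) : g) : Module.End F g) ((-c : ℤ) : F) := by
    intro c v
    rw [mem_eig, mem_eig (h := -h)]
    push_cast
    rw [neg_lie, neg_smul, neg_inj]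
  have hxp : xp ∈ Ge R (-h) (-2) := eig_le_Ge le_rfl ((hneg 2 xp).1 P.xp_mem)
  have : ∀ j : ℕ, ∃ a d, a ∈ cent F g xm ∧ a ∈ Ge R (-h) 0 ∧ d ∈ Ge R (-h) j ∧ InnRel F (xp + y) (xp + a + d) := by
    intro j
    induction j with
    | zero => exact ⟨0, y, Submodule.zero_mem _, Submodule.zero_mem _, by simpa using hy, by rw [add_zero]; exact InnRel.refl _⟩
    | succ j ih =>
      obtain ⟨a, d, ha, ha0, hd, hI⟩ := ih
      have hd' := hd
      have hset : Set.Ici (j : ℤ) = {(j : ℤ)} ∪ Set.Ici ((j + 1 : ℕ) : ℤ) := by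
        ext x; simp; omega
      unfold Ge at hd'
      rw [hset, OpTriple.Wge_union, OpTriple.Wge_singleton] at hd'
      obtain ⟨d1, hd1, d2, hd2, hdd⟩ := Submodule.mem_sup.1 hd'
      have hd1' : d1 ∈ Module.End.eigenspace (LieAlgebra.ad F g (h : g) : Module.End F g) ((-(j : ℤ) : ℤ) : F) := by
        rw [hneg, neg_neg]; exact hd1
      obtain ⟨a', ha', hfa, w, hw, hdw⟩ := P.T.eig_decomp _ _ hd1'
      have ha'0 : a' ∈ Ge R (-h) 0 := eig_le_Ge (b := j) (by omega) (by rw [hneg, neg_neg] at ha'; exact ha')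
      have hw' : w ∈ Module.End.eigenspace (LieAlgebra.ad F g ((-h : H) : g) : Module.End F g) ((j + 2 : ℤ) : F) := by
        rw [hneg] at hw
        convert hw using 3; ring
      have hwG : w ∈ Ge R (-h) (j + 2) := eig_le_Ge le_rfl hw'
      have had : a + d ∈ Ge R (-h) 0 := Submodule.add_mem _ ha0 (Ge_mono (by omega) hd)
      have hyG : xp + a + d ∈ Ge R (-h) (-2) := by
        rw [add_assoc]; exact Submodule.add_mem _ hxp (Ge_mono (by omega) had)
      have h1 := exp_Ge (R := R) (b := (j + 1 : ℕ)) (by omega) hw' (y := xp + a + d) 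
        (Ge_mono (by push_cast; omega) (lie_Ge hwG (lie_Ge hwG hyG)))
      have hwx : ⁅w, xp⁆ = a' - d1 := by
        rw [← lie_skew]
        have : ⁅xp, w⁆ = d1 - a' := by rw [hdw]; simp
        rw [this]; abel
      refine ⟨a + a', expEnd (LieAlgebra.ad F g w : Module.End F g) (xp + a + d) - (xp + a + a'), Submodule.add_mem _ ha hfa, Submodule.add_mem _ ha0 ha'0, ?_, ?_⟩
      · have : expEnd (LieAlgebra.ad F g w : Module.End F g) (xp + a + d) - (xp + a + a') = 
          (expEnd (LieAlgebra.ad F g w : Module.End F g) (xp + a + d) - (xp + a + d + ⁅w, xp + a + d⁆)) + d2 + ⁅w, a + d⁆ := by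
          rw [add_assoc xp a d, lie_add w xp, hwx, ← hdd]; abel
        rw [this]
        exact Submodule.add_mem _ (Submodule.add_mem _ h1 hd2) (Ge_mono (by push_cast; omega) (lie_Ge hwG had))
      · rw [← add_assoc xp a a', add_sub_cancel]
        exact hI.trans (InnRel.exp w (nil_eig (by omega) hw') _)
  obtain ⟨M, hM⟩ := Ge_bot R (-h)
  obtain ⟨a, d, h1, h2, h3, h4⟩ := this M
  rw [hM] at h3
  rw [(Submodule.mem_bot F).1 h3, add_zero] at h4
  exact ⟨a, h1, h2, h4⟩

lemma cent_finrank_eq (θ : g ≃ₗ⁅F⁆ g) (x : g) : Module.finrank F (cent F g (θ x)) ≤ Module.finrank F (cent F g x) := by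
  have : cent F g (θ x) ≤ (cent F g x).map θ.toLinearEquiv.toLinearMap := by
    intro v hv
    refine ⟨θ.symm v, ?_, LieEquiv.apply_symm_apply θ v⟩
    change ⁅x, θ.symm v⁆ = 0
    apply θ.injective
    change θ _ = θ _
    rw [LieEquiv.map_lie, LieEquiv.apply_symm_apply, map_zero]
    exact hv
  exact (Submodule.finrank_mono this).trans (Submodule.finrank_map_le _ _)

theorem reg_slice (P : Prin R xp xm h) [LieAlgebra.IsKilling F g] (x : g) (hreg : ∀ z, Module.finrank F (cent F g x) ≤ Module.finrank F (cent F g z)) :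
    ∃ a ∈ cent F g xm, a ∈ Ge R (-h) 0 ∧ InnRel F x (xp + a) := by
  classical
  obtain ⟨s, n, φ, hI, hφ, h0, hn⟩ := P.std x
  have hco : ∀ i, P.ht i = 2 → R.al i s = 0 → R.co i n ≠ 0 := by
    refine P.co_ne_of_reg s n h0 (fun i hi => (hn i hi).1) (fun z => le_trans ?_ (hreg z))
    obtain ⟨θ, _, hθ⟩ := hI
    rw [← hθ]
    exact cent_finrank_eq θ x
  obtain ⟨θ, c, k1, k2, k3, k4⟩ := P.exists_scale (fun i => if P.ht i = 2 ∧ R.al i s = 0 then R.co i xp / R.co i n else 1) (fun i => by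
    split_ifs with hi
    · exact div_ne_zero (P.co_xp_ne i hi.1) (hco i hi.1 hi.2)
    · exact one_ne_zero)
  have hθn : θ n = ((0 : H) : g) + ∑ i, (R.co i n * c i) • R.ev i := by
    conv_lhs => rw [R.dec n, h0, zero_add]
    simp [map_sum, k3, smul_smul]
  have hcn : ∀ i, R.co i (θ n) = R.co i n * c i := fun i => by rw [hθn, R.co_sum]
  have hp0 : R.p0 (θ n) = 0 := by rw [hθn, R.p0_sum]; rfl
  have hθG : θ n ∈ Ge R h 2 := P.mem_Ge hp0 fun i hi => by
    rw [hcn]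
    by_contra hne
    have h1 := (hn i (left_ne_zero_of_mul hne)).1
    have := P.ht_one i
    omega
  have hfin := P.deg s φ hφ (θ n - xp) (Submodule.sub_mem _ hθG (eig_le_Ge le_rfl P.xp_mem)) (fun i hi h0 => by
    rw [map_sub, hcn, k4 i hi, if_pos ⟨hi, h0⟩, mul_div_cancel₀ _ (hco i hi h0), sub_self])
  have e1 : (s : g) + xp + (θ n - xp) = θ (s + n) := by rw [map_add, k2]; abel
  rw [e1] at hfin
  obtain ⟨a, ha, ha0, hs⟩ := P.slice s (eig_le_Ge le_rfl (mem_eig.2 (by rw [R.ab (-h) s]; simp)))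
  refine ⟨a, ha, ha0, ((hI.trans ⟨θ, k1, rfl⟩).trans hfin).trans ?_⟩
  rw [add_comm (s : g) xp]
  exact hs
end Prin
end Deg
end

section
open scoped TensorProduct
set_option linter.unusedSectionVars false
set_option linter.unusedVariables false

section Trans
variable {F : Type*} [Field F] [CharZero F] [IsAlgClosed F] {g : Type*} [LieRing g] [LieAlgebra F g]
  [FiniteDimensional F g] {H : LieSubalgebra F g} {ι : Type*} [Fintype ι] {R : RD F H ι}
  {xp xm : g} {h : H}

lemma Prin.transv (P : Prin R xp xm h) (a : g) (ha : a ∈ Prin.Ge R (-h) 0) (v : g) :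
    ∃ w, ∃ b ∈ cent F g xm, v = ⁅xp + a, w⁆ + b := by
  have hneg : ∀ (c : ℤ) (v : g), v ∈ Module.End.eigenspace (LieAlgebra.ad F g (h : g) : Module.End F g) (c : F) ↔ 
      v ∈ Module.End.eigenspace (LieAlgebra.ad F g ((-h : H) : g) : Module.End F g) ((-c : ℤ) : F) := by
    intro c v
    rw [Prin.mem_eig, Prin.mem_eig (h := -h)]
    push_cast
    rw [neg_lie, neg_smul, neg_inj]
  let S : Submodule F g := LinearMap.range (LieAlgebra.ad F g (xp + a) : Module.End F g) ⊔ cent F g xm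
  obtain ⟨M, hM⟩ := Prin.Ge_bot R (-h)
  have key : ∀ n : ℕ, Prin.Ge R (-h) ((M : ℤ) - n) ≤ S := by
    intro n
    induction n with
    | zero => simp only [Nat.cast_zero, sub_zero]; rw [hM]; exact bot_le
    | succ n ih =>
      intro d hd
      set j : ℤ := (M : ℤ) - (n + 1 : ℕ) with hj
      have hset : Set.Ici (j : ℤ) = {(j : ℤ)} ∪ Set.Ici ((M : ℤ) - n) := by
        ext x; simp [hj]; omega
      unfold Prin.Ge at hd
      rw [hset, OpTriple.Wge_union, OpTriple.Wge_singleton] at hd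
      obtain ⟨d1, hd1, d2, hd2, hdd⟩ := Submodule.mem_sup.1 hd
      have hd1' : d1 ∈ Module.End.eigenspace (LieAlgebra.ad F g (h : g) : Module.End F g) ((-(j : ℤ) : ℤ) : F) := by
        rw [hneg, neg_neg]; exact hd1
      obtain ⟨a', ha', hfa, w, hw, hdw⟩ := P.T.eig_decomp _ _ hd1'
      have hw' : w ∈ Module.End.eigenspace (LieAlgebra.ad F g ((-h : H) : g) : Module.End F g) ((j + 2 : ℤ) : F) := by
        rw [hneg] at hw
        convert hw using 3; ring
      have hwG : w ∈ Prin.Ge R (-h) (j + 2) := Prin.eig_le_Ge le_rfl hw'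
      have h1 : ⁅a, w⁆ ∈ S := ih (Prin.Ge_mono (by simp [hj]; omega) (Prin.lie_Ge ha hwG))
      have h2 : ⁅xp + a, w⁆ ∈ S := Submodule.mem_sup_left ⟨w, rfl⟩
      have h3 : a' ∈ S := Submodule.mem_sup_right hfa
      have : d = a' + (⁅xp + a, w⁆ - ⁅a, w⁆) + d2 := by
        rw [← hdd, hdw, add_lie, add_sub_cancel_right]; rfl
      rw [this]
      exact Submodule.add_mem _ (Submodule.add_mem _ h3 (Submodule.sub_mem _ h2 h1)) (ih hd2)
  have hv : v ∈ S := by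
    obtain ⟨M', hM'⟩ := OpTriple.exists_bound (LieAlgebra.ad F g ((-h : H) : g) : Module.End F g)
    have h1 : v ∈ ⨆ i : ℤ, Module.End.eigenspace (LieAlgebra.ad F g (h : g) : Module.End F g) (i : F) := by
      rw [P.T.iSup_eigenspace]; trivial
    refine key (M + M') ((iSup_le fun i => ?_ : _ ≤ Prin.Ge R (-h) _) h1)
    intro x hx
    rw [hneg] at hx
    by_cases hi : (M' : ℤ) ≤ i
    · rw [hM' (-i) (by rw [abs_neg]; exact le_trans hi (le_abs_self _))] at hx
      rw [(Submodule.mem_bot F).1 hx]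
      exact Submodule.zero_mem _
    · exact Prin.eig_le_Ge (by push_cast; omega) hx
  obtain ⟨_, ⟨w, rfl⟩, b, hb, hvb⟩ := Submodule.mem_sup.1 hv
  exact ⟨w, b, hb, hvb.symm⟩
end Trans

section Lift
variable {F : Type*} [Field F] [CharZero F] {g : Type*} [LieRing g] [LieAlgebra F g]
  [FiniteDimensional F g] {A : Type*} [CommRing A] [Algebra F A] [FiniteDimensional F A]

lemma ad_one_pow (N : g) (n : ℕ) (a : A) (x : g) :
    ((LieAlgebra.ad F (A ⊗[F] g) ((1 : A) ⊗ₜ[F] N) : Module.End F (A ⊗[F] g)) ^ n) (a ⊗ₜ[F] x) =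
      a ⊗ₜ[F] (((LieAlgebra.ad F g N : Module.End F g) ^ n) x) := by
  induction n with
  | zero => simp
  | succ n ih =>
    rw [pow_succ', pow_succ', Module.End.mul_apply, Module.End.mul_apply, ih, LieAlgebra.ad_apply, LieAlgebra.ad_apply,
      LieAlgebra.ExtendScalars.bracket_tmul, one_mul]

lemma nil_one (N : g) (hN : IsNilpotent (LieAlgebra.ad F g N : Module.End F g)) :
    IsNilpotent (LieAlgebra.ad F (A ⊗[F] g) ((1 : A) ⊗ₜ[F] N) : Module.End F (A ⊗[F] g)) := by
  obtain ⟨n, hn⟩ := hN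
  refine ⟨n, TensorProduct.ext' fun a x => ?_⟩
  rw [ad_one_pow, hn]; simp

lemma exp_one (N : g) (hN : IsNilpotent (LieAlgebra.ad F g N : Module.End F g)) (a : A) (x : g) :
    expEnd (LieAlgebra.ad F (A ⊗[F] g) ((1 : A) ⊗ₜ[F] N) : Module.End F (A ⊗[F] g)) (a ⊗ₜ[F] x) =
      a ⊗ₜ[F] expEnd (LieAlgebra.ad F g N : Module.End F g) x := by
  have hN' := nil_one (A := A) N hN
  obtain ⟨n, hn⟩ := id hN
  rw [expEnd_apply_of_pow _ hN n x (by rw [hn]; rfl), expEnd_apply_of_pow _ hN' n _ (by rw [ad_one_pow, hn]; simp),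
    TensorProduct.tmul_sum]
  refine Finset.sum_congr rfl fun k _ => ?_
  rw [ad_one_pow, TensorProduct.tmul_smul]

/-- filtration -/
def Fil (F : Type*) [Field F] (g : Type*) [LieRing g] [LieAlgebra F g] {A : Type*} [CommRing A] [Algebra F A] (I : Ideal A) :
    Submodule A (A ⊗[F] g) := I • ⊤

lemma Fil_smul {I : Ideal A} {c : F} {x : A ⊗[F] g} (hx : x ∈ Fil F g I) : c • x ∈ Fil F g I := by
  rw [← algebraMap_smul A c x]
  exact Submodule.smul_mem _ _ hx

lemma Fil_lie {I J : Ideal A} {x y : A ⊗[F] g} (hx : x ∈ Fil F g I) (hy : y ∈ Fil F g J) : ⁅x, y⁆ ∈ Fil F g (I * J) := by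
  unfold Fil at *
  refine Submodule.smul_induction_on hx (fun r hr n _ => ?_) (fun a b ha hb => by rw [add_lie]; exact Submodule.add_mem _ ha hb)
  refine Submodule.smul_induction_on hy (fun s hs k _ => ?_) (fun a b ha hb => by rw [lie_add]; exact Submodule.add_mem _ ha hb)
  rw [smul_lie, lie_smul, smul_smul]
  exact Submodule.smul_mem_smul (Ideal.mul_mem_mul hr hs) trivial

lemma Fil_lie' {I : Ideal A} {x : A ⊗[F] g} (z : A ⊗[F] g) (hx : x ∈ Fil F g I) : ⁅z, x⁆ ∈ Fil F g I := by
  unfold Fil at *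
  refine Submodule.smul_induction_on hx (fun r hr n _ => ?_) (fun a b ha hb => by rw [lie_add]; exact Submodule.add_mem _ ha hb)
  rw [lie_smul]
  exact Submodule.smul_mem_smul hr trivial

lemma Fil_mono {I J : Ideal A} (h : I ≤ J) : Fil F g I ≤ Fil F g J := Submodule.smul_mono_left h

lemma exp_Fil {I : Ideal A} (z : A ⊗[F] g) {x : A ⊗[F] g} (hx : x ∈ Fil F g I) :
    expEnd (LieAlgebra.ad F (A ⊗[F] g) z : Module.End F (A ⊗[F] g)) x ∈ Fil F g I := by
  unfold expEnd
  rw [LinearMap.sum_apply]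
  refine Submodule.sum_mem _ fun n hn => ?_
  rw [LinearMap.smul_apply]
  refine Fil_smul ?_
  clear hn
  induction n with
  | zero => simpa using hx
  | succ n ih => rw [pow_succ', Module.End.mul_apply]; exact Fil_lie' z ih

lemma lift_inn {x y : g} (h : InnRel F x y) (I : Ideal A) (X : A ⊗[F] g) (hX : X - (1 : A) ⊗ₜ[F] x ∈ Fil F g I) :
    ∃ X', InnRel F X X' ∧ X' - (1 : A) ⊗ₜ[F] y ∈ Fil F g I := by
  obtain ⟨θ, ⟨l, h1, h2⟩, rfl⟩ := h
  rw [← h2 x]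
  clear h2
  induction l with
  | nil => exact ⟨X, InnRel.refl X, hX⟩
  | cons N l ih =>
    obtain ⟨X', h3, h4⟩ := ih (fun N hN => h1 N (List.mem_cons_of_mem _ hN))
    have hN := h1 N (by simp)
    refine ⟨_, h3.trans (InnRel.exp ((1 : A) ⊗ₜ[F] N) (nil_one N hN) X'), ?_⟩
    rw [List.foldr_cons, ← exp_one N hN, ← map_sub]
    exact exp_Fil _ h4

lemma nil_Fil {m : Ideal A} (hm : IsNilpotent m) {W : A ⊗[F] g} (hW : W ∈ Fil F g m) :
    IsNilpotent (LieAlgebra.ad F (A ⊗[F] g) W : Module.End F (A ⊗[F] g)) := by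
  obtain ⟨K, hK⟩ := hm
  refine ⟨K, LinearMap.ext fun v => ?_⟩
  have : ∀ n : ℕ, ((LieAlgebra.ad F (A ⊗[F] g) W : Module.End F (A ⊗[F] g)) ^ n) v ∈ Fil F g (m ^ n) := by
    intro n
    induction n with
    | zero => simp [Fil]
    | succ n ih =>
      rw [pow_succ' m n, pow_succ' _ n, Module.End.mul_apply]
      exact Fil_lie hW ih
  have h := this K
  rw [hK] at h
  simpa [Fil] using h

lemma slice_lift {xp xm a : g} (ha : a ∈ cent F g xm) (ht : ∀ v : g, ∃ w, ∃ b ∈ cent F g xm, v = ⁅xp + a, w⁆ + b)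
    {m : Ideal A} (hm : IsNilpotent m) (X : A ⊗[F] g) (hX : X - (1 : A) ⊗ₜ[F] (xp + a) ∈ Fil F g m) :
    ∃ Y, InnRel F X Y ∧ Y ∈ tSlice F xp xm := by
  have hmem : ∀ (r : A) (b : g), b ∈ cent F g xm → r ⊗ₜ[F] b ∈ centSub F (A := A) xm := fun r b hb =>
    ⟨r ⊗ₜ[F] ⟨b, hb⟩, by simp⟩
  have htm : ∀ (k : ℕ) (Y : A ⊗[F] g), Y ∈ Fil F g (m ^ k) → ∃ W B, W ∈ Fil F g (m ^ k) ∧ B ∈ Fil F g (m ^ k) ∧ B ∈ centSub F (A := A) xm ∧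
      Y = ⁅(1 : A) ⊗ₜ[F] (xp + a), W⁆ + B := by
    intro k Y hY
    refine Submodule.smul_induction_on hY (fun r hr n _ => ?_) ?_
    · induction n using TensorProduct.induction_on with
      | zero => exact ⟨0, 0, Submodule.zero_mem _, Submodule.zero_mem _, Submodule.zero_mem _, by simp⟩
      | tmul s v =>
        obtain ⟨w, b, hb, hv⟩ := ht v
        refine ⟨r • (s ⊗ₜ[F] w), r • (s ⊗ₜ[F] b), Submodule.smul_mem_smul hr trivial, Submodule.smul_mem_smul hr trivial, ?_, ?_⟩
        · rw [TensorProduct.smul_tmul']; exact hmem _ b hb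
        · rw [lie_smul, LieAlgebra.ExtendScalars.bracket_tmul, one_mul, ← smul_add, ← TensorProduct.tmul_add, ← hv]
      | add x y hx hy =>
        obtain ⟨W, B, h1, h2, h3, h4⟩ := hx trivial
        obtain ⟨W', B', h1', h2', h3', h4'⟩ := hy trivial
        refine ⟨W + W', B + B', Submodule.add_mem _ h1 h1', Submodule.add_mem _ h2 h2', Submodule.add_mem _ h3 h3', ?_⟩
        rw [smul_add, h4, h4', lie_add]; abel
    · rintro x y ⟨W, B, h1, h2, h3, h4⟩ ⟨W', B', h1', h2', h3', h4'⟩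
      refine ⟨W + W', B + B', Submodule.add_mem _ h1 h1', Submodule.add_mem _ h2 h2', Submodule.add_mem _ h3 h3', ?_⟩
      rw [h4, h4', lie_add]; abel
  have main : ∀ k : ℕ, ∃ X' c Y, InnRel F X X' ∧ c ∈ centSub F (A := A) xm ∧ c - (1 : A) ⊗ₜ[F] a ∈ Fil F g m ∧ Y ∈ Fil F g (m ^ (k + 1)) ∧
      X' = (1 : A) ⊗ₜ[F] xp + c + Y := by
    intro k
    induction k with
    | zero =>
      refine ⟨X, (1 : A) ⊗ₜ[F] a, X - (1 : A) ⊗ₜ[F] (xp + a), InnRel.refl X, hmem _ a ha, by rw [sub_self]; exact Submodule.zero_mem _, by simpa using hX, ?_⟩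
      rw [TensorProduct.tmul_add]; abel
    | succ k ih =>
      obtain ⟨X', c, Y, h1, h2, h3, h4, h5⟩ := ih
      obtain ⟨W, B, hW, hB, hBc, hY⟩ := htm _ Y h4
      have hle : m ^ (k + 1) ≤ m := Ideal.pow_le_self (by omega)
      have hWm := Fil_mono hle hW
      have hle2 : m ^ (k + 1) * m ^ (k + 1) ≤ m ^ (k + 1 + 1) := by
        rw [← pow_add]; exact Ideal.pow_le_pow_right (by omega)
      have hn := nil_Fil hm hWm
      have e1 := expEnd_apply_sub_mem _ hn ((Fil F g (m ^ (k + 1 + 1))).restrictScalars F) X' (fun n hn => by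
        induction n, hn using Nat.le_induction with
        | base =>
          rw [pow_two, Module.End.mul_apply]
          refine Fil_mono hle2 (Fil_lie hW ?_)
          change ⁅W, X'⁆ ∈ _
          rw [← lie_skew]
          exact Submodule.neg_mem _ (Fil_lie' _ hW)
        | succ n hn ih => rw [pow_succ' _ n, Module.End.mul_apply]; exact Fil_lie' W ih)
      refine ⟨_, c + B, _, h1.trans (InnRel.exp W hn X'), Submodule.add_mem _ h2 hBc, ?_, ?_, (add_sub_cancel _ _).symm⟩
      · rw [add_sub_right_comm]
        exact Submodule.add_mem _ h3 (Fil_mono hle hB)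
      · have e2 : ⁅W, (c - (1 : A) ⊗ₜ[F] a) + Y⁆ ∈ Fil F g (m ^ (k + 1 + 1)) := by
          rw [pow_succ _ (k + 1)]
          exact Fil_lie hW (Submodule.add_mem _ h3 (Fil_mono hle h4))
        have e3 : expEnd (LieAlgebra.ad F (A ⊗[F] g) W : Module.End F (A ⊗[F] g)) X' - ((1 : A) ⊗ₜ[F] xp + (c + B)) =
          (expEnd (LieAlgebra.ad F (A ⊗[F] g) W : Module.End F (A ⊗[F] g)) X' - (X' + ⁅W, X'⁆)) + ⁅W, (c - (1 : A) ⊗ₜ[F] a) + Y⁆ := by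
          have q1 : ⁅W, X'⁆ = ⁅W, (1 : A) ⊗ₜ[F] (xp + a)⁆ + ⁅W, (c - (1 : A) ⊗ₜ[F] a) + Y⁆ := by
            rw [← lie_add, h5, TensorProduct.tmul_add]; congr 1; abel
          have q2 : ⁅W, (1 : A) ⊗ₜ[F] (xp + a)⁆ = B - Y := by
            rw [← lie_skew, hY]; abel
          rw [q1, q2]
          nth_rewrite 3 [h5]
          abel
        rw [e3]
        exact Submodule.add_mem _ e1 e2
  obtain ⟨K, hK⟩ := id hm
  obtain ⟨X', c, Y, h1, h2, h3, h4, h5⟩ := main K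
  have : Y = 0 := by
    rw [pow_succ, hK] at h4
    simpa [Fil] using h4
  refine ⟨X', h1, ?_⟩
  change X' - (1 : A) ⊗ₜ[F] xp ∈ centSub F xm
  rw [h5, this, add_zero, add_sub_cancel_left]
  exact h2
end Lift
end

section
open scoped TensorProduct
set_option linter.unusedSectionVars false
set_option linter.unusedVariables false

section Smith
open Polynomial
variable {F : Type*} [Field F] [CharZero F] 

lemma smith_rank {M : Type*} [AddCommGroup M] [Module F[X] M] [Module F M] [IsScalarTower F F[X] M]
    {n : ℕ} (b : Module.Basis (Fin n) F[X] M) {V : Type*} [AddCommGroup V] [Module F V] [FiniteDimensional F V]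
    (hV : Module.finrank F V = n) (ev : F → M →ₗ[F] V) (hev : ∀ s, Function.Surjective (ev s))
    (hevs : ∀ s (p : F[X]) m, ev s (p • m) = p.eval s • ev s m)
    (D : M →ₗ[F[X]] M) (Ds : F → V →ₗ[F] V) (hD : ∀ s m, ev s (D m) = Ds s (ev s m))
    {L : Type*} [AddCommGroup L] [Module F L] [FiniteDimensional F L] (N : ℕ) (hN : 0 < N)
    (π : M →ₗ[F] L) (hπ : Function.Surjective π) (hπN : ∀ m, π ((X ^ N : F[X]) • m) = 0) 
    (Db : L →ₗ[F] L) (hDb : ∀ m, π (D m) = Db (π m)) :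
    ∃ k, (∃ s, Module.finrank F (LinearMap.ker (Ds s)) + k ≤ n) ∧ Module.finrank F (LinearMap.range Db) ≤ N * k ∧
      (N * k ≤ Module.finrank F (LinearMap.range Db) → Module.finrank F (LinearMap.ker (Ds 0)) + k ≤ n) := by
  classical
  obtain ⟨k, bM, bN, f, a, snf⟩ := Submodule.smithNormalForm b (LinearMap.range D)
  have ha : ∀ i, a i ≠ 0 := fun i h0 => by
    have h1 := snf i
    rw [h0, zero_smul] at h1
    exact bN.ne_zero i (Subtype.ext h1)
  have key : ∀ s, (∀ i, (a i).eval s ≠ 0) → Module.finrank F (LinearMap.ker (Ds s)) + k ≤ n := by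
    intro s hs
    have hspan : ⊤ ≤ Submodule.span F (Set.range fun i => ev s (bM i)) := by
      rintro v -
      obtain ⟨m, rfl⟩ := hev s v
      rw [← bM.sum_repr m, map_sum]
      refine Submodule.sum_mem _ fun i _ => ?_
      rw [hevs]
      exact Submodule.smul_mem _ _ (Submodule.subset_span ⟨i, rfl⟩)
    have hli : LinearIndependent F (fun i => ev s (bM i)) :=
      linearIndependent_of_top_le_span_of_card_eq_finrank hspan (by rw [Fintype.card_fin, hV])
    have hli2 := hli.comp f f.injective
    have hle : Submodule.span F (Set.range ((fun i => ev s (bM i)) ∘ f)) ≤ LinearMap.range (Ds s) := by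
      rw [Submodule.span_le]
      rintro _ ⟨i, rfl⟩
      obtain ⟨m, hm⟩ := (bN i).2
      refine ⟨((a i).eval s)⁻¹ • ev s m, ?_⟩
      rw [map_smul, ← hD, hm, snf, hevs, smul_smul, inv_mul_cancel₀ (hs i), one_smul]
      rfl
    have h1 := Submodule.finrank_mono hle
    rw [finrank_span_eq_card hli2, Fintype.card_fin] at h1
    have h2 := LinearMap.finrank_range_add_finrank_ker (Ds s)
    omega
  have hrange : LinearMap.range Db ≤ Submodule.span F (Set.range fun p : Fin k × Fin N => π ((X ^ (p.2 : ℕ) : F[X]) • (bN p.1 : M))) := by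
    rintro _ ⟨v, rfl⟩
    obtain ⟨m, rfl⟩ := hπ v
    rw [← hDb]
    obtain ⟨y, hy⟩ : ∃ y : LinearMap.range D, (y : M) = D m := ⟨⟨D m, LinearMap.mem_range_self D m⟩, rfl⟩
    have : D m = ∑ i, bN.repr y i • (bN i : M) := by
      rw [← hy]
      conv_lhs => rw [← bN.sum_repr y]
      rw [Submodule.coe_sum]
      rfl
    rw [this, map_sum]
    refine Submodule.sum_mem _ fun i _ => ?_
    generalize bN.repr y i = p
    rw [p.as_sum_range_C_mul_X_pow, Finset.sum_smul, map_sum]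
    refine Submodule.sum_mem _ fun j _ => ?_
    rw [mul_smul, ← Polynomial.algebraMap_eq, algebraMap_smul, map_smul]
    refine Submodule.smul_mem _ _ ?_
    by_cases hj : j < N
    · exact Submodule.subset_span ⟨(i, ⟨j, hj⟩), rfl⟩
    · obtain ⟨c, rfl⟩ := Nat.exists_eq_add_of_le (not_lt.1 hj)
      rw [pow_add, mul_smul, hπN]
      exact Submodule.zero_mem _
  refine ⟨k, ?_, ?_, fun hle => ?_⟩
  · have hp : (∏ i, a i) ≠ 0 := Finset.prod_ne_zero_iff.2 fun i _ => ha i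
    obtain ⟨s, hs⟩ : ∃ s, (∏ i, a i).eval s ≠ 0 := by
      by_contra hcon
      push Not at hcon
      exact hp (Polynomial.funext fun s => by rw [hcon s, eval_zero])
    rw [eval_prod] at hs
    exact ⟨s, key s fun i => Finset.prod_ne_zero_iff.1 hs i (Finset.mem_univ i)⟩
  · refine (Submodule.finrank_mono hrange).trans ((finrank_range_le_card _).trans ?_)
    simp [mul_comm]
  · refine key 0 fun i0 h0 => ?_
    obtain ⟨q, hq⟩ : X ∣ a i0 := by rwa [X_dvd_iff, coeff_zero_eq_eval_zero]
    let j0 : Fin N := ⟨N - 1, by omega⟩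
    have hz : π ((X ^ (j0 : ℕ) : F[X]) • (bN i0 : M)) = 0 := by
      rw [snf, hq, smul_smul, ← mul_assoc, ← pow_succ, show ((j0 : ℕ) + 1) = N by simp [j0]; omega, mul_smul, hπN]
    have hr2 : LinearMap.range Db ≤ Submodule.span F (Set.range fun p : {p : Fin k × Fin N // p ≠ (i0, j0)} => 
        π ((X ^ (p.1.2 : ℕ) : F[X]) • (bN p.1.1 : M))) := by
      refine hrange.trans (Submodule.span_le.2 ?_)
      rintro _ ⟨p, rfl⟩
      by_cases hp : p = (i0, j0)
      · subst hp
        change π ((X ^ (j0 : ℕ) : F[X]) • (bN i0 : M)) ∈ _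
        rw [hz]; exact Submodule.zero_mem _
      · exact Submodule.subset_span ⟨⟨p, hp⟩, rfl⟩
    have h3 := (Submodule.finrank_mono hr2).trans (finrank_range_le_card _)
    rw [Fintype.card_subtype_compl, Fintype.card_subtype_eq] at h3
    simp only [Fintype.card_prod, Fintype.card_fin] at h3
    have : 0 < k * N := Nat.mul_pos (by have := i0.2; omega) hN
    rw [mul_comm] at hle
    omega
end Smith

section Red
variable {F : Type*} [Field F] {g : Type*} [LieRing g] [LieAlgebra F g]
  {A B : Type*} [CommRing A] [Algebra F A] [CommRing B] [Algebra F B]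

lemma rT_lie (φ : A →ₐ[F] B) (x y : A ⊗[F] g) :
    φ.toLinearMap.rTensor g ⁅x, y⁆ = ⁅φ.toLinearMap.rTensor g x, φ.toLinearMap.rTensor g y⁆ := by
  induction x using TensorProduct.induction_on with
  | zero => simp
  | add a b ha hb => rw [add_lie, map_add, map_add, ha, hb, add_lie]
  | tmul a u =>
    induction y using TensorProduct.induction_on with
    | zero => simp
    | add a b ha hb => rw [lie_add, map_add, map_add, ha, hb, lie_add]
    | tmul b v => simp [LieAlgebra.ExtendScalars.bracket_tmul]

/-- reduction -/
noncomputable def redu (ε : A →ₐ[F] F) : A ⊗[F] g →ₗ[F] g := (TensorProduct.lid F g).toLinearMap ∘ₗ ε.toLinearMap.rTensor g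

@[simp] lemma redu_tmul (ε : A →ₐ[F] F) (a : A) (x : g) : redu ε (a ⊗ₜ[F] x) = ε a • x := by simp [redu]

lemma redu_lie (ε : A →ₐ[F] F) (x y : A ⊗[F] g) : redu ε ⁅x, y⁆ = ⁅redu ε x, redu ε y⁆ := by
  induction x using TensorProduct.induction_on with
  | zero => simp
  | add a b ha hb => rw [add_lie, map_add, map_add, ha, hb, add_lie]
  | tmul a u =>
    induction y using TensorProduct.induction_on with
    | zero => simp
    | add a b ha hb => rw [lie_add, map_add, map_add, ha, hb, lie_add]
    | tmul b v => simp [LieAlgebra.ExtendScalars.bracket_tmul, smul_smul, mul_comm]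

lemma redu_sub_mem (ε : A →ₐ[F] F) (X : A ⊗[F] g) : X - (1 : A) ⊗ₜ[F] redu ε X ∈ Fil F g (RingHom.ker ε) := by
  induction X using TensorProduct.induction_on with
  | zero => simp
  | add a b ha hb =>
    rw [map_add, TensorProduct.tmul_add, add_sub_add_comm]
    exact Submodule.add_mem _ ha hb
  | tmul a x =>
    have : a ⊗ₜ[F] x - (1 : A) ⊗ₜ[F] redu ε (a ⊗ₜ[F] x) = (a - algebraMap F A (ε a)) • ((1 : A) ⊗ₜ[F] x) := by
      rw [redu_tmul, TensorProduct.tmul_smul, sub_smul, algebraMap_smul, TensorProduct.smul_tmul' a, smul_eq_mul, mul_one]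
    rw [this]
    exact Submodule.smul_mem_smul (by simp [RingHom.mem_ker]) trivial

lemma redu_rT (φ : A →ₐ[F] B) (ε : B →ₐ[F] F) (x : A ⊗[F] g) : redu ε (φ.toLinearMap.rTensor g x) = redu (ε.comp φ) x := by
  induction x using TensorProduct.induction_on with
  | zero => simp
  | add a b ha hb => rw [map_add, map_add, ha, hb, map_add]
  | tmul a u => simp

/-- the inductive statement -/
def Good (F : Type*) [Field F] (g : Type*) [LieRing g] [LieAlgebra F g] {A : Type*} [CommRing A] [Algebra F A] (r : ℕ) (ε : A →ₐ[F] F) : Prop :=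
  ∀ X : A ⊗[F] g, Module.finrank F A * r ≤ Module.finrank F (cent F (A ⊗[F] g) X) ∧
    (Module.finrank F (cent F (A ⊗[F] g) X) ≤ Module.finrank F A * r → Module.finrank F (cent F g (redu ε X)) ≤ r)

lemma good_base [FiniteDimensional F g] [FiniteDimensional F A] (r : ℕ) (hr : ∀ x : g, r ≤ Module.finrank F (cent F g x)) (ε : A →ₐ[F] F)
    (h1 : Module.finrank F A = 1) : Good F g r ε := by
  intro X
  rw [h1, one_mul]
  have hs : Function.Surjective (redu (g := g) ε) := fun x => ⟨(1 : A) ⊗ₜ[F] x, by simp⟩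
  have hd : Module.finrank F (A ⊗[F] g) = Module.finrank F g := by
    rw [Module.finrank_tensorProduct, h1, one_mul]
  have hi := (LinearMap.injective_iff_surjective_of_finrank_eq_finrank hd).2 hs
  let e := LinearEquiv.ofBijective (redu (g := g) ε) ⟨hi, hs⟩
  have : cent F (A ⊗[F] g) X = (cent F g (redu ε X)).comap e.toLinearMap := by
    ext y
    change ⁅X, y⁆ = 0 ↔ ⁅redu ε X, redu ε y⁆ = 0
    rw [← redu_lie, map_eq_zero_iff _ hi]
  have h2 : Module.finrank F (cent F (A ⊗[F] g) X) = Module.finrank F (cent F g (redu ε X)) := by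
    rw [this, Submodule.comap_equiv_eq_map_symm]
    exact LinearEquiv.finrank_map_eq _ _
  rw [h2]
  exact ⟨hr _, id⟩
end Red
end

section
open scoped TensorProduct
set_option linter.unusedSectionVars false
set_option linter.unusedVariables false

section Step
open Polynomial
variable {F : Type*} [Field F] [CharZero F] {g : Type*} [LieRing g] [LieAlgebra F g] [FiniteDimensional F g]
  {B C : Type*} [CommRing B] [Algebra F B] [CommRing C] [Algebra F C] [FiniteDimensional F B] [FiniteDimensional F C]

variable {Q : Type*} [CommRing Q] [Algebra F Q] [Algebra F[X] Q] [IsScalarTower F F[X] Q]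

/-- ad over polynomials -/
noncomputable def adP (X : Q ⊗[F] g) : Q ⊗[F] g →ₗ[F[X]] Q ⊗[F] g where
  toFun y := ⁅X, y⁆
  map_add' := lie_add X
  map_smul' p y := by
    rw [← algebraMap_smul Q p y, lie_smul, algebraMap_smul]; rfl

lemma rT_smul {D : Type*} [CommRing D] [Algebra F D] (ψ : Q →ₐ[F] D) (p : F[X]) (m : Q ⊗[F] g) :
    ψ.toLinearMap.rTensor g (p • m) = ψ (algebraMap F[X] Q p) • ψ.toLinearMap.rTensor g m := by
  induction m using TensorProduct.induction_on with
  | zero => simp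
  | add a b ha hb => rw [smul_add, map_add, map_add, ha, hb, smul_add]
  | tmul q x =>
    rw [← algebraMap_smul Q p, TensorProduct.smul_tmul', LinearMap.rTensor_tmul, LinearMap.rTensor_tmul, TensorProduct.smul_tmul']
    simp

lemma cent_add_range {L : Type*} [LieRing L] [LieAlgebra F L] [FiniteDimensional F L] (x : L) :
    Module.finrank F (LinearMap.range (LieAlgebra.ad F L x : Module.End F L)) + Module.finrank F (cent F L x) = Module.finrank F L := 
  LinearMap.finrank_range_add_finrank_ker (LieAlgebra.ad F L x : Module.End F L)

lemma good_step_aux [Module.Free F[X] Q] [Module.Finite F[X] Q] (hQ : Module.finrank F[X] Q = Module.finrank F B)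
    (r : ℕ) (εB : B →ₐ[F] F) (εC : C →ₐ[F] F) (N : ℕ) (hN : 0 < N) 
    (ψ : Q →ₐ[F] C) (ev : F → Q →ₐ[F] B) (hψ : Function.Surjective ψ) (hev : ∀ s, Function.Surjective (ev s))
    (hψN : ψ (algebraMap F[X] Q (X ^ N)) = 0) (hevp : ∀ s p, ev s (algebraMap F[X] Q p) = algebraMap F B (p.eval s))
    (hε : εB.comp (ev 0) = εC.comp ψ)
    (hdim : Module.finrank F C = N * Module.finrank F B) (hB : Good F g r εB) : Good F g r εC := by
  intro X0
  have hψs : Function.Surjective (ψ.toLinearMap.rTensor g) := LinearMap.rTensor_surjective g hψ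
  have hevs : ∀ s, Function.Surjective ((ev s).toLinearMap.rTensor g) := fun s => LinearMap.rTensor_surjective g (hev s)
  obtain ⟨Xt, hXt⟩ := hψs X0
  have hn : Module.finrank F[X] (Q ⊗[F] g) = Module.finrank F (B ⊗[F] g) := by
    rw [Module.finrank_tensorProduct, Module.finrank_tensorProduct, hQ]
  have b : Module.Basis (Fin (Module.finrank F (B ⊗[F] g))) F[X] (Q ⊗[F] g) := by
    have : Module.Finite F[X] (Q ⊗[F] g) := Module.Finite.of_basis ((Module.finBasis F[X] Q).tensorProduct (Module.finBasis F g))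
    rw [← hn]; exact Module.finBasis F[X] (Q ⊗[F] g)
  obtain ⟨k, ⟨s, k1⟩, k2, k3⟩ := smith_rank b (V := B ⊗[F] g) rfl (fun s => (ev s).toLinearMap.rTensor g) hevs
    (fun s p m => by rw [rT_smul, hevp, algebraMap_smul])
    (adP Xt) (fun s => (LieAlgebra.ad F (B ⊗[F] g) ((ev s).toLinearMap.rTensor g Xt) : Module.End F (B ⊗[F] g))) 
    (fun s m => rT_lie (ev s) Xt m) (L := C ⊗[F] g) N hN (ψ.toLinearMap.rTensor g) hψs 
    (fun m => by rw [rT_smul, hψN, zero_smul])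
    (LieAlgebra.ad F (C ⊗[F] g) X0 : Module.End F (C ⊗[F] g)) (fun m => by rw [← hXt]; exact rT_lie ψ Xt m)
  have hc := cent_add_range (F := F) X0
  rw [Module.finrank_tensorProduct, hdim] at hc
  rw [Module.finrank_tensorProduct] at k1 k3
  rw [hdim]
  have q1 := (hB ((ev s).toLinearMap.rTensor g Xt)).1
  have q2 := hB ((ev 0).toLinearMap.rTensor g Xt)
  rw [cent_eq_ker] at q1 q2
  rw [redu_rT] at q2
  have q3 : redu (εB.comp (ev 0)) Xt = redu εC X0 := by
    rw [← hXt, redu_rT, hε]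
  rw [q3] at q2
  set n := Module.finrank F B * Module.finrank F g
  set d := Module.finrank F B * r with hd
  have hdk : d + k ≤ n := by omega
  have h5 : N * d + N * k ≤ N * n := by rw [← mul_add]; exact Nat.mul_le_mul_left N hdk
  rw [mul_assoc] at hc
  rw [mul_assoc, ← hd]
  change _ + _ = N * n at hc
  refine ⟨by omega, fun hle => q2.2 ?_⟩
  have h6 : N * n ≤ N * (d + k) := by rw [mul_add]; omega
  have h7 : n ≤ d + k := Nat.le_of_mul_le_mul_left h6 hN
  have h8 := k3 (by 
    have : n = d + k := by omega
    have : N * n = N * d + N * k := by rw [this, mul_add]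
    omega)
  omega

lemma good_step (r : ℕ) (εB : B →ₐ[F] F) (εC : C →ₐ[F] F) (φ : B →ₐ[F] C) (t : C) (N : ℕ) (hN : 0 < N) (ht : t ^ N = 0)
    (hεt : εC t = 0) (hε : ∀ b, εC (φ b) = εB b) 
    (hs : Function.Surjective (Algebra.TensorProduct.productMap (aeval t : F[X] →ₐ[F] C) φ))
    (hdim : Module.finrank F C = N * Module.finrank F B) (hB : Good F g r εB) : Good F g r εC := by
  refine good_step_aux (Q := F[X] ⊗[F] B) Module.finrank_baseChange r εB εC N hN
    (Algebra.TensorProduct.productMap (aeval t : F[X] →ₐ[F] C) φ) 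
    (fun s => Algebra.TensorProduct.productMap ((Algebra.ofId F B).comp (aeval s : F[X] →ₐ[F] F)) (AlgHom.id F B))
    hs (fun s b => ⟨1 ⊗ₜ b, by simp⟩) ?_ (fun s p => ?_) ?_ hdim hB
  · simp [Algebra.TensorProduct.algebraMap_apply, ht]
  · simp [Algebra.TensorProduct.algebraMap_apply, Algebra.ofId_apply]
  · refine Algebra.TensorProduct.ext (Polynomial.algHom_ext ?_) (AlgHom.ext fun b => ?_)
    · simp [hεt]
    · simp [hε]
end Step
end

section
open scoped TensorProduct
set_option linter.unusedSectionVars false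
set_option linter.unusedVariables false

section Trunc
variable {F : Type*} [Field F] {ℓ : ℕ} (μ : Fin ℓ → ℕ)

lemma mem_truncIdeal (f : MvPolynomial (Fin ℓ) F) : f ∈ truncIdeal F μ ↔ ∀ ω : Fin ℓ →₀ ℕ, (⇑ω ≤ μ) → f.coeff ω = 0 := by
  have h1 : truncIdeal F μ = Ideal.span ((fun s : Fin ℓ →₀ ℕ => MvPolynomial.monomial s (1 : F)) '' {s | ¬ (⇑s ≤ μ)}) := by
    unfold truncIdeal
    congr 1
    ext p
    constructor
    · rintro ⟨ω, hω, rfl⟩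
      exact ⟨Finsupp.equivFunOnFinite.symm ω, by simpa using hω, rfl⟩
    · rintro ⟨ω, hω, rfl⟩
      exact ⟨⇑ω, hω, by simp⟩
  rw [h1, MvPolynomial.mem_ideal_span_monomial_image]
  constructor
  · intro h ω hω
    by_contra hne
    obtain ⟨s, hs, hle⟩ := h ω (MvPolynomial.mem_support_iff.2 hne)
    exact hs (le_trans hle hω)
  · intro h ω hω
    refine ⟨ω, fun hle => MvPolynomial.mem_support_iff.1 hω (h ω hle), le_rfl⟩

/-- coefficients -/
noncomputable def coefMap : MvPolynomial (Fin ℓ) F →ₗ[F] (Finset.Iic μ → F) :=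
  LinearMap.pi fun ω => MvPolynomial.lcoeff F (Finsupp.equivFunOnFinite.symm ω.1)

lemma ker_coefMap : LinearMap.ker (coefMap (F := F) μ) = (truncIdeal F μ).restrictScalars F := by
  ext f
  rw [Submodule.restrictScalars_mem, mem_truncIdeal, LinearMap.mem_ker]
  constructor
  · intro h ω hω
    have := congrFun h ⟨⇑ω, Finset.mem_Iic.2 hω⟩
    simpa [coefMap] using this
  · intro h
    funext ω
    exact h (Finsupp.equivFunOnFinite.symm ω.1) (by simpa using Finset.mem_Iic.1 ω.2)

lemma coefMap_surj : Function.Surjective (coefMap (F := F) μ) := by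
  classical
  intro c
  refine ⟨∑ ω, MvPolynomial.monomial (Finsupp.equivFunOnFinite.symm ω.1) (c ω), ?_⟩
  funext ω
  simp only [coefMap, LinearMap.pi_apply, map_sum, MvPolynomial.lcoeff_apply, MvPolynomial.coeff_monomial]
  rw [Finset.sum_eq_single ω]
  · simp
  · intro b _ hb
    rw [if_neg]
    intro h
    exact hb (Subtype.ext (Finsupp.equivFunOnFinite.symm.injective h))
  · simp

/-- the coefficient equivalence -/
noncomputable def truncEquiv : trunc F μ ≃ₗ[F] (Finset.Iic μ → F) :=
  (Submodule.Quotient.restrictScalarsEquiv F (truncIdeal F μ)).symm.trans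
    ((Submodule.quotEquivOfEq _ _ (ker_coefMap μ).symm).trans ((coefMap (F := F) μ).quotKerEquivOfSurjective (coefMap_surj μ)))

instance trunc_fin : FiniteDimensional F (trunc F μ) := Module.Finite.equiv (truncEquiv μ).symm

lemma trunc_finrank : Module.finrank F (trunc F μ) = ∏ i, (μ i + 1) := by
  rw [(truncEquiv μ).finrank_eq, Module.finrank_fintype_fun_eq_card, Fintype.card_coe, Pi.card_Iic]
  simp

/-- augmentation -/
noncomputable def augm : trunc F μ →ₐ[F] F :=
  Ideal.Quotient.liftₐ (truncIdeal F μ) (MvPolynomial.aeval (fun _ => (0 : F))) (fun f hf => by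
    have := (mem_truncIdeal μ f).1 hf 0 (fun i => Nat.zero_le _)
    rw [MvPolynomial.aeval_zero', ← MvPolynomial.constantCoeff_eq] at *
    simp [this])

@[simp] lemma augm_X (i : Fin ℓ) : augm (F := F) μ (Ideal.Quotient.mk _ (MvPolynomial.X i)) = 0 := by
  change MvPolynomial.aeval (fun _ => (0 : F)) (MvPolynomial.X i) = 0
  simp

lemma X_pow (i : Fin ℓ) : (Ideal.Quotient.mk (truncIdeal F μ) (MvPolynomial.X i)) ^ (μ i + 1) = 0 := by
  rw [← map_pow, Ideal.Quotient.eq_zero_iff_mem, mem_truncIdeal]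
  intro ω hω
  rw [MvPolynomial.coeff_X_pow, if_neg]
  rintro rfl
  have := hω i
  simp at this

lemma ker_augm_nil : IsNilpotent (RingHom.ker (augm (F := F) μ)) := by
  have : IsNoetherianRing (trunc F μ) := inferInstance
  rw [Ideal.FG.isNilpotent_iff_le_nilradical (IsNoetherian.noetherian _)]
  have key : ∀ f : MvPolynomial (Fin ℓ) F, Ideal.Quotient.mk (truncIdeal F μ) f - 
      algebraMap F (trunc F μ) (augm μ (Ideal.Quotient.mk (truncIdeal F μ) f)) ∈ nilradical (trunc F μ) := by
    intro f
    induction f using MvPolynomial.induction_on with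
    | C a =>
      have : Ideal.Quotient.mk (truncIdeal F μ) (MvPolynomial.C a) = algebraMap F (trunc F μ) a := rfl
      rw [this, AlgHom.commutes]
      simp
    | add p q hp hq =>
      rw [map_add, map_add, map_add, add_sub_add_comm]
      exact Ideal.add_mem _ hp hq
    | mul_X p i hp =>
      rw [map_mul, map_mul, augm_X, mul_zero, map_zero, sub_zero]
      exact Ideal.mul_mem_left _ _ ⟨_, X_pow μ i⟩
  intro x hx
  obtain ⟨f, rfl⟩ := Ideal.Quotient.mk_surjective x
  have := key f
  rw [(RingHom.mem_ker).1 hx, map_zero, sub_zero] at this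
  exact this
end Trunc

section TruncStep
variable {F : Type*} [Field F] {ℓ : ℕ} (μ : Fin (ℓ + 1) → ℕ)

/-- inclusion -/
noncomputable def inclT : trunc F (fun i => μ (Fin.succ i)) →ₐ[F] trunc F μ :=
  Ideal.Quotient.liftₐ _ ((Ideal.Quotient.mkₐ F (truncIdeal F μ)).comp (MvPolynomial.rename Fin.succ)) (fun f hf => by
    change Ideal.Quotient.mk _ (MvPolynomial.rename Fin.succ f) = 0
    rw [Ideal.Quotient.eq_zero_iff_mem, mem_truncIdeal]
    intro ω hω
    by_contra hne
    obtain ⟨u, hu, hcu⟩ := MvPolynomial.coeff_rename_ne_zero _ _ _ hne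
    refine hcu ((mem_truncIdeal _ f).1 hf u fun i => ?_)
    have := hω i.succ
    rw [← hu, Finsupp.mapDomain_apply (Fin.succ_injective ℓ)] at this
    exact this)

lemma inclT_mk (f : MvPolynomial (Fin ℓ) F) : inclT (F := F) μ (Ideal.Quotient.mk _ f) = Ideal.Quotient.mk _ (MvPolynomial.rename Fin.succ f) := rfl

lemma trunc_surj : Function.Surjective (Algebra.TensorProduct.productMap 
    (Polynomial.aeval (Ideal.Quotient.mk (truncIdeal F μ) (MvPolynomial.X 0)) : Polynomial F →ₐ[F] trunc F μ) (inclT (F := F) μ)) := by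
  intro x
  obtain ⟨f, rfl⟩ := Ideal.Quotient.mk_surjective x
  rw [← AlgHom.mem_range]
  induction f using MvPolynomial.induction_on with
  | C a => exact Subalgebra.algebraMap_mem _ a
  | add p q hp hq => rw [map_add]; exact Subalgebra.add_mem _ hp hq
  | mul_X p i hp =>
    rw [map_mul]
    refine Subalgebra.mul_mem _ hp ?_
    refine Fin.cases ?_ (fun i => ?_) i
    · exact ⟨Polynomial.X ⊗ₜ 1, by simp⟩
    · exact ⟨1 ⊗ₜ (Ideal.Quotient.mk _ (MvPolynomial.X i)), by simp [inclT_mk]⟩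

lemma augm_inclT (b : trunc F (fun i => μ (Fin.succ i))) : augm μ (inclT (F := F) μ b) = augm _ b := by
  obtain ⟨f, rfl⟩ := Ideal.Quotient.mk_surjective b
  rw [inclT_mk]
  change MvPolynomial.aeval (fun _ => (0 : F)) (MvPolynomial.rename Fin.succ f) = MvPolynomial.aeval (fun _ => (0 : F)) f
  rw [MvPolynomial.aeval_rename]
  rfl
end TruncStep

section Fin
variable {F : Type*} [Field F] [CharZero F] {g : Type*} [LieRing g] [LieAlgebra F g] [FiniteDimensional F g]

lemma good_trunc (r : ℕ) (hr : ∀ x : g, r ≤ Module.finrank F (cent F g x)) {ℓ : ℕ} (μ : Fin ℓ → ℕ) : Good F g r (augm (F := F) μ) := by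
  induction ℓ with
  | zero => exact good_base r hr _ (by rw [trunc_finrank]; simp)
  | succ ℓ ih =>
    refine good_step r (augm (fun i => μ (Fin.succ i))) (augm μ) (inclT μ) (Ideal.Quotient.mk (truncIdeal F μ) (MvPolynomial.X 0)) (μ 0 + 1)
      (Nat.succ_pos _) (X_pow μ 0) (augm_X μ 0) (augm_inclT μ) (trunc_surj μ) ?_ (ih _)
    rw [trunc_finrank, trunc_finrank, Fin.prod_univ_succ]

lemma cent_one {A : Type*} [CommRing A] [Algebra F A] [FiniteDimensional F A] (x : g) :
    Module.finrank F (cent F (A ⊗[F] g) ((1 : A) ⊗ₜ[F] x)) ≤ Module.finrank F A * Module.finrank F (cent F g x) := by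
  have h1 : (LieAlgebra.ad F (A ⊗[F] g) ((1 : A) ⊗ₜ[F] x) : Module.End F (A ⊗[F] g)) = LinearMap.lTensor A (LieAlgebra.ad F g x : Module.End F g) := by
    refine TensorProduct.ext' fun a y => ?_
    simp [LieAlgebra.ExtendScalars.bracket_tmul]
  rw [cent_eq_ker, h1, cent_eq_ker]
  have h2 := Module.Flat.lTensor_exact A (LinearMap.exact_subtype_ker_map (LieAlgebra.ad F g x : Module.End F g))
  rw [LinearMap.exact_iff.1 h2, ← Module.finrank_tensorProduct]
  exact LinearMap.finrank_range_le _
end Fin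
end

set_option synthInstance.maxHeartbeats 1000000 in
/-- Let `F` be an algebraically closed field of characteristic zero,
`g` a semisimple Lie algebra over `F`, `μ ∈ ℕ^ℓ`, `A = F[t₁,…,t_ℓ]/⟨t^ω : ω ≰ μ⟩`, and
let `(x₊, x₋, h)` be a principal `sl₂`-triple of `g` (so `⁅h, x₊⁆ = 2x₊`,
`⁅h, x₋⁆ = -2x₋`, `⁅x₊, x₋⁆ = h`, with `x₊, x₋, h` regular).  Let `X` be a regular
element of `g ⊗ A`.  Then the orbit of `X` under the adjoint group of `g ⊗ A` meets the
affine subspace `t = x₊ ⊗ 1 + g^{x₋} ⊗ A`. -/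
theorem statement12 {F : Type*} [Field F] [CharZero F] [IsAlgClosed F]
    {g : Type*} [LieRing g] [LieAlgebra F g] [FiniteDimensional F g]
    [LieAlgebra.IsSemisimple F g]
    {ℓ : ℕ} (μ : Fin ℓ → ℕ)
    (xp xm h : g)
    (hhp : ⁅h, xp⁆ = 2 • xp) (hhm : ⁅h, xm⁆ = -(2 • xm)) (hpm : ⁅xp, xm⁆ = h)
    (hpreg : isRegular F g xp) (hmreg : isRegular F g xm) (hhreg : isRegular F g h)
    (X : trunc F μ ⊗[F] g) (hX : isRegular F (trunc F μ ⊗[F] g) X) :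
    ∃ Y, reach F (trunc F μ ⊗[F] g) X Y ∧ Y ∈ tSlice F xp xm := by
  have hp : ⁅h, xp⁆ = (2 : F) • xp := by
    rw [hhp, ← Nat.cast_smul_eq_nsmul F]; norm_num
  have hm : ⁅h, xm⁆ = (-2 : F) • xm := by
    rw [hhm, ← Nat.cast_smul_eq_nsmul F, ← neg_smul]; norm_num
  obtain ⟨H, _, hh, R, ⟨P⟩⟩ := exists_prin hp hm hpm hpreg hhreg
  have h1 := (good_trunc (F := F) (g := g) (Module.finrank F (cent F g xp)) (fun z => hpreg.le z) μ X).2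
    ((hX.le ((1 : trunc F μ) ⊗ₜ[F] xp)).trans (cent_one xp))
  obtain ⟨a, ha, ha0, hI⟩ := P.reg_slice (redu (augm μ) X) (fun z => h1.trans (hpreg.le z))
  obtain ⟨X', h2, h3⟩ := lift_inn hI (RingHom.ker (augm μ)) X (redu_sub_mem _ X)
  obtain ⟨Y, h4, h5⟩ := slice_lift ha (P.transv a ha0) (ker_augm_nil μ) X' h3
  obtain ⟨θ, h6, rfl⟩ := h2.trans h4
  exact ⟨_, h6.reach X, h5⟩
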